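/- (One-dimensional marginals of Theorem 3.1 of the paper, stated via characteristic functions.) Fix α ∈ (0,1)∪(1,2), β ∈ [−1,1], γ = 1/α, and define W_n(t)(y,ω) = n^{−γ}·d_α^{−γ}·(Σ_{j=0}^{⌊nt⌋−1} ω_j·τ(F^j(y)) − n·t·β·ℓ_α) on the product probability space (Y × {−1,1}^ℕ, μ_Y ⊗ ν_β^{⊗ℕ}). Then for every t ≥ 0 and every s ∈ ℝ, ∫ exp( i·s·W_n(t) ) d(μ_Y ⊗ ν_β^{⊗ℕ}) → exp( −t·|s|^α·(1 − i·β·sgn(s)·tan(απ/2)) ) as n → ∞; that is, for each fixed t the random variable W_n(t) converges in distribution to W_{α,1,β}(t) = t^{1/α}·X_{α,1,β}, the time-t marginal of the α-stable Lévy process. -/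

import Mathlib

open Real Set MeasureTheory Filter Topology

noncomputable section

/-- The common branch formula of the Thaler map:
`g(x) = (x^(1-γ) + (1+x)^(1-γ) − 1)^(1/(1-γ))` (real powers). -/
def thalerG (γ x : ℝ) : ℝ := (x ^ (1 - γ) + (1 + x) ^ (1 - γ) - 1) ^ (1 / (1 - γ))

/-- The Thaler map with branch point `xs`: `T 0 = 0`, `T x = g x` on `(0, xs]` and
`T x = g x − 1` on `(xs, 1]`. -/
def thalerT (γ xs : ℝ) (x : ℝ) : ℝ :=
  if x ≤ 0 then 0 else if x ≤ xs then thalerG γ x else thalerG γ x - 1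

/-- The invariant density `h(x) = x^(-γ) + (x+1)^(-γ)`. -/
def thalerH (γ x : ℝ) : ℝ := x ^ (-γ) + (x + 1) ^ (-γ)

/-- The measure `μ` on `[0,1]` with density `h` with respect to Lebesgue measure. -/
def thalerMu (γ : ℝ) : Measure ℝ :=
  (volume.restrict (Set.Icc (0 : ℝ) 1)).withDensity fun x => ENNReal.ofReal (thalerH γ x)

/-- The normalized restriction `μ_Y = μ|_Y / μ(Y)` of `μ` to `Y = (xs,1]`. -/
def thalerMuY (γ xs : ℝ) : Measure ℝ :=
  (thalerMu γ (Set.Ioc xs 1))⁻¹ • (thalerMu γ).restrict (Set.Ioc xs 1)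

/-- The first return time `τ(y) = inf{n ≥ 1 : T^n y ∈ Y}` to `Y = (xs, 1]`. -/
def thalerTau (γ xs : ℝ) (y : ℝ) : ℕ :=
  sInf {n : ℕ | 1 ≤ n ∧ (thalerT γ xs)^[n] y ∈ Set.Ioc xs 1}

/-- The first return map `F(y) = T^(τ(y))(y)`. -/
def thalerF (γ xs : ℝ) (y : ℝ) : ℝ := (thalerT γ xs)^[thalerTau γ xs y] y

/-- `g_α = Γ(1−α)·cos(απ/2)`. -/
def stableGa (α : ℝ) : ℝ := Real.Gamma (1 - α) * Real.cos (α * π / 2)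

/-- `d_α = α^α·((1−γ)/(2^(1−γ)−1))·g_α` with `γ = 1/α`. -/
def stableDa (α : ℝ) : ℝ := α ^ α * ((1 - α⁻¹) / (2 ^ (1 - α⁻¹) - 1)) * stableGa α

/-- `ℓ_α = 0` for `α ∈ (0,1)` and `ℓ_α = (1 − 2^(γ−1))⁻¹` for `α ∈ (1,2)`, `γ = 1/α`. -/
def stableLa (α : ℝ) : ℝ := if α < 1 then 0 else (1 - 2 ^ (α⁻¹ - 1))⁻¹

section Branch

variable {γ xs x : ℝ}

theorem thalerBase_pos (hx : x ∈ Ioc (0 : ℝ) 1) :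
    0 < x ^ (1 - γ) + (1 + x) ^ (1 - γ) - 1 := by
  obtain ⟨h0, h1⟩ := hx
  rcases le_or_gt 0 (1 - γ) with h | h
  · have := Real.rpow_pos_of_pos h0 (1 - γ)
    have := Real.one_le_rpow (by linarith : (1 : ℝ) ≤ 1 + x) h
    linarith
  · have := Real.rpow_pos_of_pos (by linarith : 0 < 1 + x) (1 - γ)
    have := Real.one_le_rpow_of_pos_of_le_one_of_nonpos h0 h1 h.le
    linarith

theorem thalerG_pos (hx : x ∈ Ioc (0 : ℝ) 1) : 0 < thalerG γ x :=
  Real.rpow_pos_of_pos (thalerBase_pos hx) _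

theorem thalerG_rpow (hγ : γ ≠ 1) (hx : x ∈ Ioc (0 : ℝ) 1) :
    thalerG γ x ^ (1 - γ) = x ^ (1 - γ) + (1 + x) ^ (1 - γ) - 1 := by
  rw [thalerG, one_div, Real.rpow_inv_rpow (thalerBase_pos hx).le (sub_ne_zero.2 hγ.symm)]

theorem thalerH_pos (hx : 0 < x) : 0 < thalerH γ x := by
  have := Real.rpow_pos_of_pos hx (-γ)
  have := Real.rpow_pos_of_pos (by linarith : 0 < x + 1) (-γ)
  unfold thalerH; linarith

theorem hasDerivAt_thalerG (hγ : γ ≠ 1) (hx : x ∈ Ioc (0 : ℝ) 1) :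
    HasDerivAt (thalerG γ) (thalerG γ x ^ γ * thalerH γ x) x := by
  have he : 1 - γ ≠ 0 := sub_ne_zero.2 hγ.symm
  have hB := thalerBase_pos (γ := γ) hx
  have h1 : HasDerivAt (fun y : ℝ => y ^ (1 - γ) + (1 + y) ^ (1 - γ) - 1)
      ((1 - γ) * thalerH γ x) x := by
    have a := Real.hasDerivAt_rpow_const (x := x) (p := 1 - γ) (Or.inl hx.1.ne')
    have b := ((hasDerivAt_id x).const_add 1).rpow_const (p := 1 - γ)
      (Or.inl (by simp only [id]; linarith [hx.1]))
    refine ((a.add b).sub_const 1).congr_deriv ?_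
    simp only [id, thalerH, add_comm x 1]
    rw [show 1 - γ - 1 = -γ by ring]; ring
  refine (h1.rpow_const (p := 1 / (1 - γ)) (Or.inl hB.ne')).congr_deriv ?_
  rw [thalerG, ← Real.rpow_mul hB.le, show 1 / (1 - γ) * γ = 1 / (1 - γ) - 1 by field_simp; ring]
  field_simp

theorem continuousOn_thalerG (hγ : γ ≠ 1) : ContinuousOn (thalerG γ) (Ioc 0 1) :=
  fun _ hx => (hasDerivAt_thalerG hγ hx).continuousAt.continuousWithinAt

theorem strictMonoOn_thalerG (hγ : γ ≠ 1) : StrictMonoOn (thalerG γ) (Ioc 0 1) := by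
  refine strictMonoOn_of_deriv_pos (convex_Ioc 0 1) (continuousOn_thalerG hγ) fun x hx => ?_
  have hx' := interior_subset hx
  rw [(hasDerivAt_thalerG hγ hx').deriv]
  exact mul_pos (Real.rpow_pos_of_pos (thalerG_pos hx') _) (thalerH_pos hx'.1)

theorem lt_thalerG (hγ : γ ≠ 1) (hx : x ∈ Ioc (0 : ℝ) 1) : x < thalerG γ x := by
  have h := thalerG_rpow hγ hx
  have hg := thalerG_pos (γ := γ) hx
  by_contra! hle
  rcases lt_or_gt_of_ne (sub_ne_zero.2 hγ.symm) with he | he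
  · have := Real.rpow_le_rpow_of_nonpos hg hle he.le
    have := Real.rpow_lt_one_of_one_lt_of_neg (by linarith [hx.1] : 1 < 1 + x) he
    linarith
  · have := Real.rpow_le_rpow hg.le hle he.le
    have := Real.one_lt_rpow (by linarith [hx.1] : 1 < 1 + x) he
    linarith

theorem thalerG_one (hγ : γ ≠ 1) : thalerG γ 1 = 2 := by
  have he : 1 - γ ≠ 0 := sub_ne_zero.2 hγ.symm
  rw [thalerG, Real.one_rpow, add_sub_cancel_left, one_div, Real.rpow_rpow_inv (by norm_num) he]
  norm_num

theorem thalerG_branchPoint (hxseq : xs ^ (1 - γ) + (1 + xs) ^ (1 - γ) = 2) :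
    thalerG γ xs = 1 := by
  rw [thalerG, hxseq]; norm_num

/-- The relative increment: `g x = x (1 + w x)^(1/(1-γ))`. -/
def thalerW (γ x : ℝ) : ℝ := ((1 + x) ^ (1 - γ) - 1) * x ^ (-(1 - γ))

theorem one_add_thalerW (hx : x ∈ Ioc (0 : ℝ) 1) :
    x ^ (1 - γ) * (1 + thalerW γ x) = x ^ (1 - γ) + (1 + x) ^ (1 - γ) - 1 := by
  have := (Real.rpow_pos_of_pos hx.1 (1 - γ)).ne'
  rw [thalerW, Real.rpow_neg hx.1.le]
  field_simp
  ring

theorem one_add_thalerW_pos (hx : x ∈ Ioc (0 : ℝ) 1) : 0 < 1 + thalerW γ x := by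
  have h := thalerBase_pos (γ := γ) hx
  rw [← one_add_thalerW hx] at h
  exact (mul_pos_iff_of_pos_left (Real.rpow_pos_of_pos hx.1 _)).1 h

theorem thalerG_eq (hγ : γ ≠ 1) (hx : x ∈ Ioc (0 : ℝ) 1) :
    thalerG γ x = x * (1 + thalerW γ x) ^ (1 / (1 - γ)) := by
  have he : 1 - γ ≠ 0 := sub_ne_zero.2 hγ.symm
  rw [thalerG, ← one_add_thalerW hx, Real.mul_rpow (Real.rpow_pos_of_pos hx.1 _).le
    (one_add_thalerW_pos hx).le, one_div, Real.rpow_rpow_inv hx.1.le he]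

theorem thalerW_ne_zero (hγ : γ ≠ 1) (hx : x ∈ Ioc (0 : ℝ) 1) : thalerW γ x ≠ 0 := by
  intro h
  have := lt_thalerG hγ hx
  rw [thalerG_eq hγ hx, h] at this
  simp at this

theorem Ioc_mem_nhdsGT_zero : Ioc (0 : ℝ) 1 ∈ 𝓝[>] (0 : ℝ) := Ioc_mem_nhdsGT one_pos

theorem tendsto_one_add_rpow_sub_one_div (p : ℝ) :
    Tendsto (fun t : ℝ => ((1 + t) ^ p - 1) / t) (𝓝[≠] 0) (𝓝 p) := by
  have h := ((hasDerivAt_id (0 : ℝ)).const_add 1).rpow_const (p := p) (Or.inl (by simp))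
  have := hasDerivAt_iff_tendsto_slope.1 h
  simp only [id, add_zero, Real.one_rpow, one_mul, mul_one] at this
  refine this.congr fun t => ?_
  simp [slope_def_field]

theorem tendsto_thalerW_div :
    Tendsto (fun x => thalerW γ x / x ^ γ) (𝓝[>] 0) (𝓝 (1 - γ)) := by
  refine ((tendsto_one_add_rpow_sub_one_div (1 - γ)).mono_left
    (nhdsWithin_mono 0 fun x (hx : 0 < x) => hx.ne')).congr' ?_
  filter_upwards [self_mem_nhdsWithin] with x (hx : 0 < x)
  rw [thalerW, mul_div_assoc, ← Real.rpow_sub hx, show -(1 - γ) - γ = -1 by ring,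
    Real.rpow_neg_one, div_eq_mul_inv]

theorem tendsto_rpow_nhdsGT_zero (hγ : 0 < γ) :
    Tendsto (fun x : ℝ => x ^ γ) (𝓝[>] 0) (𝓝 0) := by
  have := (Real.continuousAt_rpow_const 0 γ (Or.inr hγ.le)).tendsto
  rw [Real.zero_rpow hγ.ne'] at this
  exact this.mono_left nhdsWithin_le_nhds

theorem tendsto_thalerW (hγ : 0 < γ) (hγ1 : γ ≠ 1) :
    Tendsto (thalerW γ) (𝓝[>] 0) (𝓝[≠] 0) := by
  refine tendsto_nhdsWithin_iff.2 ⟨?_, ?_⟩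
  · have := (tendsto_thalerW_div (γ := γ)).mul (tendsto_rpow_nhdsGT_zero hγ)
    rw [mul_zero] at this
    refine this.congr' ?_
    filter_upwards [self_mem_nhdsWithin] with x (hx : 0 < x)
    exact div_mul_cancel₀ _ (Real.rpow_pos_of_pos hx _).ne'
  · filter_upwards [Ioc_mem_nhdsGT_zero] with x hx using thalerW_ne_zero hγ1 hx

theorem tendsto_thalerW_rpow (hγ : 0 < γ) (hγ1 : γ ≠ 1) (p : ℝ) :
    Tendsto (fun x => ((1 + thalerW γ x) ^ p - 1) / x ^ γ) (𝓝[>] 0) (𝓝 (p * (1 - γ))) := by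
  refine (((tendsto_one_add_rpow_sub_one_div p).comp (tendsto_thalerW hγ hγ1)).mul
    tendsto_thalerW_div).congr' ?_
  filter_upwards [Ioc_mem_nhdsGT_zero] with x hx
  have := thalerW_ne_zero hγ1 hx
  simp only [Function.comp]
  field_simp

theorem tendsto_thalerG_sub_div (hγ : 0 < γ) (hγ1 : γ ≠ 1) :
    Tendsto (fun x => (thalerG γ x - x) / x ^ (1 + γ)) (𝓝[>] 0) (𝓝 1) := by
  have h := tendsto_thalerW_rpow hγ hγ1 (1 / (1 - γ))
  rw [one_div, inv_mul_cancel₀ (sub_ne_zero.2 hγ1.symm), ← one_div] at h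
  refine h.congr' ?_
  filter_upwards [Ioc_mem_nhdsGT_zero] with x hx
  have := hx.1.ne'
  rw [thalerG_eq hγ1 hx, Real.rpow_add hx.1, Real.rpow_one]
  field_simp

theorem tendsto_rpow_neg_sub_thalerG (hγ : 0 < γ) (hγ1 : γ ≠ 1) :
    Tendsto (fun x => x ^ (-γ) - thalerG γ x ^ (-γ)) (𝓝[>] 0) (𝓝 γ) := by
  have he : 1 - γ ≠ 0 := sub_ne_zero.2 hγ1.symm
  have h := (tendsto_thalerW_rpow hγ hγ1 (1 / (1 - γ) * -γ)).neg
  rw [show -(1 / (1 - γ) * -γ * (1 - γ)) = γ by field_simp] at h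
  refine h.congr' ?_
  filter_upwards [Ioc_mem_nhdsGT_zero] with x hx
  rw [thalerG_eq hγ1 hx, Real.mul_rpow hx.1.le
    (Real.rpow_pos_of_pos (one_add_thalerW_pos hx) _).le,
    ← Real.rpow_mul (one_add_thalerW_pos hx).le, Real.rpow_neg hx.1.le]
  ring

theorem tendsto_thalerG_zero (hγ : 0 < γ) (hγ1 : γ ≠ 1) :
    Tendsto (thalerG γ) (𝓝[>] 0) (𝓝 0) := by
  have h := ((tendsto_thalerG_sub_div hγ hγ1).mul
    (tendsto_rpow_nhdsGT_zero (by linarith : 0 < 1 + γ))).add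
    (tendsto_id.mono_left (nhdsWithin_le_nhds (a := (0 : ℝ)) (s := Ioi 0)))
  rw [mul_zero, zero_add] at h
  refine h.congr' ?_
  filter_upwards [self_mem_nhdsWithin] with x (hx : 0 < x)
  rw [div_mul_cancel₀ _ (Real.rpow_pos_of_pos hx _).ne']
  simp

theorem image_thalerG_Ioc {a b : ℝ} (hγ : γ ≠ 1) (ha : 0 < a) (hab : a ≤ b) (hb : b ≤ 1) :
    thalerG γ '' Ioc a b = Ioc (thalerG γ a) (thalerG γ b) := by
  have hmono := strictMonoOn_thalerG hγ
  apply subset_antisymm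
  · rintro _ ⟨x, hx, rfl⟩
    exact ⟨hmono ⟨ha, hab.trans hb⟩ ⟨ha.trans hx.1, hx.2.trans hb⟩ hx.1,
      hmono.monotoneOn ⟨ha.trans hx.1, hx.2.trans hb⟩ ⟨ha.trans_le hab, hb⟩ hx.2⟩
  · refine intermediate_value_Ioc hab ((continuousOn_thalerG hγ).mono fun x hx => ?_)
    exact ⟨ha.trans_le hx.1, hx.2.trans hb⟩

theorem surjOn_thalerG (hγ : 0 < γ) (hγ1 : γ ≠ 1) : SurjOn (thalerG γ) (Ioc 0 1) (Ioc 0 2) := by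
  intro w hw
  obtain ⟨a, ha, haw⟩ := ((eventually_mem_set.2 Ioc_mem_nhdsGT_zero).and
    ((tendsto_thalerG_zero hγ hγ1).eventually (gt_mem_nhds hw.1)) |>.exists)
  have := image_thalerG_Ioc hγ1 ha.1 ha.2 le_rfl
  rw [thalerG_one hγ1] at this
  obtain ⟨x, hx, hxw⟩ : w ∈ thalerG γ '' Ioc a 1 := by rw [this]; exact ⟨haw, hw.2⟩
  exact ⟨x, ⟨ha.1.trans hx.1, hx.2⟩, hxw⟩

/-- The inverse of the common branch formula `g` on `(0, 2]`, extended to a monotone function. -/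
def thalerInv (γ w : ℝ) : ℝ := sSup (insert 0 {x | x ∈ Ioc (0 : ℝ) 1 ∧ thalerG γ x ≤ w})

theorem bddAbove_thalerInv (w : ℝ) :
    BddAbove (insert 0 {x | x ∈ Ioc (0 : ℝ) 1 ∧ thalerG γ x ≤ w}) := by
  refine ⟨1, ?_⟩
  rintro x (rfl | hx)
  exacts [zero_le_one, hx.1.2]

theorem monotone_thalerInv : Monotone (thalerInv γ) := fun _ _ hvw =>
  csSup_le_csSup (bddAbove_thalerInv _) (insert_nonempty _ _)
    (insert_subset_insert fun _ hx => ⟨hx.1, hx.2.trans hvw⟩)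

theorem thalerInv_thalerG (hγ : γ ≠ 1) (hx : x ∈ Ioc (0 : ℝ) 1) :
    thalerInv γ (thalerG γ x) = x := by
  refine IsGreatest.csSup_eq ⟨Or.inr ⟨hx, le_rfl⟩, ?_⟩
  rintro y (rfl | hy)
  exacts [hx.1.le, ((strictMonoOn_thalerG hγ).le_iff_le hy.1 hx).1 hy.2]

theorem thalerInv_mem (hγ : 0 < γ) (hγ1 : γ ≠ 1) {w : ℝ} (hw : w ∈ Ioc (0 : ℝ) 2) :
    thalerInv γ w ∈ Ioc (0 : ℝ) 1 := by
  obtain ⟨x, hx, rfl⟩ := surjOn_thalerG hγ hγ1 hw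
  rwa [thalerInv_thalerG hγ1 hx]

theorem thalerG_thalerInv (hγ : 0 < γ) (hγ1 : γ ≠ 1) {w : ℝ} (hw : w ∈ Ioc (0 : ℝ) 2) :
    thalerG γ (thalerInv γ w) = w := by
  obtain ⟨x, hx, rfl⟩ := surjOn_thalerG hγ hγ1 hw
  rw [thalerInv_thalerG hγ1 hx]

theorem thalerInv_lt (hγ : 0 < γ) (hγ1 : γ ≠ 1) {w : ℝ} (hw : w ∈ Ioc (0 : ℝ) 2) :
    thalerInv γ w < w := by
  have := lt_thalerG hγ1 (thalerInv_mem hγ hγ1 hw)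
  rwa [thalerG_thalerInv hγ hγ1 hw] at this

theorem thalerInv_one (hγ : γ ≠ 1) (hxs : xs ∈ Ioo (0 : ℝ) 1)
    (hxseq : xs ^ (1 - γ) + (1 + xs) ^ (1 - γ) = 2) : thalerInv γ 1 = xs := by
  rw [← thalerG_branchPoint hxseq, thalerInv_thalerG hγ ⟨hxs.1, hxs.2.le⟩]

/-- Change of variables `w = g x`, using `g' = g^γ h`. -/
theorem setIntegral_thalerH_mul {a b : ℝ} (hγ : γ ≠ 1) (ha : 0 < a) (hab : a ≤ b) (hb : b ≤ 1)
    (f u : ℝ → ℂ) :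
    ∫ x in Ioc a b, (thalerH γ x : ℂ) * (f x * u (thalerG γ x)) =
      ∫ w in Ioc (thalerG γ a) (thalerG γ b), ((w ^ (-γ) : ℝ) : ℂ) * (f (thalerInv γ w) * u w) := by
  have hsub : Ioc a b ⊆ Ioc 0 1 := fun x hx => ⟨ha.trans hx.1, hx.2.trans hb⟩
  rw [← image_thalerG_Ioc hγ ha hab hb, integral_image_eq_integral_abs_deriv_smul measurableSet_Ioc
    (fun x hx => (hasDerivAt_thalerG hγ (hsub hx)).hasDerivWithinAt)
    ((strictMonoOn_thalerG hγ).injOn.mono hsub)]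
  refine setIntegral_congr_fun measurableSet_Ioc fun x hx => ?_
  have hg := thalerG_pos (γ := γ) (hsub hx)
  have hh := thalerH_pos (γ := γ) (hsub hx).1
  have hgp := Real.rpow_pos_of_pos hg γ
  have hgc : ((thalerG γ x ^ γ : ℝ) : ℂ) ≠ 0 := by exact_mod_cast hgp.ne'
  rw [abs_of_pos (mul_pos hgp hh), thalerInv_thalerG hγ (hsub hx), Real.rpow_neg hg.le,
    Complex.real_smul]
  push_cast
  field_simp

end Branch

/-- The standing assumptions on the parameter `γ` and the branch point `xs`. -/
structure ThalerParam (γ xs : ℝ) : Prop where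
  pos : 0 < γ
  ne_one : γ ≠ 1
  mem : xs ∈ Ioo (0 : ℝ) 1
  eq : xs ^ (1 - γ) + (1 + xs) ^ (1 - γ) = 2

/-- The preimages of `1` under the left branch: `c 0 = 1` and `g (c (k+1)) = c k`. -/
def thalerCut (γ : ℝ) (k : ℕ) : ℝ := (thalerInv γ)^[k] 1

/-- The unnormalized mass `μ (Y ∩ {τ = k + 1})`. -/
def thalerMass (γ : ℝ) (k : ℕ) : ℝ :=
  ((1 + thalerCut γ k) ^ (1 - γ) - (1 + thalerCut γ (k + 1)) ^ (1 - γ)) / (1 - γ)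

namespace ThalerParam

variable {γ xs : ℝ}

theorem ne_zero (P : ThalerParam γ xs) : 1 - γ ≠ 0 := sub_ne_zero.2 P.ne_one.symm

theorem inv_mem (P : ThalerParam γ xs) {w : ℝ} (hw : w ∈ Ioc (0 : ℝ) 2) :
    thalerInv γ w ∈ Ioc (0 : ℝ) 1 := thalerInv_mem P.pos P.ne_one hw

theorem g_inv (P : ThalerParam γ xs) {w : ℝ} (hw : w ∈ Ioc (0 : ℝ) 2) :
    thalerG γ (thalerInv γ w) = w := thalerG_thalerInv P.pos P.ne_one hw

theorem inv_one (P : ThalerParam γ xs) : thalerInv γ 1 = xs := thalerInv_one P.ne_one P.mem P.eq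

theorem mem_two {w : ℝ} (hw : w ∈ Ioc (0 : ℝ) 1) : w ∈ Ioc (0 : ℝ) 2 :=
  ⟨hw.1, hw.2.trans one_le_two⟩

theorem cut_succ (k : ℕ) : thalerCut γ (k + 1) = thalerInv γ (thalerCut γ k) :=
  Function.iterate_succ_apply' _ _ _

theorem cut_zero : thalerCut γ 0 = 1 := rfl

theorem cut_one (P : ThalerParam γ xs) : thalerCut γ 1 = xs := by
  rw [cut_succ, cut_zero, P.inv_one]

theorem cut_mem (P : ThalerParam γ xs) (k : ℕ) : thalerCut γ k ∈ Ioc (0 : ℝ) 1 := by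
  induction k with
  | zero => exact ⟨one_pos, le_rfl⟩
  | succ k ih => rw [cut_succ]; exact P.inv_mem (mem_two ih)

theorem g_cut (P : ThalerParam γ xs) (k : ℕ) :
    thalerG γ (thalerCut γ (k + 1)) = thalerCut γ k := by
  rw [cut_succ, P.g_inv (mem_two (P.cut_mem k))]

theorem cut_lt (P : ThalerParam γ xs) (k : ℕ) : thalerCut γ (k + 1) < thalerCut γ k := by
  rw [cut_succ]; exact thalerInv_lt P.pos P.ne_one (mem_two (P.cut_mem k))

theorem strictAnti_cut (P : ThalerParam γ xs) : StrictAnti (thalerCut γ) :=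
  strictAnti_nat_of_succ_lt P.cut_lt

theorem tendsto_cut (P : ThalerParam γ xs) : Tendsto (thalerCut γ) atTop (𝓝 0) := by
  have hb : BddBelow (range (thalerCut γ)) := ⟨0, by rintro _ ⟨k, rfl⟩; exact (P.cut_mem k).1.le⟩
  have h := tendsto_atTop_ciInf P.strictAnti_cut.antitone hb
  set c := ⨅ k, thalerCut γ k
  have hc0 : 0 ≤ c := le_ciInf fun k => (P.cut_mem k).1.le
  have hc1 : c ≤ 1 := ciInf_le hb 0
  rcases hc0.eq_or_lt with hc | hc
  · rwa [← hc] at h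
  · have hg := ((hasDerivAt_thalerG P.ne_one ⟨hc, hc1⟩).continuousAt.tendsto.comp
      ((tendsto_add_atTop_iff_nat 1).2 h))
    have := tendsto_nhds_unique (hg.congr P.g_cut) h
    exact absurd this (lt_thalerG P.ne_one ⟨hc, hc1⟩).ne'

theorem tendsto_cut_succ (P : ThalerParam γ xs) :
    Tendsto (fun k => thalerCut γ (k + 1)) atTop (𝓝[>] 0) :=
  tendsto_nhdsWithin_iff.2 ⟨(tendsto_add_atTop_iff_nat 1).2 P.tendsto_cut,
    Eventually.of_forall fun _ => (P.cut_mem _).1⟩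

/-- `k c_k^γ → 1/γ`. -/
theorem tendsto_mul_cut_rpow (P : ThalerParam γ xs) :
    Tendsto (fun k : ℕ => (k : ℝ) * thalerCut γ k ^ γ) atTop (𝓝 γ⁻¹) := by
  have h := ((tendsto_rpow_neg_sub_thalerG P.pos P.ne_one).comp P.tendsto_cut_succ).cesaro
  have h1 : Tendsto (fun n : ℕ => (n⁻¹ : ℝ) * (thalerCut γ n ^ (-γ) - 1)) atTop (𝓝 γ) := by
    refine h.congr fun n => ?_
    congr 1
    have := Finset.sum_range_sub (fun k => thalerCut γ k ^ (-γ)) n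
    simp only [cut_zero, Real.one_rpow] at this
    rw [← this]
    refine Finset.sum_congr rfl fun k _ => ?_
    simp only [Function.comp, P.g_cut]
  have h2 := (h1.add tendsto_inv_atTop_nhds_zero_nat).inv₀ (by simpa using P.pos.ne')
  rw [add_zero] at h2
  refine h2.congr fun n => ?_
  rw [Real.rpow_neg (P.cut_mem n).1.le, ← mul_add_one, sub_add_cancel, mul_inv, inv_inv, inv_inv]

theorem tendsto_mul_cut_succ_rpow (P : ThalerParam γ xs) :
    Tendsto (fun k : ℕ => ((k : ℝ) + 1) ^ (1 + γ⁻¹) * thalerCut γ (k + 1) ^ (1 + γ)) atTop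
      (𝓝 (γ⁻¹ ^ (1 + γ⁻¹))) := by
  have hγ := P.pos
  have h := ((tendsto_add_atTop_iff_nat 1).2 P.tendsto_mul_cut_rpow).rpow_const (p := 1 + γ⁻¹)
    (Or.inl (by positivity))
  refine h.congr fun k => ?_
  have hc := (P.cut_mem (k + 1)).1
  rw [Real.mul_rpow (by positivity) (by positivity), ← Real.rpow_mul hc.le,
    show γ * (1 + γ⁻¹) = 1 + γ by field_simp; ring]
  push_cast; rfl

theorem tendsto_mass_div (P : ThalerParam γ xs) :
    Tendsto (fun k => thalerMass γ k / (thalerCut γ k - thalerCut γ (k + 1))) atTop (𝓝 1) := by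
  have hd : HasStrictDerivAt (fun t : ℝ => (1 + t) ^ (1 - γ)) (1 - γ) 0 := by
    have h1 := Real.hasStrictDerivAt_rpow_const_of_ne (x := 1 + 0) (by simp) (1 - γ)
    have := h1.comp 0 ((hasStrictDerivAt_id (0 : ℝ)).const_add 1)
    simpa [Function.comp_def] using this
  have ho := hd.isLittleO
  have hpair : Tendsto (fun k => (thalerCut γ k, thalerCut γ (k + 1))) atTop (𝓝 ((0 : ℝ), (0 : ℝ))) :=
    P.tendsto_cut.prodMk_nhds ((tendsto_add_atTop_iff_nat 1).2 P.tendsto_cut)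
  have h := (ho.comp_tendsto hpair).tendsto_div_nhds_zero
  have h2 := (h.div_const (1 - γ)).add_const 1
  rw [zero_div, zero_add] at h2
  refine h2.congr fun k => ?_
  have h0 : thalerCut γ k - thalerCut γ (k + 1) ≠ 0 := (sub_pos.2 (P.cut_lt k)).ne'
  have := P.ne_zero
  simp only [Function.comp, thalerMass]
  simp only [ContinuousLinearMap.toSpanSingleton_apply, smul_eq_mul]
  field_simp
  ring

/-- The local tail asymptotics of the return time. -/
theorem tendsto_mul_mass (P : ThalerParam γ xs) :
    Tendsto (fun k : ℕ => ((k : ℝ) + 1) ^ (1 + γ⁻¹) * thalerMass γ k) atTop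
      (𝓝 (γ⁻¹ ^ (1 + γ⁻¹))) := by
  have h := (P.tendsto_mass_div.mul
    ((tendsto_thalerG_sub_div P.pos P.ne_one).comp P.tendsto_cut_succ)).mul
    P.tendsto_mul_cut_succ_rpow
  rw [one_mul, one_mul] at h
  refine h.congr fun k => ?_
  have h0 : thalerCut γ k - thalerCut γ (k + 1) ≠ 0 := (sub_pos.2 (P.cut_lt k)).ne'
  have hc := (Real.rpow_pos_of_pos (P.cut_mem (k + 1)).1 (1 + γ)).ne'
  simp only [Function.comp, P.g_cut]
  field_simp

theorem one_add_rpow_div_strictMono (P : ThalerParam γ xs) {a b : ℝ} (ha : 0 < a) (hab : a < b) :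
    a ^ (1 - γ) / (1 - γ) < b ^ (1 - γ) / (1 - γ) := by
  rcases lt_or_gt_of_ne P.ne_zero with he | he
  · exact div_lt_div_of_neg_of_lt he (Real.rpow_lt_rpow_of_neg ha hab he)
  · exact div_lt_div_of_pos_right (Real.rpow_lt_rpow ha.le hab he) he

theorem mass_pos (P : ThalerParam γ xs) (k : ℕ) : 0 < thalerMass γ k := by
  have := P.one_add_rpow_div_strictMono (by linarith [(P.cut_mem (k + 1)).1])
    (by linarith [P.cut_lt k] : 1 + thalerCut γ (k + 1) < 1 + thalerCut γ k)
  rw [thalerMass, sub_div]; linarith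

/-- The total mass `μ(Y)`. -/
def total (γ : ℝ) : ℝ := (2 ^ (1 - γ) - 1) / (1 - γ)

theorem total_pos (P : ThalerParam γ xs) : 0 < total γ := by
  have := P.one_add_rpow_div_strictMono one_pos one_lt_two
  rw [Real.one_rpow] at this
  rw [total, sub_div]; linarith

theorem tendsto_tail (P : ThalerParam γ xs) :
    Tendsto (fun k => ((1 + thalerCut γ k) ^ (1 - γ) - 1) / (1 - γ)) atTop (𝓝 0) := by
  have h := ((P.tendsto_cut.const_add 1).rpow_const (p := 1 - γ) (Or.inl (by simp)))
  have h := (h.sub_const 1).div_const (1 - γ)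
  simpa using h

theorem sum_range_mass (n : ℕ) : ∑ k ∈ Finset.range n, thalerMass γ k =
    total γ - ((1 + thalerCut γ n) ^ (1 - γ) - 1) / (1 - γ) := by
  have := Finset.sum_range_sub' (fun k => (1 + thalerCut γ k) ^ (1 - γ) / (1 - γ)) n
  rw [cut_zero] at this
  simp only [thalerMass, sub_div, this, total]
  norm_num

theorem hasSum_mass (P : ThalerParam γ xs) : HasSum (thalerMass γ) (total γ) := by
  refine (hasSum_iff_tendsto_nat_of_nonneg (fun k => (P.mass_pos k).le) _).2 ?_
  simp only [sum_range_mass]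
  simpa using P.tendsto_tail.const_sub (total γ)

/-- Kac's formula, for `γ < 1`. -/
theorem hasSum_mul_mass (P : ThalerParam γ xs) (hγ : γ < 1) :
    HasSum (fun k : ℕ => ((k : ℝ) + 1) * thalerMass γ k) (2 ^ (1 - γ) / (1 - γ)) := by
  refine (hasSum_iff_tendsto_nat_of_nonneg
    (fun k => mul_nonneg (by positivity) (P.mass_pos k).le) _).2 ?_
  set t : ℕ → ℝ := fun k => ((1 + thalerCut γ k) ^ (1 - γ) - 1) / (1 - γ) with ht
  have hmass : ∀ k, thalerMass γ k = t k - t (k + 1) := fun k => by simp only [ht, thalerMass]; ring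
  have hsum : ∀ n : ℕ, ∑ k ∈ Finset.range n, ((k : ℝ) + 1) * thalerMass γ k =
      (∑ k ∈ Finset.range n, t k) - n * t n := by
    intro n
    induction n with
    | zero => simp
    | succ n ih => rw [Finset.sum_range_succ, ih, hmass, Finset.sum_range_succ]; push_cast; ring
  have htsucc : ∀ k, t (k + 1) =
      thalerCut γ k ^ (1 - γ) / (1 - γ) - thalerCut γ (k + 1) ^ (1 - γ) / (1 - γ) := by
    intro k
    have := thalerG_rpow P.ne_one (P.cut_mem (k + 1))
    rw [P.g_cut] at this
    simp only [ht, this]; ring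
  have hsumt : ∀ n : ℕ, ∑ k ∈ Finset.range (n + 1), t k =
      2 ^ (1 - γ) / (1 - γ) - thalerCut γ n ^ (1 - γ) / (1 - γ) := by
    intro n
    rw [Finset.sum_range_succ']
    simp only [htsucc]
    rw [Finset.sum_range_sub' (fun k => thalerCut γ k ^ (1 - γ) / (1 - γ))]
    simp only [ht, cut_zero, Real.one_rpow]
    ring_nf
  have he : 0 < 1 - γ := sub_pos.2 hγ
  have hlim : Tendsto (fun n => thalerCut γ n ^ (1 - γ)) atTop (𝓝 0) := by
    have := P.tendsto_cut.rpow_const (p := 1 - γ) (Or.inr he.le)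
    rwa [Real.zero_rpow he.ne'] at this
  have hS : Tendsto (fun n => ∑ k ∈ Finset.range n, t k) atTop (𝓝 (2 ^ (1 - γ) / (1 - γ))) := by
    rw [← tendsto_add_atTop_iff_nat 1]
    simp only [hsumt]
    simpa using (hlim.div_const (1 - γ)).const_sub (2 ^ (1 - γ) / (1 - γ))
  have hn : Tendsto (fun n : ℕ => (n : ℝ) * t n) atTop (𝓝 0) := by
    have hb := P.tendsto_mul_cut_rpow.mul hlim
    rw [mul_zero] at hb
    refine squeeze_zero (fun n => mul_nonneg n.cast_nonneg ?_) (fun n => ?_) hb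
    · exact div_nonneg (sub_nonneg.2 (Real.one_le_rpow (by linarith [(P.cut_mem n).1]) he.le)) he.le
    · have hc := (P.cut_mem n).1
      rw [mul_assoc, ← Real.rpow_add hc, add_sub_cancel, Real.rpow_one]
      refine mul_le_mul_of_nonneg_left ?_ n.cast_nonneg
      rw [div_le_iff₀ he]
      have := rpow_one_add_le_one_add_mul_self (s := thalerCut γ n) (by linarith) he.le
        (by linarith [P.pos])
      linarith
  simp only [hsum]
  simpa using hS.sub hn

end ThalerParam

/-- The level sets `D_k = (c_{k+1}, c_k]` partitioning `(0, 1]`. -/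
def thalerCell (γ : ℝ) (k : ℕ) : Set ℝ := Ioc (thalerCut γ (k + 1)) (thalerCut γ k)

/-- The domain `Y ∩ {τ = k + 1}` of the `k`-th branch of the first return map. -/
def thalerBranch (γ : ℝ) (k : ℕ) : Set ℝ :=
  Ioc (thalerInv γ (1 + thalerCut γ (k + 1))) (thalerInv γ (1 + thalerCut γ k))

/-- The conditional probability of the left preimage in the dual chain. -/
def thalerR (γ z : ℝ) : ℝ := z ^ (-γ) / thalerH γ z

/-- Iterated left preimages. -/
def leftPre (γ : ℝ) (k : ℕ) (x : ℝ) : ℝ := (thalerInv γ)^[k] x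

/-- The probability that the dual chain started at `x` makes at least `k` left steps. -/
def dualTail (γ : ℝ) (k : ℕ) (x : ℝ) : ℝ := ∏ j ∈ Finset.range k, thalerR γ (leftPre γ j x)

/-- The probability that the dual chain started at `x` makes exactly `k` left steps. -/
def dualProb (γ : ℝ) (k : ℕ) (x : ℝ) : ℝ := dualTail γ k x * (1 - thalerR γ (leftPre γ k x))

/-- The `k`-th inverse branch of the first return map. -/
def returnPre (γ : ℝ) (k : ℕ) (x : ℝ) : ℝ := thalerInv γ (1 + leftPre γ k x)

namespace ThalerParam

variable {γ xs : ℝ}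

theorem thalerR_mul_thalerH {z : ℝ} (hz : 0 < z) : thalerR γ z * thalerH γ z = z ^ (-γ) :=
  div_mul_cancel₀ _ (thalerH_pos hz).ne'

theorem one_sub_thalerR_mul_thalerH {z : ℝ} (hz : 0 < z) :
    (1 - thalerR γ z) * thalerH γ z = (1 + z) ^ (-γ) := by
  rw [sub_mul, thalerR_mul_thalerH hz, thalerH, add_comm z 1]; ring

theorem one_add_mem {z : ℝ} (hz : z ∈ Ioc (0 : ℝ) 1) : 1 + z ∈ Ioc (0 : ℝ) 2 :=
  ⟨by linarith [hz.1], by linarith [hz.2]⟩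

theorem cell_subset (P : ThalerParam γ xs) (k : ℕ) : thalerCell γ k ⊆ Ioc 0 1 := fun _ hx =>
  ⟨(P.cut_mem _).1.trans hx.1, hx.2.trans (P.cut_mem k).2⟩

theorem cell_zero (P : ThalerParam γ xs) : thalerCell γ 0 = Ioc xs 1 := by
  rw [thalerCell, P.cut_one, cut_zero]

theorem thalerT_left {x : ℝ} (hx : x ∈ Ioc (0 : ℝ) xs) : thalerT γ xs x = thalerG γ x := by
  rw [thalerT, if_neg hx.1.not_ge, if_pos hx.2]

theorem thalerT_right (P : ThalerParam γ xs) {x : ℝ} (hx : x ∈ Ioc xs 1) :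
    thalerT γ xs x = thalerG γ x - 1 := by
  rw [thalerT, if_neg (P.mem.1.trans hx.1).not_ge, if_neg hx.1.not_ge]

theorem thalerT_cell_succ (P : ThalerParam γ xs) {k : ℕ} {x : ℝ} (hx : x ∈ thalerCell γ (k + 1)) :
    thalerT γ xs x = thalerG γ x := by
  refine thalerT_left ⟨(P.cell_subset _ hx).1, hx.2.trans ?_⟩
  rw [← P.cut_one]
  exact P.strictAnti_cut.antitone (by omega)

theorem thalerG_cell_succ (P : ThalerParam γ xs) {k : ℕ} {x : ℝ} (hx : x ∈ thalerCell γ (k + 1)) :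
    thalerG γ x ∈ thalerCell γ k := by
  have := image_thalerG_Ioc P.ne_one (P.cut_mem (k + 1 + 1)).1 (P.cut_lt (k + 1)).le
    (P.cut_mem (k + 1)).2
  rw [P.g_cut, P.g_cut] at this
  rw [thalerCell, ← this]
  exact ⟨x, hx, rfl⟩

theorem iterate_cell (P : ThalerParam γ xs) (j : ℕ) : ∀ {k : ℕ} {x : ℝ},
    x ∈ thalerCell γ (k + j) → (thalerT γ xs)^[j] x ∈ thalerCell γ k := by
  induction j with
  | zero => intro k x hx; exact hx
  | succ j ih =>
    intro k x hx
    rw [Function.iterate_succ_apply, P.thalerT_cell_succ (k := k + j) hx]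
    exact ih (P.thalerG_cell_succ (k := k + j) hx)

theorem exists_cell (P : ThalerParam γ xs) {z : ℝ} (hz : z ∈ Ioc (0 : ℝ) 1) :
    ∃ k, z ∈ thalerCell γ k := by
  classical
  have hex : ∃ k, thalerCut γ k < z := (P.tendsto_cut.eventually (gt_mem_nhds hz.1)).exists
  have hs := Nat.find_spec hex
  have hm := fun m => Nat.find_min (m := m) hex
  generalize Nat.find hex = n at hs hm
  rcases n with _ | k
  · exact absurd hs (not_lt.2 hz.2)
  · exact ⟨k, hs, not_lt.1 (hm k (Nat.lt_succ_self k))⟩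

theorem image_branch (P : ThalerParam γ xs) (k : ℕ) :
    thalerG γ '' thalerBranch γ k = Ioc (1 + thalerCut γ (k + 1)) (1 + thalerCut γ k) := by
  have h1 := one_add_mem (P.cut_mem (k + 1))
  have h0 := one_add_mem (P.cut_mem k)
  rw [thalerBranch, image_thalerG_Ioc P.ne_one (P.inv_mem h1).1
    (monotone_thalerInv (by linarith [P.cut_lt k])) (P.inv_mem h0).2, P.g_inv h1, P.g_inv h0]

theorem branch_subset (P : ThalerParam γ xs) (k : ℕ) : thalerBranch γ k ⊆ Ioc xs 1 := by
  intro y hy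
  refine ⟨lt_of_le_of_lt ?_ hy.1, hy.2.trans (P.inv_mem (one_add_mem (P.cut_mem k))).2⟩
  rw [← P.inv_one]
  exact monotone_thalerInv (by linarith [(P.cut_mem (k + 1)).1])

theorem sub_one_mem_cell (P : ThalerParam γ xs) {k : ℕ} {y : ℝ} (hy : y ∈ thalerBranch γ k) :
    thalerG γ y - 1 ∈ thalerCell γ k := by
  have : thalerG γ y ∈ thalerG γ '' thalerBranch γ k := ⟨y, hy, rfl⟩
  rw [P.image_branch] at this
  exact ⟨by linarith [this.1], by linarith [this.2]⟩

theorem iUnion_branch (P : ThalerParam γ xs) : ⋃ k, thalerBranch γ k = Ioc xs 1 := by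
  refine subset_antisymm (iUnion_subset P.branch_subset) fun y hy => ?_
  have hy0 : y ∈ Ioc (0 : ℝ) 1 := ⟨P.mem.1.trans hy.1, hy.2⟩
  have hg : thalerG γ y ∈ Ioc (thalerG γ xs) (thalerG γ 1) := by
    rw [← image_thalerG_Ioc P.ne_one P.mem.1 P.mem.2.le le_rfl]; exact ⟨y, hy, rfl⟩
  rw [thalerG_branchPoint P.eq, thalerG_one P.ne_one] at hg
  obtain ⟨k, hk⟩ := P.exists_cell (z := thalerG γ y - 1) ⟨by linarith [hg.1], by linarith [hg.2]⟩
  have : thalerG γ y ∈ thalerG γ '' thalerBranch γ k := by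
    rw [P.image_branch]; exact ⟨by linarith [hk.1], by linarith [hk.2]⟩
  obtain ⟨y', hy', he⟩ := this
  have hb := P.branch_subset k hy'
  rw [(strictMonoOn_thalerG P.ne_one).injOn ⟨P.mem.1.trans hb.1, hb.2⟩ hy0 he] at hy'
  exact mem_iUnion.2 ⟨k, hy'⟩

theorem iterate_branch (P : ThalerParam γ xs) {k : ℕ} {y : ℝ} (hy : y ∈ thalerBranch γ k)
    (n : ℕ) : (thalerT γ xs)^[n + 1] y = (thalerT γ xs)^[n] (thalerG γ y - 1) := by
  rw [Function.iterate_succ_apply, P.thalerT_right (P.branch_subset k hy)]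

theorem tau_branch (P : ThalerParam γ xs) {k : ℕ} {y : ℝ} (hy : y ∈ thalerBranch γ k) :
    thalerTau γ xs y = k + 1 := by
  have hc := P.sub_one_mem_cell hy
  refine IsLeast.csInf_eq ⟨⟨by omega, ?_⟩, ?_⟩
  · rw [P.iterate_branch hy, ← P.cell_zero]
    exact P.iterate_cell k (by simpa using hc)
  · rintro n ⟨h1, hn⟩
    obtain ⟨m, rfl⟩ := Nat.exists_eq_succ_of_ne_zero (by omega : n ≠ 0)
    by_contra! hlt
    obtain ⟨i, rfl⟩ := Nat.exists_eq_add_of_lt (by omega : m < k)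
    rw [Nat.succ_eq_add_one, P.iterate_branch hy] at hn
    have := P.iterate_cell m (k := i + 1) (by convert hc using 1; congr 1; ring)
    have hle := P.strictAnti_cut.antitone (by omega : 1 ≤ i + 1)
    rw [P.cut_one] at hle
    exact absurd (hn.1.trans_le this.2) hle.not_gt

theorem F_branch (P : ThalerParam γ xs) {k : ℕ} {y : ℝ} (hy : y ∈ thalerBranch γ k) :
    thalerF γ xs y = (thalerT γ xs)^[k] (thalerG γ y - 1) := by
  rw [thalerF, P.tau_branch hy, P.iterate_branch hy]

theorem F_mem (P : ThalerParam γ xs) {y : ℝ} (hy : y ∈ Ioc xs 1) : thalerF γ xs y ∈ Ioc xs 1 := by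
  rw [← P.iUnion_branch] at hy
  obtain ⟨k, hk⟩ := mem_iUnion.1 hy
  rw [P.F_branch hk, ← P.cell_zero]
  exact P.iterate_cell k (by simpa using P.sub_one_mem_cell hk)

theorem pairwise_disjoint_branch (P : ThalerParam γ xs) :
    Pairwise (Function.onFun Disjoint (thalerBranch γ)) := by
  intro i j hij
  refine Set.disjoint_left.2 fun y hi hj => hij ?_
  have := (P.tau_branch hi).symm.trans (P.tau_branch hj)
  omega

theorem integral_cell (P : ThalerParam γ xs) (u : ℝ → ℂ) (k : ℕ) : ∀ f : ℝ → ℂ,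
    ∫ z in thalerCell γ k, (thalerH γ z : ℂ) * (f z * u ((thalerT γ xs)^[k] z)) =
      ∫ x in Ioc xs 1, (thalerH γ x : ℂ) * ((dualTail γ k x * f (leftPre γ k x)) * u x) := by
  induction k with
  | zero => intro f; simp [P.cell_zero, dualTail, leftPre]
  | succ k ih =>
    intro f
    have h1 : ∫ z in thalerCell γ (k + 1),
        (thalerH γ z : ℂ) * (f z * u ((thalerT γ xs)^[k + 1] z)) =
        ∫ z in thalerCell γ (k + 1),
          (thalerH γ z : ℂ) * (f z * (fun w => u ((thalerT γ xs)^[k] w)) (thalerG γ z)) := by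
      refine setIntegral_congr_fun measurableSet_Ioc fun z hz => ?_
      simp only [Function.iterate_succ_apply, P.thalerT_cell_succ hz]
    have h2 := setIntegral_thalerH_mul P.ne_one (P.cut_mem (k + 1 + 1)).1 (P.cut_lt (k + 1)).le
      (P.cut_mem (k + 1)).2 f (fun w => u ((thalerT γ xs)^[k] w))
    rw [P.g_cut, P.g_cut] at h2
    rw [h1, thalerCell, h2]
    have h3 := ih (fun z => thalerR γ z * f (thalerInv γ z))
    have h4 : ∫ w in Ioc (thalerCut γ (k + 1)) (thalerCut γ k), ((w ^ (-γ) : ℝ) : ℂ) *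
        (f (thalerInv γ w) * (fun w => u ((thalerT γ xs)^[k] w)) w) =
        ∫ z in thalerCell γ k, (thalerH γ z : ℂ) *
          ((thalerR γ z * f (thalerInv γ z)) * u ((thalerT γ xs)^[k] z)) := by
      refine setIntegral_congr_fun measurableSet_Ioc fun z hz => ?_
      simp only
      rw [← thalerR_mul_thalerH (P.cell_subset k hz).1]
      push_cast; ring
    rw [h4, h3]
    refine setIntegral_congr_fun measurableSet_Ioc fun x _ => ?_
    simp only [dualTail, Finset.prod_range_succ, leftPre, Function.iterate_succ_apply']
    push_cast; ring

theorem setIntegral_branch (P : ThalerParam γ xs) (f u : ℝ → ℂ) (k : ℕ) :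
    ∫ y in thalerBranch γ k, (thalerH γ y : ℂ) * (f y * u (thalerF γ xs y)) =
      ∫ x in Ioc xs 1, (thalerH γ x : ℂ) * ((dualProb γ k x * f (returnPre γ k x)) * u x) := by
  have hm1 := one_add_mem (P.cut_mem (k + 1))
  have hm0 := one_add_mem (P.cut_mem k)
  have h1 : ∫ y in thalerBranch γ k, (thalerH γ y : ℂ) * (f y * u (thalerF γ xs y)) =
      ∫ y in thalerBranch γ k, (thalerH γ y : ℂ) *
        (f y * (fun w => u ((thalerT γ xs)^[k] (w - 1))) (thalerG γ y)) := by
    refine setIntegral_congr_fun measurableSet_Ioc fun y hy => ?_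
    simp only [P.F_branch hy]
  have hle : thalerCut γ (k + 1) ≤ thalerCut γ k := (P.cut_lt k).le
  rw [h1, thalerBranch, setIntegral_thalerH_mul P.ne_one (P.inv_mem hm1).1
    (monotone_thalerInv (by linarith)) (P.inv_mem hm0).2 f
    (fun w => u ((thalerT γ xs)^[k] (w - 1))), P.g_inv hm1, P.g_inv hm0,
    ← intervalIntegral.integral_of_le (by linarith), ← intervalIntegral.integral_comp_add_left,
    intervalIntegral.integral_of_le hle]
  have h3 := P.integral_cell u k (fun z => (1 - thalerR γ z) * f (thalerInv γ (1 + z)))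
  have h4 : ∫ z in Ioc (thalerCut γ (k + 1)) (thalerCut γ k), (((1 + z) ^ (-γ) : ℝ) : ℂ) *
      (f (thalerInv γ (1 + z)) * u ((thalerT γ xs)^[k] (1 + z - 1))) =
      ∫ z in thalerCell γ k, (thalerH γ z : ℂ) *
        (((1 - thalerR γ z) * f (thalerInv γ (1 + z))) * u ((thalerT γ xs)^[k] z)) := by
    refine setIntegral_congr_fun measurableSet_Ioc fun z hz => ?_
    simp only [add_sub_cancel_left]
    rw [← one_sub_thalerR_mul_thalerH (P.cell_subset k hz).1]
    push_cast; ring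
  rw [h4, h3]
  refine setIntegral_congr_fun measurableSet_Ioc fun x _ => ?_
  simp only [dualProb, returnPre]
  push_cast; ring

end ThalerParam

section Measurability

variable {γ xs : ℝ}

theorem measurable_thalerG : Measurable (thalerG γ) := by
  unfold thalerG; fun_prop

theorem measurable_thalerT : Measurable (thalerT γ xs) := by
  unfold thalerT
  exact Measurable.ite measurableSet_Iic measurable_const
    (Measurable.ite measurableSet_Iic measurable_thalerG (measurable_thalerG.sub_const 1))

theorem measurable_sInf_nat {Ω : Type*} [MeasurableSpace Ω] {A : ℕ → Set Ω}
    (hA : ∀ n, MeasurableSet (A n)) : Measurable fun x => sInf {n : ℕ | x ∈ A n} := by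
  refine measurable_to_countable' fun n => ?_
  have : (fun x => sInf {n : ℕ | x ∈ A n}) ⁻¹' {n} =
      (A n ∩ ⋂ m ∈ Iio n, (A m)ᶜ) ∪ ({x | n = 0} ∩ ⋂ m, (A m)ᶜ) := by
    ext x
    simp only [mem_preimage, mem_singleton_iff, mem_union, mem_inter_iff, mem_iInter, mem_Iio,
      mem_compl_iff, mem_ofPred_eq]
    constructor
    · rintro rfl
      rcases Set.eq_empty_or_nonempty {n : ℕ | x ∈ A n} with h | h
      · right
        refine ⟨by rw [h, Nat.sInf_empty], fun m hm => ?_⟩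
        exact (Set.ext_iff.1 h m).1 hm
      · exact Or.inl ⟨Nat.sInf_mem h, fun m hm => Nat.notMem_of_lt_sInf hm⟩
    · rintro (⟨h1, h2⟩ | ⟨rfl, h2⟩)
      · exact IsLeast.csInf_eq ⟨h1, fun m hm => not_lt.1 fun hlt => h2 m hlt hm⟩
      · rw [show {n : ℕ | x ∈ A n} = ∅ from Set.eq_empty_of_forall_notMem h2, Nat.sInf_empty]
  rw [this]
  exact ((hA n).inter (MeasurableSet.biInter (to_countable _) fun m _ => (hA m).compl)).union
    ((MeasurableSet.const _).inter (MeasurableSet.iInter fun m => (hA m).compl))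

theorem measurable_thalerTau : Measurable (thalerTau γ xs) := by
  refine measurable_sInf_nat (A := fun n => {y | 1 ≤ n ∧ (thalerT γ xs)^[n] y ∈ Ioc xs 1})
    fun n => (MeasurableSet.const _).inter (measurable_thalerT.iterate n measurableSet_Ioc)

theorem measurable_thalerF : Measurable (thalerF γ xs) := by
  have : Measurable fun p : ℕ × ℝ => (thalerT γ xs)^[p.1] p.2 :=
    measurable_from_prod_countable_right fun n => measurable_thalerT.iterate n
  exact this.comp (measurable_thalerTau.prodMk measurable_id)

theorem measurable_thalerH : Measurable (thalerH γ) := by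
  unfold thalerH; fun_prop

end Measurability

namespace ThalerParam

variable {γ xs : ℝ}

theorem setIntegral_thalerH (P : ThalerParam γ xs) {a b : ℝ} (ha : 0 < a) (hab : a ≤ b)
    (hb : b ≤ 1) : ∫ x in Ioc a b, (thalerH γ x : ℂ) =
      ((thalerG γ b ^ (1 - γ) - thalerG γ a ^ (1 - γ)) / (1 - γ) : ℝ) := by
  have h := setIntegral_thalerH_mul P.ne_one ha hab hb (fun _ => 1) (fun _ => 1)
  simp only [mul_one] at h
  have hga := thalerG_pos (γ := γ) ⟨ha, hab.trans hb⟩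
  have hle := (strictMonoOn_thalerG P.ne_one).monotoneOn ⟨ha, hab.trans hb⟩ ⟨ha.trans_le hab, hb⟩ hab
  rw [h, integral_complex_ofReal, ← intervalIntegral.integral_of_le hle, integral_rpow]
  · rw [show -γ + 1 = 1 - γ by ring]
  · refine Or.inr ⟨fun h => P.ne_one (by linarith), fun h0 => ?_⟩
    rw [uIcc_of_le hle] at h0
    exact absurd h0.1 hga.not_ge

theorem setIntegral_thalerH_Y (P : ThalerParam γ xs) :
    ∫ x in Ioc xs 1, (thalerH γ x : ℂ) = (total γ : ℝ) := by
  rw [P.setIntegral_thalerH P.mem.1 P.mem.2.le le_rfl, thalerG_one P.ne_one,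
    thalerG_branchPoint P.eq, Real.one_rpow, total]

theorem setIntegral_thalerH_branch (P : ThalerParam γ xs) (k : ℕ) :
    ∫ x in thalerBranch γ k, (thalerH γ x : ℂ) = (thalerMass γ k : ℝ) := by
  have hm1 := one_add_mem (P.cut_mem (k + 1))
  have hm0 := one_add_mem (P.cut_mem k)
  rw [thalerBranch, P.setIntegral_thalerH (P.inv_mem hm1).1
    (monotone_thalerInv (by linarith [P.cut_lt k])) (P.inv_mem hm0).2, P.g_inv hm1, P.g_inv hm0,
    thalerMass]

theorem thalerMu_restrict (P : ThalerParam γ xs) :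
    (thalerMu γ).restrict (Ioc xs 1) =
      (volume.restrict (Ioc xs 1)).withDensity fun x => ENNReal.ofReal (thalerH γ x) := by
  have hsub : Ioc xs 1 ⊆ Icc (0 : ℝ) 1 := fun x hx => ⟨(P.mem.1.trans hx.1).le, hx.2⟩
  rw [thalerMu, restrict_withDensity measurableSet_Ioc, Measure.restrict_restrict measurableSet_Ioc,
    inter_eq_left.2 hsub]

theorem thalerMu_Y (P : ThalerParam γ xs) : thalerMu γ (Ioc xs 1) = ENNReal.ofReal (total γ) := by
  have hint : ∫ x in Ioc xs 1, thalerH γ x = total γ := by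
    have := P.setIntegral_thalerH_Y
    rw [integral_complex_ofReal] at this
    exact_mod_cast this
  rw [← Measure.restrict_apply_univ, P.thalerMu_restrict, withDensity_apply _ MeasurableSet.univ,
    Measure.restrict_univ, ← ofReal_integral_eq_lintegral_ofReal, hint]
  · by_contra h
    rw [integral_undef h] at hint
    exact P.total_pos.ne hint
  · refine (ae_restrict_iff' measurableSet_Ioc).2 (Eventually.of_forall fun x hx => ?_)
    exact (thalerH_pos (P.mem.1.trans hx.1)).le

theorem thalerMuY_eq (P : ThalerParam γ xs) : thalerMuY γ xs = (ENNReal.ofReal (total γ))⁻¹ •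
    (volume.restrict (Ioc xs 1)).withDensity fun x => ENNReal.ofReal (thalerH γ x) := by
  rw [thalerMuY, P.thalerMu_Y, P.thalerMu_restrict]

theorem isProbabilityMeasure (P : ThalerParam γ xs) : IsProbabilityMeasure (thalerMuY γ xs) := by
  refine ⟨?_⟩
  rw [thalerMuY, Measure.smul_apply, Measure.restrict_apply_univ, smul_eq_mul, P.thalerMu_Y]
  exact ENNReal.inv_mul_cancel (by simpa using P.total_pos) ENNReal.ofReal_ne_top

theorem absolutelyContinuous (P : ThalerParam γ xs) :
    thalerMuY γ xs ≪ volume.restrict (Ioc xs 1) := by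
  rw [P.thalerMuY_eq]
  exact (withDensity_absolutelyContinuous _ _).smul_left _

theorem ae_mem (P : ThalerParam γ xs) : ∀ᵐ y ∂thalerMuY γ xs, y ∈ Ioc xs 1 :=
  P.absolutelyContinuous.ae_le (ae_restrict_mem measurableSet_Ioc)

theorem setIntegral_muY (P : ThalerParam γ xs) {s : Set ℝ} (hs : MeasurableSet s)
    (hsub : s ⊆ Ioc xs 1) (f : ℝ → ℂ) : ∫ y in s, f y ∂thalerMuY γ xs =
      (total γ : ℂ)⁻¹ * ∫ y in s, (thalerH γ y : ℂ) * f y := by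
  rw [P.thalerMuY_eq, Measure.restrict_smul, integral_smul_measure, restrict_withDensity hs,
    Measure.restrict_restrict hs, inter_eq_left.2 hsub,
    integral_withDensity_eq_integral_toReal_smul (measurable_thalerH.ennreal_ofReal)
      (Eventually.of_forall fun _ => ENNReal.ofReal_lt_top), ENNReal.toReal_inv,
    ENNReal.toReal_ofReal P.total_pos.le, Complex.real_smul, Complex.ofReal_inv]
  congr 1
  refine setIntegral_congr_fun hs fun y hy => ?_
  simp only [Complex.real_smul]
  rw [ENNReal.toReal_ofReal (thalerH_pos (P.mem.1.trans (hsub hy).1)).le]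

theorem restrict_Y (P : ThalerParam γ xs) : (thalerMuY γ xs).restrict (Ioc xs 1) = thalerMuY γ xs :=
  Measure.restrict_eq_self_of_ae_mem P.ae_mem

theorem integral_muY (P : ThalerParam γ xs) (f : ℝ → ℂ) : ∫ y, f y ∂thalerMuY γ xs =
      (total γ : ℂ)⁻¹ * ∫ y in Ioc xs 1, (thalerH γ y : ℂ) * f y := by
  rw [← P.setIntegral_muY measurableSet_Ioc subset_rfl, P.restrict_Y]

theorem measurableSet_branch (k : ℕ) : MeasurableSet (thalerBranch γ k) := measurableSet_Ioc

/-- Change of variables along a branch of the first return map. -/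
theorem integral_branch (P : ThalerParam γ xs) (f u : ℝ → ℂ) (k : ℕ) :
    ∫ y in thalerBranch γ k, f y * u (thalerF γ xs y) ∂thalerMuY γ xs =
      ∫ x, dualProb γ k x * f (returnPre γ k x) * u x ∂thalerMuY γ xs := by
  rw [P.setIntegral_muY (measurableSet_branch k) (P.branch_subset k), P.setIntegral_branch,
    P.integral_muY]

theorem hasSum_integral_branch (P : ThalerParam γ xs) {f : ℝ → ℂ}
    (hf : Integrable f (thalerMuY γ xs)) :
    HasSum (fun k => ∫ y in thalerBranch γ k, f y ∂thalerMuY γ xs) (∫ y, f y ∂thalerMuY γ xs) := by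
  have := hasSum_integral_iUnion measurableSet_branch P.pairwise_disjoint_branch
    hf.integrableOn
  rwa [P.iUnion_branch, P.restrict_Y] at this

theorem setIntegral_branch_const (P : ThalerParam γ xs) (k : ℕ) (c : ℂ) :
    ∫ _ in thalerBranch γ k, c ∂thalerMuY γ xs = (thalerMass γ k / total γ : ℝ) * c := by
  rw [P.setIntegral_muY (measurableSet_branch k) (P.branch_subset k), integral_mul_const,
    P.setIntegral_thalerH_branch]
  push_cast; ring

/-! ### Monotonicity of the dual chain -/

theorem thalerR_eq {z : ℝ} (hz : 0 < z) : thalerR γ z = (1 + (z / (z + 1)) ^ γ)⁻¹ := by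
  have h1 := Real.rpow_pos_of_pos hz γ
  have h2 := Real.rpow_pos_of_pos (by linarith : 0 < z + 1) γ
  rw [thalerR, thalerH, Real.rpow_neg hz.le, Real.rpow_neg (by linarith),
    Real.div_rpow hz.le (by linarith)]
  field_simp

theorem thalerR_pos {z : ℝ} (hz : 0 < z) : 0 < thalerR γ z :=
  div_pos (Real.rpow_pos_of_pos hz _) (thalerH_pos hz)

theorem thalerR_le_one {z : ℝ} (hz : 0 < z) : thalerR γ z ≤ 1 := by
  rw [thalerR_eq hz]
  exact inv_le_one_of_one_le₀ (by linarith [Real.rpow_pos_of_pos (by positivity : 0 < z / (z + 1)) γ])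

theorem thalerR_anti (P : ThalerParam γ xs) {z w : ℝ} (hz : 0 < z) (hzw : z ≤ w) :
    thalerR γ w ≤ thalerR γ z := by
  have hw := hz.trans_le hzw
  rw [thalerR_eq hz, thalerR_eq hw]
  have h : z / (z + 1) ≤ w / (w + 1) := by
    rw [div_le_div_iff₀ (by linarith) (by linarith)]; nlinarith
  have := Real.rpow_le_rpow (by positivity) h P.pos.le
  exact inv_anti₀ (by positivity) (by linarith)

theorem half_lt_thalerR_one (P : ThalerParam γ xs) : 1 / 2 < thalerR γ 1 := by
  rw [thalerR_eq one_pos, one_div]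
  have : ((1 : ℝ) / (1 + 1)) ^ γ < 1 := Real.rpow_lt_one (by norm_num) (by norm_num) P.pos
  have h0 : 0 < ((1 : ℝ) / (1 + 1)) ^ γ := by positivity
  exact inv_strictAnti₀ (by linarith) (by linarith)

theorem leftPre_zero (x : ℝ) : leftPre γ 0 x = x := rfl

theorem leftPre_succ (k : ℕ) (x : ℝ) : leftPre γ (k + 1) x = leftPre γ k (thalerInv γ x) :=
  Function.iterate_succ_apply _ _ _

theorem monotone_leftPre (k : ℕ) : Monotone (leftPre γ k) := monotone_thalerInv.iterate k

theorem leftPre_mem (P : ThalerParam γ xs) (k : ℕ) {x : ℝ} (hx : x ∈ Ioc (0 : ℝ) 1) :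
    leftPre γ k x ∈ Ioc (0 : ℝ) 1 := by
  induction k generalizing x with
  | zero => exact hx
  | succ k ih => rw [leftPre_succ]; exact ih (P.inv_mem (mem_two hx))

theorem leftPre_one (k : ℕ) : leftPre γ k 1 = thalerCut γ k := rfl

theorem leftPre_xs (P : ThalerParam γ xs) (k : ℕ) : leftPre γ k xs = thalerCut γ (k + 1) := by
  rw [← leftPre_one, leftPre_succ, P.inv_one]

theorem Icc_subset (P : ThalerParam γ xs) : Icc xs 1 ⊆ Ioc 0 1 := fun _ hx =>
  ⟨P.mem.1.trans_le hx.1, hx.2⟩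

theorem xs_mem (P : ThalerParam γ xs) : xs ∈ Icc xs 1 := ⟨le_rfl, P.mem.2.le⟩

theorem one_mem (P : ThalerParam γ xs) : (1 : ℝ) ∈ Icc xs 1 := ⟨P.mem.2.le, le_rfl⟩

theorem monotone_returnPre (k : ℕ) : Monotone (returnPre γ k) := fun _ _ h =>
  monotone_thalerInv (by linarith [monotone_leftPre (γ := γ) k h])

theorem inv_one_add_mem (P : ThalerParam γ xs) {z : ℝ} (hz : z ∈ Ioc (0 : ℝ) 1) :
    thalerInv γ (1 + z) ∈ Icc xs 1 := by
  refine ⟨?_, (P.inv_mem (one_add_mem hz)).2⟩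
  rw [← P.inv_one]
  exact monotone_thalerInv (by linarith [hz.1])

theorem returnPre_mem (P : ThalerParam γ xs) (k : ℕ) {x : ℝ} (hx : x ∈ Icc xs 1) :
    returnPre γ k x ∈ Icc xs 1 := P.inv_one_add_mem (P.leftPre_mem k (P.Icc_subset hx))

theorem dualTail_zero (x : ℝ) : dualTail γ 0 x = 1 := Finset.prod_range_zero _

theorem dualTail_succ (k : ℕ) (x : ℝ) :
    dualTail γ (k + 1) x = dualTail γ k x * thalerR γ (leftPre γ k x) :=
  Finset.prod_range_succ _ _

theorem dualTail_succ' (k : ℕ) (x : ℝ) :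
    dualTail γ (k + 1) x = thalerR γ x * dualTail γ k (thalerInv γ x) := by
  rw [dualTail, Finset.prod_range_succ', mul_comm]
  rfl

theorem dualProb_zero (x : ℝ) : dualProb γ 0 x = 1 - thalerR γ x := by
  rw [dualProb, dualTail_zero, one_mul, leftPre_zero]

theorem dualProb_succ (k : ℕ) (x : ℝ) :
    dualProb γ (k + 1) x = thalerR γ x * dualProb γ k (thalerInv γ x) := by
  rw [dualProb, dualTail_succ', leftPre_succ, dualProb, mul_assoc]

theorem returnPre_succ (k : ℕ) (x : ℝ) :
    returnPre γ (k + 1) x = returnPre γ k (thalerInv γ x) := by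
  rw [returnPre, leftPre_succ, returnPre]

theorem dualTail_pos (P : ThalerParam γ xs) (k : ℕ) {x : ℝ} (hx : x ∈ Ioc (0 : ℝ) 1) :
    0 < dualTail γ k x := Finset.prod_pos fun j _ => thalerR_pos (P.leftPre_mem j hx).1

theorem dualTail_anti (P : ThalerParam γ xs) (k : ℕ) {x y : ℝ} (hx : x ∈ Ioc (0 : ℝ) 1)
    (hy : y ∈ Ioc (0 : ℝ) 1) (hxy : x ≤ y) : dualTail γ k y ≤ dualTail γ k x :=
  Finset.prod_le_prod (fun j _ => (thalerR_pos (P.leftPre_mem j hy).1).le) fun j _ =>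
    P.thalerR_anti (P.leftPre_mem j hx).1 (monotone_leftPre j hxy)

theorem dualTail_succ_le (P : ThalerParam γ xs) (k : ℕ) {x : ℝ} (hx : x ∈ Ioc (0 : ℝ) 1) :
    dualTail γ (k + 1) x ≤ dualTail γ k x := by
  rw [dualTail_succ]
  exact mul_le_of_le_one_right (P.dualTail_pos k hx).le (thalerR_le_one (P.leftPre_mem k hx).1)

theorem dualProb_nonneg (P : ThalerParam γ xs) (k : ℕ) {x : ℝ} (hx : x ∈ Ioc (0 : ℝ) 1) :
    0 ≤ dualProb γ k x :=
  mul_nonneg (P.dualTail_pos k hx).le (sub_nonneg.2 (thalerR_le_one (P.leftPre_mem k hx).1))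

theorem sum_dualProb (n : ℕ) (x : ℝ) :
    ∑ k ∈ Finset.range n, dualProb γ k x = 1 - dualTail γ n x := by
  induction n with
  | zero => simp [dualTail_zero]
  | succ n ih => rw [Finset.sum_range_succ, ih, dualTail_succ, dualProb]; ring

theorem measurable_leftPre (k : ℕ) : Measurable (leftPre γ k) := (monotone_leftPre k).measurable

theorem measurable_thalerR : Measurable (thalerR γ) := by
  unfold thalerR
  exact (by fun_prop : Measurable fun z : ℝ => z ^ (-γ)).div measurable_thalerH

theorem measurable_dualProb (k : ℕ) : Measurable (dualProb γ k) := by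
  unfold dualProb dualTail
  exact (Finset.measurable_prod _ fun j _ => measurable_thalerR.comp (measurable_leftPre j)).mul
    ((measurable_thalerR.comp (measurable_leftPre k)).const_sub 1)

theorem dualProb_le_one (P : ThalerParam γ xs) (k : ℕ) {x : ℝ} (hx : x ∈ Ioc (0 : ℝ) 1) :
    dualProb γ k x ≤ 1 := by
  have h := sum_dualProb (γ := γ) (k + 1) x
  have h1 := Finset.single_le_sum (fun i _ => P.dualProb_nonneg i hx)
    (Finset.mem_range.2 (Nat.lt_succ_self k))
  linarith [P.dualTail_pos (k + 1) hx]

theorem integrable_dualProb (P : ThalerParam γ xs) (k : ℕ) :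
    Integrable (dualProb γ k) (thalerMuY γ xs) := by
  have := P.isProbabilityMeasure
  refine Integrable.of_bound (measurable_dualProb k).aestronglyMeasurable 1 ?_
  filter_upwards [P.ae_mem] with x hx
  have hx' := P.Icc_subset (Ioc_subset_Icc_self hx)
  rw [Real.norm_of_nonneg (P.dualProb_nonneg k hx')]
  exact P.dualProb_le_one k hx'

theorem integral_dualProb (P : ThalerParam γ xs) (k : ℕ) :
    ∫ x, dualProb γ k x ∂thalerMuY γ xs = thalerMass γ k / total γ := by
  have h := P.integral_branch (fun _ => 1) (fun _ => 1) k
  simp only [mul_one] at h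
  rw [P.setIntegral_branch_const, mul_one, integral_complex_ofReal] at h
  exact_mod_cast h.symm

theorem dualTail_xs (P : ThalerParam γ xs) (k : ℕ) :
    dualTail γ k xs = dualTail γ (k + 1) 1 / thalerR γ 1 := by
  rw [dualTail_succ', P.inv_one, mul_div_cancel_left₀ _ (thalerR_pos one_pos).ne']

theorem tendsto_dualTail_one (P : ThalerParam γ xs) :
    Tendsto (fun n => dualTail γ n 1) atTop (𝓝 0) := by
  have := P.isProbabilityMeasure
  have hle : ∀ n, dualTail γ n 1 ≤ 1 - (∑ k ∈ Finset.range n, thalerMass γ k) / total γ := by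
    intro n
    have h1 : ∑ k ∈ Finset.range n, thalerMass γ k / total γ ≤ 1 - dualTail γ n 1 := by
      simp only [← P.integral_dualProb]
      rw [← integral_finsetSum _ fun k _ => P.integrable_dualProb k]
      have h2 := integral_mono_ae (μ := thalerMuY γ xs) (g := fun _ => 1 - dualTail γ n 1)
        (integrable_finsetSum (Finset.range n) fun k _ => P.integrable_dualProb k)
        (integrable_const _) ?_
      · simpa using h2
      · filter_upwards [P.ae_mem] with x hx
        have hx' := P.Icc_subset (Ioc_subset_Icc_self hx)
        have := P.dualTail_anti n hx' ⟨one_pos, le_rfl⟩ hx.2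
        simp only [sum_dualProb]; linarith
    rw [Finset.sum_div]; linarith
  have hlim : Tendsto (fun n => 1 - (∑ k ∈ Finset.range n, thalerMass γ k) / total γ) atTop
      (𝓝 0) := by
    have := (P.hasSum_mass.tendsto_sum_nat.div_const (total γ)).const_sub 1
    rwa [div_self P.total_pos.ne', sub_self] at this
  exact squeeze_zero (fun n => (P.dualTail_pos n ⟨one_pos, le_rfl⟩).le) hle hlim

theorem tendsto_dualTail (P : ThalerParam γ xs) {x : ℝ} (hx : x ∈ Icc xs 1) :
    Tendsto (fun n => dualTail γ n x) atTop (𝓝 0) := by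
  have h := ((tendsto_add_atTop_iff_nat 1).2 P.tendsto_dualTail_one).div_const (thalerR γ 1)
  rw [zero_div] at h
  simp only [← P.dualTail_xs] at h
  exact squeeze_zero (fun n => (P.dualTail_pos n (P.Icc_subset hx)).le)
    (fun n => P.dualTail_anti n (P.Icc_subset P.xs_mem) (P.Icc_subset hx) hx.1) h

theorem hasSum_dualProb (P : ThalerParam γ xs) {x : ℝ} (hx : x ∈ Icc xs 1) :
    HasSum (fun k => dualProb γ k x) 1 := by
  refine (hasSum_iff_tendsto_nat_of_nonneg
    (fun k => P.dualProb_nonneg k (P.Icc_subset hx)) _).2 ?_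
  simp only [sum_dualProb]
  simpa using (P.tendsto_dualTail hx).const_sub 1

/-! ### Uniform bounds for the branch weights -/

/-- A bound for the supremum and the variation of `dualProb γ k` on `Y`. -/
def weightBound (γ xs : ℝ) (k : ℕ) : ℝ := 2 * (dualTail γ k xs * (1 - thalerR γ (thalerCut γ k)))

/-- A monotone function controlling the oscillation of `dualProb γ k`. -/
def weightVar (γ xs : ℝ) (k : ℕ) (x : ℝ) : ℝ :=
  -dualTail γ k x * (1 - thalerR γ (thalerCut γ k)) +
    dualTail γ k xs * (1 - thalerR γ (leftPre γ k x))

theorem one_sub_thalerR_le (P : ThalerParam γ xs) (k : ℕ) {x : ℝ} (hx : x ∈ Icc xs 1) :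
    1 - thalerR γ (leftPre γ k x) ≤ 1 - thalerR γ (thalerCut γ k) := by
  have := P.thalerR_anti (P.leftPre_mem k (P.Icc_subset hx)).1 (monotone_leftPre k hx.2)
  rw [leftPre_one] at this
  linarith

theorem dualTail_le_xs (P : ThalerParam γ xs) (k : ℕ) {x : ℝ} (hx : x ∈ Icc xs 1) :
    dualTail γ k x ≤ dualTail γ k xs :=
  P.dualTail_anti k (P.Icc_subset P.xs_mem) (P.Icc_subset hx) hx.1

theorem weightBound_nonneg (P : ThalerParam γ xs) (k : ℕ) : 0 ≤ weightBound γ xs k :=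
  mul_nonneg two_pos.le (mul_nonneg (P.dualTail_pos k (P.Icc_subset P.xs_mem)).le
    (sub_nonneg.2 (thalerR_le_one (P.cut_mem k).1)))

theorem dualProb_le_weightBound (P : ThalerParam γ xs) (k : ℕ) {x : ℝ} (hx : x ∈ Icc xs 1) :
    dualProb γ k x ≤ weightBound γ xs k := by
  have h1 : dualProb γ k x ≤ dualTail γ k xs * (1 - thalerR γ (thalerCut γ k)) :=
    mul_le_mul (P.dualTail_le_xs k hx) (P.one_sub_thalerR_le k hx)
      (sub_nonneg.2 (thalerR_le_one (P.leftPre_mem k (P.Icc_subset hx)).1))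
      (P.dualTail_pos k (P.Icc_subset P.xs_mem)).le
  have := P.weightBound_nonneg k
  unfold weightBound at *
  linarith

theorem abs_dualProb_sub_le (P : ThalerParam γ xs) (k : ℕ) {x y : ℝ} (hx : x ∈ Icc xs 1)
    (hy : y ∈ Icc xs 1) (hxy : x ≤ y) :
    |dualProb γ k y - dualProb γ k x| ≤ weightVar γ xs k y - weightVar γ xs k x := by
  have ha := P.dualTail_anti k (P.Icc_subset hx) (P.Icc_subset hy) hxy
  have hb := P.thalerR_anti (P.leftPre_mem k (P.Icc_subset hx)).1 (monotone_leftPre k hxy)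
  have hcx := P.one_sub_thalerR_le k hx
  have hcy := P.one_sub_thalerR_le k hy
  have hx1 := thalerR_le_one (γ := γ) (P.leftPre_mem k (P.Icc_subset hx)).1
  have hdx := P.dualTail_le_xs k hx
  have hdy := P.dualTail_le_xs k hy
  have hy0 := (P.dualTail_pos k (P.Icc_subset hy)).le
  unfold dualProb weightVar
  generalize thalerR γ (leftPre γ k x) = a at *
  generalize thalerR γ (leftPre γ k y) = b at *
  generalize dualTail γ k x = p at *
  generalize dualTail γ k y = q at *
  generalize dualTail γ k xs = Q at *
  generalize thalerR γ (thalerCut γ k) = R at *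
  rw [abs_le]
  constructor <;>
  nlinarith [mul_nonneg (sub_nonneg.2 ha) (sub_nonneg.2 hcx),
    mul_nonneg (sub_nonneg.2 ha) (sub_nonneg.2 hcy), mul_nonneg (sub_nonneg.2 hb) (sub_nonneg.2 hdx),
    mul_nonneg (sub_nonneg.2 hb) (sub_nonneg.2 hdy), mul_nonneg (sub_nonneg.2 ha) (sub_nonneg.2 hx1),
    mul_nonneg (sub_nonneg.2 hb) hy0]

theorem weightVar_sub_le (P : ThalerParam γ xs) (k : ℕ) :
    weightVar γ xs k 1 - weightVar γ xs k xs ≤ weightBound γ xs k := by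
  have h1 := (P.dualTail_pos k ⟨one_pos, le_rfl⟩).le
  have h2 := (P.dualTail_pos k (P.Icc_subset P.xs_mem)).le
  have h3 := thalerR_le_one (γ := γ) (P.cut_mem k).1
  have h4 := thalerR_le_one (γ := γ) (P.leftPre_mem k (P.Icc_subset P.xs_mem)).1
  unfold weightVar weightBound
  rw [leftPre_one]
  nlinarith [mul_nonneg h1 (sub_nonneg.2 h3), mul_nonneg h2 (sub_nonneg.2 h4)]

theorem weightBound_succ_le (P : ThalerParam γ xs) (k : ℕ) :
    weightBound γ xs (k + 1) ≤ 4 / total γ * thalerMass γ k := by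
  have := P.isProbabilityMeasure
  have hM := P.total_pos
  have hR := P.half_lt_thalerR_one
  have h1mem : (1 : ℝ) ∈ Ioc (0 : ℝ) 1 := ⟨one_pos, le_rfl⟩
  have hR' : 0 ≤ 1 - thalerR γ (thalerCut γ (k + 1)) :=
    sub_nonneg.2 (thalerR_le_one (P.cut_mem _).1)
  have hA : dualTail γ (k + 1) 1 * (1 - thalerR γ (thalerCut γ (k + 1))) ≤
      thalerMass γ k / total γ := by
    rw [← P.integral_dualProb]
    have := integral_mono_ae (μ := thalerMuY γ xs) (integrable_const
      (dualTail γ (k + 1) 1 * (1 - thalerR γ (thalerCut γ (k + 1))))) (P.integrable_dualProb k) ?_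
    · simpa using this
    · filter_upwards [P.ae_mem] with x hx
      have hx' := P.Icc_subset (Ioc_subset_Icc_self hx)
      refine mul_le_mul ((P.dualTail_succ_le k h1mem).trans (P.dualTail_anti k hx' h1mem hx.2)) ?_
        hR' (P.dualTail_pos k hx').le
      have := P.thalerR_anti (P.cut_mem (k + 1)).1
        ((P.leftPre_xs k).symm.trans_le (monotone_leftPre k hx.1.le))
      linarith
  have hB : dualTail γ (k + 1) xs ≤ 2 * dualTail γ (k + 1) 1 := by
    rw [P.dualTail_xs, div_le_iff₀ (by linarith)]
    have := P.dualTail_succ_le (k + 1) h1mem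
    have := (P.dualTail_pos (k + 1) h1mem)
    nlinarith
  have := mul_le_mul_of_nonneg_right hB hR'
  rw [weightBound, div_mul_eq_mul_div, mul_div_assoc]
  linarith

theorem exists_weightBound_le (P : ThalerParam γ xs) :
    ∃ K, 0 < K ∧ ∀ k : ℕ, weightBound γ xs k ≤ K * ((k : ℝ) + 1) ^ (-(1 + γ⁻¹)) := by
  obtain ⟨B, hB⟩ := P.tendsto_mul_mass.bddAbove_range
  have hB' : ∀ k : ℕ, ((k : ℝ) + 1) ^ (1 + γ⁻¹) * thalerMass γ k ≤ B := fun k => hB ⟨k, rfl⟩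
  have hM := P.total_pos
  have hγ := P.pos
  have hB0 : 0 < B := lt_of_lt_of_le (mul_pos (by positivity) (P.mass_pos 0)) (hB' 0)
  have h0 := P.weightBound_nonneg 0
  refine ⟨weightBound γ xs 0 + 4 / total γ * B * 2 ^ (1 + γ⁻¹), by positivity, fun k => ?_⟩
  rcases k with _ | k
  · simp only [Nat.cast_zero, zero_add, Real.one_rpow, mul_one]
    have : 0 < 4 / total γ * B * 2 ^ (1 + γ⁻¹) := by positivity
    linarith
  · have hk : (0 : ℝ) < (k : ℝ) + 1 := by positivity
    have hm : thalerMass γ k ≤ B * ((k : ℝ) + 1) ^ (-(1 + γ⁻¹)) := by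
      rw [Real.rpow_neg hk.le, ← div_eq_mul_inv, le_div_iff₀ (by positivity), mul_comm]
      exact hB' k
    have h2 : ((k : ℝ) + 1) ^ (-(1 + γ⁻¹)) ≤
        2 ^ (1 + γ⁻¹) * (((k + 1 : ℕ) : ℝ) + 1) ^ (-(1 + γ⁻¹)) := by
      have h3 : (2 : ℝ) ^ (1 + γ⁻¹) = (2⁻¹ : ℝ) ^ (-(1 + γ⁻¹)) := by
        rw [Real.rpow_neg (by norm_num), Real.inv_rpow (by norm_num), inv_inv]
      rw [h3, ← Real.mul_rpow (by norm_num) (by positivity)]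
      refine Real.rpow_le_rpow_of_nonpos (by positivity) ?_ (by
        have : 0 < γ⁻¹ := by positivity
        linarith)
      push_cast; linarith [k.cast_nonneg (α := ℝ)]
    calc weightBound γ xs (k + 1) ≤ 4 / total γ * thalerMass γ k := P.weightBound_succ_le k
      _ ≤ 4 / total γ * (B * (2 ^ (1 + γ⁻¹) * (((k + 1 : ℕ) : ℝ) + 1) ^ (-(1 + γ⁻¹)))) := by
          gcongr; exact hm.trans (by gcongr)
      _ ≤ _ := by
          rw [add_mul]
          have : 0 ≤ weightBound γ xs 0 * (((k + 1 : ℕ) : ℝ) + 1) ^ (-(1 + γ⁻¹)) := by positivity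
          linarith

end ThalerParam

/-- The transfer operator of the first return map, twisted by the multiplier `φ (τ - 1)`. -/
def dualOp (γ : ℝ) (φ : ℕ → ℂ) (f : ℝ → ℂ) (x : ℝ) : ℂ :=
  ∑' k, (dualProb γ k x : ℂ) * (φ k * f (returnPre γ k x))

/-- The transfer operator of the first return map, acting on real functions. -/
def realDual (γ : ℝ) (V : ℝ → ℝ) (x : ℝ) : ℝ := ∑' k, dualProb γ k x * V (returnPre γ k x)

/-- The dual chain, stopped after at most `n` left steps. -/
def stoppedDual (γ : ℝ) (V : ℝ → ℝ) : ℕ → ℝ → ℝ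
  | 0, z => V (thalerInv γ (1 + z))
  | n + 1, z => (1 - thalerR γ z) * V (thalerInv γ (1 + z)) +
      thalerR γ z * stoppedDual γ V n (thalerInv γ z)

/-- `V` controls the oscillation of `f` on `[xs, 1]`. -/
def Controls (xs : ℝ) (V : ℝ → ℝ) (f : ℝ → ℂ) : Prop :=
  ∀ x ∈ Icc xs 1, ∀ y ∈ Icc xs 1, x ≤ y → ‖f y - f x‖ ≤ V y - V x

/-- `f` is bounded by one and has variation at most `v` on `[xs, 1]`. -/
structure VarLE (xs : ℝ) (f : ℝ → ℂ) (v : ℝ) : Prop where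
  norm_le : ∀ x ∈ Icc xs 1, ‖f x‖ ≤ 1
  exists_controls : ∃ V, Controls xs V f ∧ V 1 - V xs ≤ v

namespace Controls

variable {xs : ℝ} {V : ℝ → ℝ} {f : ℝ → ℂ}

theorem monotoneOn (h : Controls xs V f) : MonotoneOn V (Icc xs 1) := fun x hx y hy hxy => by
  linarith [h x hx y hy hxy, norm_nonneg (f y - f x)]

theorem monotoneOn_add_re (h : Controls xs V f) {c : ℂ} (hc : ‖c‖ ≤ 1) :
    MonotoneOn (fun x => V x + (c * f x).re) (Icc xs 1) := fun x hx y hy hxy => by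
  have h1 := (neg_le_abs _).trans (Complex.abs_re_le_norm (c * (f y - f x)))
  rw [norm_mul, mul_sub, Complex.sub_re] at h1
  have := mul_le_of_le_one_left (norm_nonneg (f y - f x)) hc
  have := h x hx y hy hxy
  simp only
  linarith

theorem aemeasurable (h : Controls xs V f) : AEMeasurable f (volume.restrict (Ioc xs 1)) := by
  have aux : ∀ {g : ℝ → ℝ}, MonotoneOn g (Icc xs 1) →
      AEMeasurable g (volume.restrict (Ioc xs 1)) := fun hg =>
    aemeasurable_restrict_of_monotoneOn measurableSet_Ioc (hg.mono Ioc_subset_Icc_self)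
  have hV := aux h.monotoneOn
  have hre := (aux (h.monotoneOn_add_re (c := 1) (by simp))).sub hV
  have him := (aux (h.monotoneOn_add_re (c := -Complex.I) (by simp))).sub hV
  refine ((Complex.measurable_ofReal.comp_aemeasurable hre).add
    ((Complex.measurable_ofReal.comp_aemeasurable him).mul_const Complex.I)).congr ?_
  filter_upwards with x
  apply Complex.ext <;> simp

end Controls

namespace ThalerParam

variable {γ xs : ℝ} {V : ℝ → ℝ} {f : ℝ → ℂ} {φ : ℕ → ℂ} {v : ℝ}

/-! ### Positivity and monotonicity of the transfer operator -/

theorem stoppedDual_le (P : ThalerParam γ xs) (hV : MonotoneOn V (Icc xs 1)) (n : ℕ) {z : ℝ}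
    (hz : z ∈ Ioc (0 : ℝ) 1) : stoppedDual γ V n z ≤ V (thalerInv γ (1 + z)) := by
  induction n generalizing z with
  | zero => exact le_rfl
  | succ n ih =>
    have hw := P.inv_mem (mem_two hz)
    have h1 := ih hw
    have h2 := hV (P.inv_one_add_mem hw) (P.inv_one_add_mem hz)
      (monotone_thalerInv (by linarith [thalerInv_lt P.pos P.ne_one (mem_two hz)]))
    have h3 := mul_le_mul_of_nonneg_left (h1.trans h2) (thalerR_pos (γ := γ) hz.1).le
    rw [stoppedDual]
    linarith

theorem monotoneOn_stoppedDual (P : ThalerParam γ xs) (hV : MonotoneOn V (Icc xs 1)) (n : ℕ) :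
    MonotoneOn (stoppedDual γ V n) (Ioc 0 1) := by
  induction n with
  | zero =>
    exact fun z hz w hw h => hV (P.inv_one_add_mem hz) (P.inv_one_add_mem hw) (monotone_thalerInv (by linarith))
  | succ n ih =>
    intro z hz w hw h
    have hz' := P.inv_mem (mem_two hz)
    have hw' := P.inv_mem (mem_two hw)
    have h1 := hV (P.inv_one_add_mem hz) (P.inv_one_add_mem hw)
      (monotone_thalerInv (γ := γ) (by linarith : 1 + z ≤ 1 + w))
    have h2 := ih hz' hw' (monotone_thalerInv h)
    have h3 := P.thalerR_anti hz.1 h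
    have h4 := thalerR_le_one (γ := γ) hw.1
    have h5 := (thalerR_pos (γ := γ) hw.1).le
    have h6 := (P.stoppedDual_le hV n hz').trans (hV (P.inv_one_add_mem hz') (P.inv_one_add_mem hz)
      (monotone_thalerInv (by linarith [thalerInv_lt P.pos P.ne_one (mem_two hz)])))
    rw [stoppedDual, stoppedDual]
    nlinarith [mul_le_mul_of_nonneg_left h1 (sub_nonneg.2 h4), mul_le_mul_of_nonneg_left h2 h5,
      mul_nonneg (sub_nonneg.2 h3) (sub_nonneg.2 h6)]

theorem stoppedDual_eq (n : ℕ) (x : ℝ) : stoppedDual γ V n x =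
    ∑ k ∈ Finset.range n, dualProb γ k x * V (returnPre γ k x) +
      dualTail γ n x * V (returnPre γ n x) := by
  induction n generalizing x with
  | zero => simp [stoppedDual, dualTail_zero, returnPre, leftPre_zero]
  | succ n ih =>
    rw [stoppedDual, ih, Finset.sum_range_succ', dualTail_succ', dualProb_zero, mul_add,
      Finset.mul_sum, returnPre_succ]
    simp only [dualProb_succ, returnPre_succ, mul_assoc]
    simp only [returnPre, leftPre_zero]
    ring

theorem summable_dualProb_mul (P : ThalerParam γ xs) {x : ℝ} (hx : x ∈ Icc xs 1) {a : ℕ → ℂ}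
    {B : ℝ} (ha : ∀ k, ‖a k‖ ≤ B) : Summable fun k => (dualProb γ k x : ℂ) * a k := by
  refine Summable.of_norm_bounded ((P.hasSum_dualProb hx).summable.mul_right B) fun k => ?_
  rw [norm_mul, Complex.norm_real, Real.norm_of_nonneg (P.dualProb_nonneg k (P.Icc_subset hx))]
  exact mul_le_mul_of_nonneg_left (ha k) (P.dualProb_nonneg k (P.Icc_subset hx))

theorem summable_dualProb_mul_real (P : ThalerParam γ xs) {x : ℝ} (hx : x ∈ Icc xs 1) {a : ℕ → ℝ}
    {B : ℝ} (ha : ∀ k, |a k| ≤ B) : Summable fun k => dualProb γ k x * a k := by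
  refine Summable.of_norm_bounded ((P.hasSum_dualProb hx).summable.mul_right B) fun k => ?_
  rw [norm_mul, Real.norm_of_nonneg (P.dualProb_nonneg k (P.Icc_subset hx))]
  exact mul_le_mul_of_nonneg_left (ha k) (P.dualProb_nonneg k (P.Icc_subset hx))

theorem abs_le_of_monotoneOn (P : ThalerParam γ xs) (hV : MonotoneOn V (Icc xs 1)) {x : ℝ}
    (hx : x ∈ Icc xs 1) : |V x| ≤ |V xs| + |V 1| := by
  have h1 := hV P.xs_mem hx hx.1
  have h2 := hV hx P.one_mem hx.2
  rw [abs_le]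
  constructor <;> linarith [neg_abs_le (V xs), le_abs_self (V 1), abs_nonneg (V xs),
    abs_nonneg (V 1)]

theorem summable_realDual (P : ThalerParam γ xs) (hV : MonotoneOn V (Icc xs 1)) {x : ℝ}
    (hx : x ∈ Icc xs 1) : Summable fun k => dualProb γ k x * V (returnPre γ k x) :=
  P.summable_dualProb_mul_real hx fun k => P.abs_le_of_monotoneOn hV (P.returnPre_mem k hx)

theorem monotoneOn_realDual (P : ThalerParam γ xs) (hV : MonotoneOn V (Icc xs 1)) :
    MonotoneOn (realDual γ V) (Icc xs 1) := by
  have hlim : ∀ x ∈ Icc xs 1, Tendsto (fun n => stoppedDual γ V n x) atTop (𝓝 (realDual γ V x)) := by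
    intro x hx
    simp only [stoppedDual_eq]
    have h1 := (P.summable_realDual hV hx).hasSum.tendsto_sum_nat
    have h2 : Tendsto (fun n => dualTail γ n x * V (returnPre γ n x)) atTop (𝓝 0) :=
      (P.tendsto_dualTail hx).zero_mul_isBoundedUnder_le
        (isBoundedUnder_of ⟨_, fun n => P.abs_le_of_monotoneOn hV (P.returnPre_mem n hx)⟩)
    simpa [realDual] using h1.add h2
  exact fun x hx y hy hxy => le_of_tendsto_of_tendsto' (hlim x hx) (hlim y hy) fun n =>
    P.monotoneOn_stoppedDual hV n (P.Icc_subset hx) (P.Icc_subset hy) hxy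

theorem inv_two (P : ThalerParam γ xs) : thalerInv γ (1 + 1) = 1 := by
  have h := thalerInv_thalerG P.ne_one (x := 1) ⟨one_pos, le_rfl⟩
  rw [thalerG_one P.ne_one] at h
  rw [one_add_one_eq_two, h]

theorem le_realDual (P : ThalerParam γ xs) (hV : MonotoneOn V (Icc xs 1)) {x : ℝ}
    (hx : x ∈ Icc xs 1) : V xs ≤ realDual γ V x := by
  have h1 := (P.hasSum_dualProb hx).mul_right (V xs)
  rw [one_mul] at h1
  exact hasSum_le (fun k => mul_le_mul_of_nonneg_left
    (hV P.xs_mem (P.returnPre_mem k hx) (P.returnPre_mem k hx).1)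
    (P.dualProb_nonneg k (P.Icc_subset hx))) h1 (P.summable_realDual hV hx).hasSum

/-- The transfer operator contracts the variation. -/
theorem realDual_sub_le (P : ThalerParam γ xs) (hV : MonotoneOn V (Icc xs 1)) :
    realDual γ V 1 - realDual γ V xs ≤ (1 - thalerR γ 1) * (V 1 - V xs) := by
  have h : realDual γ V 1 = (1 - thalerR γ 1) * V 1 + thalerR γ 1 * realDual γ V xs := by
    rw [realDual, (P.summable_realDual hV P.one_mem).tsum_eq_zero_add, dualProb_zero, realDual,
      ← tsum_mul_left]
    simp only [dualProb_succ, returnPre_succ, P.inv_one, mul_assoc]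
    rw [returnPre, leftPre_zero, P.inv_two]
  have h1 := P.le_realDual hV P.xs_mem
  have h2 := thalerR_le_one (γ := γ) one_pos
  rw [h]
  nlinarith [mul_nonneg (sub_nonneg.2 h2) (sub_nonneg.2 h1)]

theorem controls_dualOp_one (P : ThalerParam γ xs) (h : Controls xs V f)
    (hf : ∀ x ∈ Icc xs 1, ‖f x‖ ≤ 1) : Controls xs (realDual γ V) (dualOp γ 1 f) := by
  intro x hx y hy hxy
  have hs : ∀ z ∈ Icc xs 1, HasSum (fun k => (dualProb γ k z : ℂ) * f (returnPre γ k z))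
      (dualOp γ 1 f z) := fun z hz => by
    have := (P.summable_dualProb_mul hz fun k => hf _ (P.returnPre_mem k hz)).hasSum
    simpa [dualOp] using this
  obtain ⟨c, hc, hc'⟩ : ∃ c : ℂ, ‖c‖ ≤ 1 ∧ c * (dualOp γ 1 f y - dualOp γ 1 f x) =
      -(‖dualOp γ 1 f y - dualOp γ 1 f x‖ : ℂ) := by
    set w := dualOp γ 1 f y - dualOp γ 1 f x
    by_cases hw : w = 0
    · exact ⟨0, by simp, by simp [hw]⟩
    · refine ⟨-(‖w‖ / w), by simp [hw], by field_simp⟩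
  have hrep : ∀ z ∈ Icc xs 1, realDual γ (fun x => V x + (c * f x).re) z =
      realDual γ V z + (c * dualOp γ 1 f z).re := by
    intro z hz
    have h1 := (P.summable_realDual h.monotoneOn hz).hasSum.add
      (Complex.hasSum_re ((hs z hz).mul_left c))
    rw [realDual, realDual, ← h1.tsum_eq]
    congr 1; ext k
    rw [mul_left_comm, Complex.re_ofReal_mul]; ring
  have hm := P.monotoneOn_realDual (h.monotoneOn_add_re hc) hx hy hxy
  rw [hrep x hx, hrep y hy] at hm
  have h2 : (c * dualOp γ 1 f y).re - (c * dualOp γ 1 f x).re =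
      -‖dualOp γ 1 f y - dualOp γ 1 f x‖ := by
    rw [← Complex.sub_re, ← mul_sub, hc']; simp
  linarith

/-! ### The twisted transfer operator -/

theorem summable_weightBound (P : ThalerParam γ xs) : Summable (weightBound γ xs) := by
  obtain ⟨K, -, hK⟩ := P.exists_weightBound_le
  have h0 : 0 < γ⁻¹ := inv_pos.2 P.pos
  have h1 : Summable fun k : ℕ => ((k : ℝ) + 1) ^ (-(1 + γ⁻¹)) := by
    have := (summable_nat_add_iff 1).2 (Real.summable_nat_rpow.2 (by linarith : -(1 + γ⁻¹) < -1))
    simpa using this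
  exact Summable.of_nonneg_of_le P.weightBound_nonneg hK (h1.mul_left K)

/-- The size of the perturbation of the transfer operator caused by the multiplier `φ`. -/
def twist (γ xs : ℝ) (φ : ℕ → ℂ) : ℝ := ∑' k, ‖φ k - 1‖ * weightBound γ xs k

theorem norm_sub_one_le (hφ : ∀ k, ‖φ k‖ ≤ 1) (k : ℕ) : ‖φ k - 1‖ ≤ 2 := by
  have := norm_sub_le (φ k) 1
  rw [norm_one] at this
  linarith [hφ k]

theorem summable_twist (P : ThalerParam γ xs) (hφ : ∀ k, ‖φ k‖ ≤ 1) :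
    Summable fun k => ‖φ k - 1‖ * weightBound γ xs k :=
  Summable.of_nonneg_of_le (fun k => mul_nonneg (norm_nonneg _) (P.weightBound_nonneg k))
    (fun k => mul_le_mul_of_nonneg_right (norm_sub_one_le hφ k) (P.weightBound_nonneg k))
    (P.summable_weightBound.mul_left 2)

theorem twist_nonneg (P : ThalerParam γ xs) (φ : ℕ → ℂ) : 0 ≤ twist γ xs φ :=
  tsum_nonneg fun k => mul_nonneg (norm_nonneg _) (P.weightBound_nonneg k)

theorem norm_dualOp_le (P : ThalerParam γ xs) (hφ : ∀ k, ‖φ k‖ ≤ 1)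
    (hf : ∀ x ∈ Icc xs 1, ‖f x‖ ≤ 1) {x : ℝ} (hx : x ∈ Icc xs 1) : ‖dualOp γ φ f x‖ ≤ 1 := by
  refine tsum_of_norm_bounded (P.hasSum_dualProb hx) fun k => ?_
  have h0 := P.dualProb_nonneg k (P.Icc_subset hx)
  rw [norm_mul, Complex.norm_real, Real.norm_of_nonneg h0, norm_mul]
  exact mul_le_of_le_one_right h0
    (mul_le_one₀ (hφ k) (norm_nonneg _) (hf _ (P.returnPre_mem k hx)))

/-- The control function for the perturbation of the transfer operator. -/
def twistVar (γ xs : ℝ) (φ : ℕ → ℂ) (V : ℝ → ℝ) (k : ℕ) (x : ℝ) : ℝ :=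
  ‖φ k - 1‖ * ((weightVar γ xs k x - weightVar γ xs k xs) +
    weightBound γ xs k * (V (returnPre γ k x) - V xs))

theorem monotoneOn_weightVar (P : ThalerParam γ xs) (k : ℕ) :
    MonotoneOn (weightVar γ xs k) (Icc xs 1) := fun x hx y hy hxy => by
  linarith [P.abs_dualProb_sub_le k hx hy hxy, abs_nonneg (dualProb γ k y - dualProb γ k x)]

theorem twistVar_nonneg (P : ThalerParam γ xs) (hV : MonotoneOn V (Icc xs 1)) (k : ℕ) {x : ℝ}
    (hx : x ∈ Icc xs 1) : 0 ≤ twistVar γ xs φ V k x := by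
  have h1 := P.monotoneOn_weightVar k P.xs_mem hx hx.1
  have h2 := hV P.xs_mem (P.returnPre_mem k hx) (P.returnPre_mem k hx).1
  exact mul_nonneg (norm_nonneg _) (add_nonneg (sub_nonneg.2 h1)
    (mul_nonneg (P.weightBound_nonneg k) (sub_nonneg.2 h2)))

theorem twistVar_le (P : ThalerParam γ xs) (hV : MonotoneOn V (Icc xs 1)) (k : ℕ) {x : ℝ}
    (hx : x ∈ Icc xs 1) : twistVar γ xs φ V k x ≤
      ‖φ k - 1‖ * weightBound γ xs k * (1 + (V 1 - V xs)) := by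
  have h1 := P.monotoneOn_weightVar k hx P.one_mem hx.2
  have h2 := hV (P.returnPre_mem k hx) P.one_mem (P.returnPre_mem k hx).2
  have h3 := P.weightVar_sub_le k
  have h4 := mul_le_mul_of_nonneg_left h2 (P.weightBound_nonneg k)
  rw [twistVar, mul_assoc]
  refine mul_le_mul_of_nonneg_left ?_ (norm_nonneg _)
  linarith

theorem summable_twistVar (P : ThalerParam γ xs) (hφ : ∀ k, ‖φ k‖ ≤ 1)
    (hV : MonotoneOn V (Icc xs 1)) {x : ℝ} (hx : x ∈ Icc xs 1) :
    Summable fun k => twistVar γ xs φ V k x :=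
  Summable.of_nonneg_of_le (fun k => P.twistVar_nonneg hV k hx) (fun k => P.twistVar_le hV k hx)
    ((P.summable_twist hφ).mul_right _)

theorem norm_term_sub_le (P : ThalerParam γ xs) (h : Controls xs V f)
    (hf : ∀ x ∈ Icc xs 1, ‖f x‖ ≤ 1) (k : ℕ) {x y : ℝ} (hx : x ∈ Icc xs 1) (hy : y ∈ Icc xs 1)
    (hxy : x ≤ y) :
    ‖(dualProb γ k y : ℂ) * ((φ k - 1) * f (returnPre γ k y)) -
      (dualProb γ k x : ℂ) * ((φ k - 1) * f (returnPre γ k x))‖ ≤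
      twistVar γ xs φ V k y - twistVar γ xs φ V k x := by
  have h1 := P.abs_dualProb_sub_le k hx hy hxy
  have h2 := h _ (P.returnPre_mem k hx) _ (P.returnPre_mem k hy) (monotone_returnPre k hxy)
  have h3 := hf _ (P.returnPre_mem k hy)
  have h4 := P.dualProb_le_weightBound k hx
  have h5 := P.dualProb_nonneg k (P.Icc_subset hx)
  rw [show (dualProb γ k y : ℂ) * ((φ k - 1) * f (returnPre γ k y)) -
      (dualProb γ k x : ℂ) * ((φ k - 1) * f (returnPre γ k x)) =
      (φ k - 1) * (((dualProb γ k y - dualProb γ k x : ℝ) : ℂ) * f (returnPre γ k y) +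
        (dualProb γ k x : ℂ) * (f (returnPre γ k y) - f (returnPre γ k x))) by push_cast; ring,
    norm_mul, twistVar, twistVar, ← mul_sub]
  refine mul_le_mul_of_nonneg_left ((norm_add_le _ _).trans ?_) (norm_nonneg _)
  rw [norm_mul, norm_mul, Complex.norm_real, Complex.norm_real, Real.norm_eq_abs,
    Real.norm_of_nonneg h5]
  have h6 := mul_le_mul h1 h3 (norm_nonneg _) ((abs_nonneg _).trans h1)
  have h7 := mul_le_mul h4 h2 (norm_nonneg _) (P.weightBound_nonneg k)
  linarith

theorem varLE_dualOp (P : ThalerParam γ xs) (hφ : ∀ k, ‖φ k‖ ≤ 1) (hf : VarLE xs f v) :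
    VarLE xs (dualOp γ φ f) ((1 / 2 + twist γ xs φ) * v + twist γ xs φ) := by
  refine ⟨fun x hx => P.norm_dualOp_le hφ hf.norm_le hx, ?_⟩
  obtain ⟨V, hV, hv⟩ := hf.exists_controls
  have hm := hV.monotoneOn
  have hsplit : ∀ x ∈ Icc xs 1, HasSum (fun k => (dualProb γ k x : ℂ) *
      ((φ k - 1) * f (returnPre γ k x))) (dualOp γ φ f x - dualOp γ 1 f x) := by
    intro x hx
    have h1 : Summable fun k => (dualProb γ k x : ℂ) * (φ k * f (returnPre γ k x)) :=
      P.summable_dualProb_mul (B := 1) hx fun k => by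
        rw [norm_mul]
        exact mul_le_one₀ (hφ k) (norm_nonneg _) (hf.norm_le _ (P.returnPre_mem k hx))
    have h2 : Summable fun k => (dualProb γ k x : ℂ) * ((1 : ℕ → ℂ) k * f (returnPre γ k x)) :=
      P.summable_dualProb_mul (B := 1) hx fun k => by
        rw [Pi.one_apply, one_mul]
        exact hf.norm_le _ (P.returnPre_mem k hx)
    refine (h1.hasSum.sub h2.hasSum).congr_fun fun k => ?_
    simp only [Pi.one_apply]; ring
  refine ⟨fun x => realDual γ V x + ∑' k, twistVar γ xs φ V k x, fun x hx y hy hxy => ?_, ?_⟩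
  · have h1 := P.controls_dualOp_one hV hf.norm_le x hx y hy hxy
    have h2 := (P.summable_twistVar hφ hm hy).hasSum.sub (P.summable_twistVar hφ hm hx).hasSum
    have h3 := (hsplit y hy).sub (hsplit x hx)
    have h4 := tsum_of_norm_bounded h2 fun k => P.norm_term_sub_le hV hf.norm_le k hx hy hxy (φ := φ)
    rw [h3.tsum_eq] at h4
    have h5 := norm_add_le (dualOp γ 1 f y - dualOp γ 1 f x)
      (dualOp γ φ f y - dualOp γ 1 f y - (dualOp γ φ f x - dualOp γ 1 f x))
    rw [show dualOp γ 1 f y - dualOp γ 1 f x +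
      (dualOp γ φ f y - dualOp γ 1 f y - (dualOp γ φ f x - dualOp γ 1 f x)) =
      dualOp γ φ f y - dualOp γ φ f x by ring] at h5
    linarith
  · have h1 := P.realDual_sub_le hm
    have h2 : ∑' k, twistVar γ xs φ V k 1 ≤ twist γ xs φ * (1 + (V 1 - V xs)) := by
      rw [twist, ← tsum_mul_right]
      exact (P.summable_twistVar hφ hm P.one_mem).tsum_le_tsum
        (fun k => P.twistVar_le hm k P.one_mem) ((P.summable_twist hφ).mul_right _)
    have h3 : 0 ≤ ∑' k, twistVar γ xs φ V k xs :=
      tsum_nonneg fun k => P.twistVar_nonneg hm k P.xs_mem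
    have h4 := P.half_lt_thalerR_one
    have h5 := hm P.xs_mem P.one_mem P.mem.2.le
    have h6 := P.twist_nonneg φ
    have h7 : (1 - thalerR γ 1) * (V 1 - V xs) ≤ 1 / 2 * (V 1 - V xs) :=
      mul_le_mul_of_nonneg_right (by linarith) (by linarith)
    have h8 := mul_le_mul_of_nonneg_left hv (by linarith : 0 ≤ 1 / 2 + twist γ xs φ)
    nlinarith

end ThalerParam

namespace ThalerParam

variable {γ xs : ℝ} {V : ℝ → ℝ} {f u : ℝ → ℂ} {φ : ℕ → ℂ} {v : ℝ}

/-! ### Duality and moments -/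

theorem aestronglyMeasurable (P : ThalerParam γ xs) (h : Controls xs V f) :
    AEStronglyMeasurable f (thalerMuY γ xs) :=
  (h.aemeasurable.mono_ac P.absolutelyContinuous).aestronglyMeasurable

theorem ae_mem_Icc (P : ThalerParam γ xs) : ∀ᵐ y ∂thalerMuY γ xs, y ∈ Icc xs 1 := by
  filter_upwards [P.ae_mem] with y hy using Ioc_subset_Icc_self hy

theorem measurable_multiplier : Measurable fun y => φ (thalerTau γ xs y - 1) :=
  (measurable_from_nat (f := fun n => φ (n - 1))).comp measurable_thalerTau

theorem controls_comp_returnPre (P : ThalerParam γ xs) (h : Controls xs V f) (k : ℕ) :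
    Controls xs (fun x => V (returnPre γ k x)) (fun x => f (returnPre γ k x)) :=
  fun _ hx _ hy hxy => h _ (P.returnPre_mem k hx) _ (P.returnPre_mem k hy) (monotone_returnPre k hxy)

theorem integral_multiplier_mul (P : ThalerParam γ xs) (hφ : ∀ k, ‖φ k‖ ≤ 1) (hf : VarLE xs f v)
    (hu : Measurable u) (hu1 : ∀ x, ‖u x‖ ≤ 1) :
    ∫ y, φ (thalerTau γ xs y - 1) * f y * u (thalerF γ xs y) ∂thalerMuY γ xs =
      ∫ x, dualOp γ φ f x * u x ∂thalerMuY γ xs := by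
  have := P.isProbabilityMeasure
  obtain ⟨V, hV, -⟩ := hf.exists_controls
  have hint : Integrable (fun y => φ (thalerTau γ xs y - 1) * f y * u (thalerF γ xs y))
      (thalerMuY γ xs) := by
    refine Integrable.of_bound ((measurable_multiplier.aestronglyMeasurable.mul
      (P.aestronglyMeasurable hV)).mul (hu.comp measurable_thalerF).aestronglyMeasurable) 1 ?_
    filter_upwards [P.ae_mem_Icc] with y hy
    rw [norm_mul, norm_mul]
    exact mul_le_one₀ (mul_le_one₀ (hφ _) (norm_nonneg _) (hf.norm_le y hy)) (norm_nonneg _) (hu1 _)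
  have h1 := P.hasSum_integral_branch hint
  set G : ℕ → ℝ → ℂ := fun k x => (dualProb γ k x : ℂ) * (φ k * f (returnPre γ k x)) * u x with hG
  have hterm : ∀ k, ∫ y in thalerBranch γ k, φ (thalerTau γ xs y - 1) * f y * u (thalerF γ xs y)
      ∂thalerMuY γ xs = ∫ x, G k x ∂thalerMuY γ xs := by
    intro k
    rw [hG, ← P.integral_branch (fun y => φ k * f y) u k]
    refine setIntegral_congr_fun (measurableSet_branch k) fun y hy => ?_
    simp only [P.tau_branch hy, Nat.add_sub_cancel]
  have hGle : ∀ k, ∀ᵐ x ∂thalerMuY γ xs, ‖G k x‖ ≤ weightBound γ xs k := by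
    intro k
    filter_upwards [P.ae_mem_Icc] with x hx
    rw [hG, norm_mul, norm_mul, norm_mul, Complex.norm_real,
      Real.norm_of_nonneg (P.dualProb_nonneg k (P.Icc_subset hx)), mul_assoc]
    refine (mul_le_of_le_one_right (P.dualProb_nonneg k (P.Icc_subset hx)) ?_).trans
      (P.dualProb_le_weightBound k hx)
    exact mul_le_one₀ (mul_le_one₀ (hφ _) (norm_nonneg _) (hf.norm_le _ (P.returnPre_mem k hx)))
      (norm_nonneg _) (hu1 _)
  have hGint : ∀ k, Integrable (G k) (thalerMuY γ xs) := fun k =>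
    Integrable.of_bound (((Complex.measurable_ofReal.comp
      (measurable_dualProb k)).aestronglyMeasurable.mul ((P.aestronglyMeasurable
      (P.controls_comp_returnPre hV k)).const_mul (φ k))).mul hu.aestronglyMeasurable) _ (hGle k)
  have hsum : Summable fun k => ∫ x, ‖G k x‖ ∂thalerMuY γ xs := by
    refine Summable.of_nonneg_of_le (fun k => integral_nonneg fun x => norm_nonneg _) (fun k => ?_)
      P.summable_weightBound
    have := integral_mono_ae (hGint k).norm (integrable_const (weightBound γ xs k)) (hGle k)
    simpa using this
  have h2 := hasSum_integral_of_summable_integral_norm hGint hsum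
  simp only [hterm] at h1
  rw [h1.unique h2]
  refine integral_congr_ae ?_
  filter_upwards with x
  simp only [hG, tsum_mul_right, dualOp]

/-- The iterates of the twisted transfer operator, applied to the constant function one. -/
def dualIter (γ : ℝ) (φ : ℕ → ℂ) (N : ℕ) : ℝ → ℂ := (dualOp γ φ)^[N] 1

theorem varLE_one (hv : 0 ≤ v) : VarLE xs 1 v :=
  ⟨fun x _ => by simp, 0, fun x _ y _ _ => by simp, by simpa⟩

theorem varLE_mono {w : ℝ} (hf : VarLE xs f v) (h : v ≤ w) : VarLE xs f w :=
  ⟨hf.norm_le, let ⟨V, hV, hv⟩ := hf.exists_controls; ⟨V, hV, hv.trans h⟩⟩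

theorem varLE_iterate (P : ThalerParam γ xs) (hφ : ∀ k, ‖φ k‖ ≤ 1) (h : twist γ xs φ ≤ 1 / 4)
    (N : ℕ) : VarLE xs (dualIter γ φ N) (4 * twist γ xs φ) := by
  have h0 := P.twist_nonneg φ
  induction N with
  | zero => exact varLE_one (by linarith)
  | succ N ih =>
    rw [dualIter, Function.iterate_succ_apply']
    exact varLE_mono (P.varLE_dualOp hφ ih) (by nlinarith)

theorem measurable_iterate_prod (N : ℕ) :
    Measurable fun y => ∏ j ∈ Finset.range N, φ (thalerTau γ xs ((thalerF γ xs)^[j] y) - 1) :=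
  Finset.measurable_prod _ fun j _ => measurable_multiplier.comp (measurable_thalerF.iterate j)

theorem norm_prod_le (hφ : ∀ k, ‖φ k‖ ≤ 1) (N : ℕ) (g : ℕ → ℕ) :
    ‖∏ j ∈ Finset.range N, φ (g j)‖ ≤ 1 := by
  rw [norm_prod]
  exact Finset.prod_le_one (fun _ _ => norm_nonneg _) fun _ _ => hφ _

theorem integral_prod_mul (P : ThalerParam γ xs) (hφ : ∀ k, ‖φ k‖ ≤ 1) (N : ℕ)
    (hf : VarLE xs f v) :
    ∫ y, f y * ∏ j ∈ Finset.range N, φ (thalerTau γ xs ((thalerF γ xs)^[j] y) - 1)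
      ∂thalerMuY γ xs = ∫ y, (dualOp γ φ)^[N] f y ∂thalerMuY γ xs := by
  induction N generalizing f v with
  | zero => simp
  | succ N ih =>
    rw [Function.iterate_succ_apply, ← ih (P.varLE_dualOp hφ hf), ← P.integral_multiplier_mul hφ hf
      (measurable_iterate_prod N) (fun x => norm_prod_le hφ N _)]
    congr 1; ext y
    rw [Finset.prod_range_succ']
    simp only [Function.iterate_succ_apply, Function.iterate_zero, id]
    ring

theorem integral_prod_eq (P : ThalerParam γ xs) (hφ : ∀ k, ‖φ k‖ ≤ 1) (N : ℕ) :
    ∫ y, ∏ j ∈ Finset.range N, φ (thalerTau γ xs ((thalerF γ xs)^[j] y) - 1) ∂thalerMuY γ xs =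
      ∫ y, dualIter γ φ N y ∂thalerMuY γ xs := by
  rw [dualIter, ← P.integral_prod_mul hφ N (varLE_one (xs := xs) le_rfl)]
  simp

theorem integral_dualOp (P : ThalerParam γ xs) (hφ : ∀ k, ‖φ k‖ ≤ 1) (hf : VarLE xs f v) :
    ∫ x, dualOp γ φ f x ∂thalerMuY γ xs =
      ∫ y, φ (thalerTau γ xs y - 1) * f y ∂thalerMuY γ xs := by
  have := P.integral_multiplier_mul hφ hf (u := fun _ => 1) measurable_const (by simp)
  simpa using this.symm

theorem integrable_multiplier (P : ThalerParam γ xs) {C : ℝ} (hφ : ∀ k, ‖φ k‖ ≤ C) :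
    Integrable (fun y => φ (thalerTau γ xs y - 1)) (thalerMuY γ xs) := by
  have := P.isProbabilityMeasure
  exact Integrable.of_bound measurable_multiplier.aestronglyMeasurable C
    (Eventually.of_forall fun y => hφ _)

theorem hasSum_multiplier (P : ThalerParam γ xs) {C : ℝ} (hφ : ∀ k, ‖φ k‖ ≤ C) :
    HasSum (fun k => ((thalerMass γ k / total γ : ℝ) : ℂ) * φ k)
      (∫ y, φ (thalerTau γ xs y - 1) ∂thalerMuY γ xs) := by
  refine (P.hasSum_integral_branch (P.integrable_multiplier hφ)).congr_fun fun k => ?_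
  rw [← P.setIntegral_branch_const]
  refine setIntegral_congr_fun (measurableSet_branch k) fun y hy => ?_
  simp only [P.tau_branch hy, Nat.add_sub_cancel]

theorem mass_div_le_weightBound (P : ThalerParam γ xs) (k : ℕ) :
    thalerMass γ k / total γ ≤ weightBound γ xs k := by
  have := P.isProbabilityMeasure
  rw [← P.integral_dualProb]
  have := integral_mono_ae (P.integrable_dualProb k) (integrable_const (weightBound γ xs k))
    (by filter_upwards [P.ae_mem_Icc] with x hx using P.dualProb_le_weightBound k hx)
  simpa using this

theorem integral_norm_multiplier_sub_one_le (P : ThalerParam γ xs) (hφ : ∀ k, ‖φ k‖ ≤ 1) :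
    ∫ y, ‖φ (thalerTau γ xs y - 1) - 1‖ ∂thalerMuY γ xs ≤ twist γ xs φ := by
  have h := P.hasSum_multiplier (φ := fun k => ((‖φ k - 1‖ : ℝ) : ℂ)) (C := 2) fun k => by
    simpa using norm_sub_one_le hφ k
  rw [integral_complex_ofReal] at h
  have h' : HasSum (fun k => thalerMass γ k / total γ * ‖φ k - 1‖)
      (∫ y, ‖φ (thalerTau γ xs y - 1) - 1‖ ∂thalerMuY γ xs) := by exact_mod_cast h
  refine hasSum_le (fun k => ?_) h' (P.summable_twist hφ).hasSum
  rw [mul_comm]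
  exact mul_le_mul_of_nonneg_left (P.mass_div_le_weightBound k) (norm_nonneg _)

theorem norm_sub_le_of_varLE (P : ThalerParam γ xs) (hf : VarLE xs f v) {x y : ℝ}
    (hx : x ∈ Icc xs 1) (hy : y ∈ Icc xs 1) : ‖f y - f x‖ ≤ v := by
  obtain ⟨V, hV, hv⟩ := hf.exists_controls
  have hm := hV.monotoneOn
  rcases le_total x y with h | h
  · linarith [hV x hx y hy h, hm P.xs_mem hx hx.1, hm hy P.one_mem hy.2]
  · rw [norm_sub_rev]
    linarith [hV y hy x hx h, hm P.xs_mem hy hy.1, hm hx P.one_mem hx.2]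

theorem integrable_of_varLE (P : ThalerParam γ xs) (hf : VarLE xs f v) :
    Integrable f (thalerMuY γ xs) := by
  have := P.isProbabilityMeasure
  obtain ⟨V, hV, -⟩ := hf.exists_controls
  refine Integrable.of_bound (P.aestronglyMeasurable hV) 1 ?_
  filter_upwards [P.ae_mem_Icc] with x hx using hf.norm_le x hx

theorem norm_sub_integral_le (P : ThalerParam γ xs) (hf : VarLE xs f v) {x : ℝ}
    (hx : x ∈ Icc xs 1) : ‖f x - ∫ y, f y ∂thalerMuY γ xs‖ ≤ v := by
  have := P.isProbabilityMeasure
  have h : f x - ∫ y, f y ∂thalerMuY γ xs = ∫ y, (f x - f y) ∂thalerMuY γ xs := by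
    rw [integral_sub (integrable_const _) (P.integrable_of_varLE hf)]; simp
  rw [h]
  have := norm_integral_le_of_norm_le_const (μ := thalerMuY γ xs) (f := fun y => f x - f y) (C := v)
    (by filter_upwards [P.ae_mem_Icc] with y hy using P.norm_sub_le_of_varLE hf hy hx)
  simpa using this

theorem norm_integral_dualOp_sub_le (P : ThalerParam γ xs) (hφ : ∀ k, ‖φ k‖ ≤ 1) (hv : 0 ≤ v)
    (hf : VarLE xs f v) :
    ‖∫ x, dualOp γ φ f x ∂thalerMuY γ xs -
      (∫ y, φ (thalerTau γ xs y - 1) ∂thalerMuY γ xs) * ∫ y, f y ∂thalerMuY γ xs‖ ≤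
      twist γ xs φ * v := by
  have := P.isProbabilityMeasure
  have hfi := P.integrable_of_varLE hf
  have hpi := P.integrable_multiplier hφ
  obtain ⟨V, hV, -⟩ := hf.exists_controls
  set m := ∫ y, f y ∂thalerMuY γ xs with hm
  have hpf : Integrable (fun y => φ (thalerTau γ xs y - 1) * f y) (thalerMuY γ xs) :=
    hfi.bdd_mul measurable_multiplier.aestronglyMeasurable (Eventually.of_forall fun y => hφ _)
  have h : ∫ x, dualOp γ φ f x ∂thalerMuY γ xs -
      (∫ y, φ (thalerTau γ xs y - 1) ∂thalerMuY γ xs) * m =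
      ∫ y, (φ (thalerTau γ xs y - 1) - 1) * (f y - m) ∂thalerMuY γ xs := by
    have e : ∀ y, (φ (thalerTau γ xs y - 1) - 1) * (f y - m) =
        (φ (thalerTau γ xs y - 1) * f y - φ (thalerTau γ xs y - 1) * m) - (f y - m) := fun y => by
      ring
    simp only [e]
    have h1 : Integrable (fun y => φ (thalerTau γ xs y - 1) * f y - φ (thalerTau γ xs y - 1) * m)
        (thalerMuY γ xs) := hpf.sub (hpi.mul_const m)
    have h2 : Integrable (fun y => f y - m) (thalerMuY γ xs) := hfi.sub (integrable_const m)
    rw [integral_sub h1 h2,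
      integral_sub hpf (hpi.mul_const m), integral_sub hfi (integrable_const m), integral_mul_const,
      P.integral_dualOp hφ hf]
    simp [← hm]
  rw [h]
  have hb : Integrable (fun y => ‖φ (thalerTau γ xs y - 1) - 1‖) (thalerMuY γ xs) :=
    (hpi.sub (integrable_const 1)).norm
  refine (norm_integral_le_of_norm_le (hb.mul_const v) ?_).trans ?_
  · filter_upwards [P.ae_mem_Icc] with y hy
    rw [norm_mul]
    exact mul_le_mul_of_nonneg_left (P.norm_sub_integral_le hf hy) (norm_nonneg _)
  · rw [integral_mul_const]
    exact mul_le_mul_of_nonneg_right (P.integral_norm_multiplier_sub_one_le hφ) hv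

/-- The expectation of a product of multipliers along the orbit is approximately a power. -/
theorem norm_integral_prod_sub_pow_le (P : ThalerParam γ xs) (hφ : ∀ k, ‖φ k‖ ≤ 1)
    (h : twist γ xs φ ≤ 1 / 4) {b : ℂ} (hb : ‖b‖ ≤ 1) (N : ℕ) :
    ‖∫ y, ∏ j ∈ Finset.range N, φ (thalerTau γ xs ((thalerF γ xs)^[j] y) - 1) ∂thalerMuY γ xs -
      b ^ N‖ ≤ N * (4 * twist γ xs φ ^ 2 +
        ‖∫ y, φ (thalerTau γ xs y - 1) ∂thalerMuY γ xs - b‖) := by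
  have := P.isProbabilityMeasure
  have h0 := P.twist_nonneg φ
  simp only [P.integral_prod_eq hφ]
  set E := ∫ y, φ (thalerTau γ xs y - 1) ∂thalerMuY γ xs
  induction N with
  | zero => simp [dualIter]
  | succ N ih =>
    have hv := P.varLE_iterate hφ h N
    have h1 := P.norm_integral_dualOp_sub_le hφ (by linarith) hv
    have hm : ‖∫ y, dualIter γ φ N y ∂thalerMuY γ xs‖ ≤ 1 := by
      have := norm_integral_le_of_norm_le_const (μ := thalerMuY γ xs) (f := dualIter γ φ N) (C := 1)
        (by filter_upwards [P.ae_mem_Icc] with y hy using hv.norm_le y hy)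
      simpa using this
    have hs : dualIter γ φ (N + 1) = dualOp γ φ (dualIter γ φ N) :=
      Function.iterate_succ_apply' _ _ _
    rw [hs]
    set m := ∫ y, dualIter γ φ N y ∂thalerMuY γ xs
    set m' := ∫ y, dualOp γ φ (dualIter γ φ N) y ∂thalerMuY γ xs
    rw [show m' - b ^ (N + 1) = (m' - E * m) + ((E - b) * m + b * (m - b ^ N)) by ring]
    refine (norm_add_le _ _).trans ((add_le_add_right (norm_add_le _ _) _).trans ?_)
    rw [norm_mul, norm_mul]
    have h2 := mul_le_of_le_one_right (norm_nonneg (E - b)) hm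
    have h3 := mul_le_of_le_one_left (norm_nonneg (m - b ^ N)) hb
    push_cast
    linarith

end ThalerParam

/-! ### Lévy integrals -/

/-- `κ` selects the compensation: `κ = 0` for `α ∈ (0,1)` and `κ = 1` for `α ∈ (1,2)`. -/
def StableIdx (α κ : ℝ) : Prop := (κ = 0 ∧ α ∈ Ioo (0 : ℝ) 1) ∨ (κ = 1 ∧ α ∈ Ioo (1 : ℝ) 2)

/-- The compensated exponential. -/
def compExp (κ : ℝ) (w : ℂ) : ℂ := 1 - κ * w - Complex.exp (-w)

/-- An integrable antitone majorant on `(0, ∞)`. -/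
def levyBound (a v : ℝ) : ℝ := min (v ^ (-a)) (v ^ (-a - 1))

theorem levyBound_nonneg {a v : ℝ} (hv : 0 < v) : 0 ≤ levyBound a v := by
  unfold levyBound; positivity

theorem levyBound_anti {a v w : ℝ} (ha : 0 < a) (hv : 0 < v) (hvw : v ≤ w) :
    levyBound a w ≤ levyBound a v :=
  min_le_min (Real.rpow_le_rpow_of_nonpos hv hvw (by linarith))
    (Real.rpow_le_rpow_of_nonpos hv hvw (by linarith))

theorem integrableOn_levyBound {a : ℝ} (ha : a ∈ Ioo (0 : ℝ) 1) :
    IntegrableOn (levyBound a) (Ioi 0) := by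
  have hmeas : Measurable (levyBound a) := by unfold levyBound; fun_prop
  rw [← Ioc_union_Ioi_eq_Ioi zero_le_one]
  refine IntegrableOn.union ?_ ?_
  · have h := (intervalIntegral.intervalIntegrable_rpow' (a := 0) (b := 1)
      (by linarith [ha.2] : -1 < -a)).1
    refine Integrable.mono' h hmeas.aestronglyMeasurable ?_
    filter_upwards [ae_restrict_mem measurableSet_Ioc] with v hv
    rw [Real.norm_of_nonneg (levyBound_nonneg hv.1)]
    exact min_le_left _ _
  · have h := integrableOn_Ioi_rpow_of_lt (by linarith [ha.1] : -a - 1 < -1) one_pos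
    refine Integrable.mono' h hmeas.aestronglyMeasurable ?_
    filter_upwards [ae_restrict_mem measurableSet_Ioi] with v hv
    rw [Real.norm_of_nonneg (levyBound_nonneg (one_pos.trans hv))]
    exact min_le_right _ _

theorem norm_one_sub_exp_neg_le {w : ℂ} (hw : 0 ≤ w.re) :
    ‖1 - Complex.exp (-w)‖ ≤ 2 ∧ ‖1 - Complex.exp (-w)‖ ≤ 2 * ‖w‖ := by
  have h2 : ‖1 - Complex.exp (-w)‖ ≤ 2 := by
    refine (norm_sub_le _ _).trans ?_
    rw [norm_one, Complex.norm_exp, Complex.neg_re]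
    linarith [Real.exp_le_one_iff.2 (neg_nonpos.2 hw)]
  refine ⟨h2, ?_⟩
  rcases le_total ‖w‖ 1 with h | h
  · rw [norm_sub_rev]
    simpa using Complex.norm_exp_sub_one_le (x := -w) (by simpa using h)
  · linarith

theorem norm_one_sub_sub_exp_neg_le {w : ℂ} (hw : 0 ≤ w.re) :
    ‖1 - w - Complex.exp (-w)‖ ≤ 3 * ‖w‖ ∧ ‖1 - w - Complex.exp (-w)‖ ≤ 3 * ‖w‖ ^ 2 := by
  have h2 : ‖1 - w - Complex.exp (-w)‖ ≤ 3 * ‖w‖ := by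
    rw [sub_right_comm]
    refine (norm_sub_le _ _).trans ?_
    linarith [(norm_one_sub_exp_neg_le hw).2]
  refine ⟨h2, ?_⟩
  rcases le_total ‖w‖ 1 with h | h
  · have := Complex.norm_exp_sub_one_sub_id_le (x := -w) (by simpa using h)
    rw [norm_neg] at this
    rw [← norm_neg, show -(1 - w - Complex.exp (-w)) = Complex.exp (-w) - 1 - -w by ring]
    nlinarith [sq_nonneg ‖w‖]
  · nlinarith

namespace StableIdx

variable {α κ : ℝ}

theorem pos (h : StableIdx α κ) : 0 < α := by
  rcases h with ⟨-, h⟩ | ⟨-, h⟩ <;> linarith [h.1]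

theorem lt_two (h : StableIdx α κ) : α < 2 := by
  rcases h with ⟨-, h⟩ | ⟨-, h⟩ <;> linarith [h.2]

theorem ne_one (h : StableIdx α κ) : α ≠ 1 := by
  rcases h with ⟨-, h⟩ | ⟨-, h⟩
  exacts [h.2.ne, h.1.ne']

theorem sub_mem (h : StableIdx α κ) : α - κ ∈ Ioo (0 : ℝ) 1 := by
  rcases h with ⟨rfl, h⟩ | ⟨rfl, h⟩ <;> constructor <;> linarith [h.1, h.2]

theorem norm_compExp_le (h : StableIdx α κ) {r : ℂ} (hr : 0 ≤ r.re) {v : ℝ} (hv : 0 < v) :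
    ‖((v ^ (-1 - α) : ℝ) : ℂ) * compExp κ (r * v)‖ ≤
      3 * (1 + ‖r‖) ^ 2 * levyBound (α - κ) v := by
  have hre : 0 ≤ (r * v).re := by simpa using mul_nonneg hr hv.le
  have hn : ‖r * v‖ = ‖r‖ * v := by simp [abs_of_pos hv]
  have hr0 := norm_nonneg r
  have hp : 0 < v ^ (-1 - α) := Real.rpow_pos_of_pos hv _
  rw [norm_mul, Complex.norm_real, Real.norm_of_nonneg hp.le, levyBound,
    mul_min_of_nonneg _ _ (by positivity), le_min_iff]
  rcases h with ⟨rfl, -⟩ | ⟨rfl, -⟩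
  · have h1 := norm_one_sub_exp_neg_le hre
    rw [hn] at h1
    rw [compExp, Complex.ofReal_zero, zero_mul, sub_zero, sub_zero,
      show -α - 1 = -1 - α by ring, show v ^ (-α) = v ^ (-1 - α) * v by
        rw [← Real.rpow_add_one hv.ne']; ring_nf]
    constructor
    · have := mul_le_mul_of_nonneg_left h1.2 hp.le
      have : 2 * ‖r‖ * (v ^ (-1 - α) * v) ≤ 3 * (1 + ‖r‖) ^ 2 * (v ^ (-1 - α) * v) :=
        mul_le_mul_of_nonneg_right (by nlinarith) (by positivity)
      linarith
    · have := mul_le_mul_of_nonneg_left h1.1 hp.le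
      have : 2 * (v ^ (-1 - α)) ≤ 3 * (1 + ‖r‖) ^ 2 * (v ^ (-1 - α)) :=
        mul_le_mul_of_nonneg_right (by nlinarith) (by positivity)
      linarith
  · have h1 := norm_one_sub_sub_exp_neg_le hre
    rw [hn] at h1
    rw [compExp, Complex.ofReal_one, one_mul,
      show v ^ (-(α - 1)) = v ^ (-1 - α) * v ^ 2 by
        rw [← Real.rpow_natCast, ← Real.rpow_add hv]; norm_num; ring_nf,
      show v ^ (-(α - 1) - 1) = v ^ (-1 - α) * v by
        rw [← Real.rpow_add_one hv.ne']; ring_nf]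
    constructor
    · have := mul_le_mul_of_nonneg_left h1.2 hp.le
      have : 3 * ‖r‖ ^ 2 * (v ^ (-1 - α) * v ^ 2) ≤ 3 * (1 + ‖r‖) ^ 2 * (v ^ (-1 - α) * v ^ 2) :=
        mul_le_mul_of_nonneg_right (by nlinarith) (by positivity)
      linarith
    · have := mul_le_mul_of_nonneg_left h1.1 hp.le
      have : 3 * ‖r‖ * (v ^ (-1 - α) * v) ≤ 3 * (1 + ‖r‖) ^ 2 * (v ^ (-1 - α) * v) :=
        mul_le_mul_of_nonneg_right (by nlinarith) (by positivity)
      linarith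

theorem measurable_compExp {r : ℂ} :
    Measurable fun v : ℝ => ((v ^ (-1 - α) : ℝ) : ℂ) * compExp κ (r * v) := by
  unfold compExp; fun_prop

theorem integrableOn_compExp (h : StableIdx α κ) {r : ℂ} (hr : 0 ≤ r.re) :
    IntegrableOn (fun v : ℝ => ((v ^ (-1 - α) : ℝ) : ℂ) * compExp κ (r * v)) (Ioi 0) := by
  refine Integrable.mono' ((integrableOn_levyBound h.sub_mem).const_mul (3 * (1 + ‖r‖) ^ 2))
    measurable_compExp.aestronglyMeasurable ?_
  filter_upwards [ae_restrict_mem measurableSet_Ioi] with v hv using h.norm_compExp_le hr hv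

theorem hasDerivAt_aux (r : ℂ) {v : ℝ} (hv : 0 < v) :
    HasDerivAt (fun v : ℝ => ((v ^ (-α) : ℝ) : ℂ) * compExp κ (r * v))
      (-α * (((v ^ (-1 - α) : ℝ) : ℂ) * compExp κ (r * v)) +
        r * (((v ^ (-α) : ℝ) : ℂ) * (Complex.exp (-(r * v)) - κ))) v := by
  have h1 := (Real.hasDerivAt_rpow_const (p := -α) (Or.inl hv.ne')).ofReal_comp
  have h2 : HasDerivAt (fun v : ℝ => r * (v : ℂ)) r v := by
    simpa using ((hasDerivAt_id v).ofReal_comp).const_mul r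
  have h3 : HasDerivAt (fun v : ℝ => compExp κ (r * v)) (r * (Complex.exp (-(r * v)) - κ)) v := by
    have := ((h2.const_mul (κ : ℂ)).const_sub 1).sub h2.neg.cexp
    refine this.congr_deriv ?_
    simp only [Pi.neg_apply]
    ring
  refine (h1.mul h3).congr_deriv ?_
  rw [show -α - 1 = -1 - α by ring]
  push_cast
  ring

theorem tendsto_aux (h : StableIdx α κ) {r : ℂ} (hr : 0 ≤ r.re) :
    Tendsto (fun v : ℝ => ((v ^ (-α) : ℝ) : ℂ) * compExp κ (r * v)) (𝓝[>] 0) (𝓝 0) ∧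
    Tendsto (fun v : ℝ => ((v ^ (-α) : ℝ) : ℂ) * compExp κ (r * v)) atTop (𝓝 0) := by
  have ha := h.sub_mem
  have hb : ∀ v : ℝ, 0 < v → ‖((v ^ (-α) : ℝ) : ℂ) * compExp κ (r * v)‖ ≤
      3 * (1 + ‖r‖) ^ 2 * min (v ^ (1 - (α - κ))) (v ^ (-(α - κ))) := by
    intro v hv
    have h1 := mul_le_mul_of_nonneg_right (h.norm_compExp_le hr hv) hv.le
    rw [levyBound, mul_assoc, min_mul_of_nonneg _ _ hv.le, ← Real.rpow_add_one hv.ne',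
      ← Real.rpow_add_one hv.ne', norm_mul, mul_right_comm, Complex.norm_real,
      Real.norm_of_nonneg (Real.rpow_pos_of_pos hv _).le, ← Real.rpow_add_one hv.ne'] at h1
    rw [norm_mul, Complex.norm_real, Real.norm_of_nonneg (Real.rpow_pos_of_pos hv _).le]
    rwa [show -1 - α + 1 = -α by ring, show -(α - κ) + 1 = 1 - (α - κ) by ring,
      show -(α - κ) - 1 + 1 = -(α - κ) by ring] at h1
  constructor
  · have h0 : Tendsto (fun v : ℝ => v ^ (1 - (α - κ))) (𝓝[>] 0) (𝓝 0) := by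
      have := (Real.continuousAt_rpow_const 0 (1 - (α - κ)) (Or.inr (by linarith [ha.2]))).tendsto
      rw [Real.zero_rpow (by linarith [ha.2])] at this
      exact this.mono_left nhdsWithin_le_nhds
    have h1 := h0.const_mul (3 * (1 + ‖r‖) ^ 2)
    rw [mul_zero] at h1
    refine squeeze_zero_norm' ?_ h1
    filter_upwards [self_mem_nhdsWithin] with v hv
    exact (hb v hv).trans (mul_le_mul_of_nonneg_left (min_le_left _ _) (by positivity))
  · have h1 := (tendsto_rpow_neg_atTop ha.1).const_mul (3 * (1 + ‖r‖) ^ 2)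
    rw [mul_zero] at h1
    refine squeeze_zero_norm' ?_ h1
    filter_upwards [eventually_gt_atTop 0] with v hv
    exact (hb v hv).trans (mul_le_mul_of_nonneg_left (min_le_right _ _) (by positivity))

theorem integral_parts (h : StableIdx α κ) {r : ℂ} (hr : 0 ≤ r.re)
    (hint : IntegrableOn (fun v : ℝ => ((v ^ (-α) : ℝ) : ℂ) * (Complex.exp (-(r * v)) - κ))
      (Ioi 0)) :
    α * ∫ v in Ioi (0 : ℝ), ((v ^ (-1 - α) : ℝ) : ℂ) * compExp κ (r * v) =
      r * ∫ v in Ioi (0 : ℝ), ((v ^ (-α) : ℝ) : ℂ) * (Complex.exp (-(r * v)) - κ) := by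
  have h1 := (h.integrableOn_compExp hr).const_mul (-(α : ℂ))
  have h2 := hint.const_mul r
  have key := integral_Ioi_of_hasDerivAt_of_tendsto (a := 0)
    (f := fun v : ℝ => ((v ^ (-α) : ℝ) : ℂ) * compExp κ (r * v)) ?_
    (fun v hv => hasDerivAt_aux r hv) (h1.add h2) (h.tendsto_aux hr).2
  · rw [integral_add h1 h2, integral_const_mul, integral_const_mul] at key
    simp only [Complex.ofReal_zero, mul_zero, compExp, neg_zero, Complex.exp_zero, sub_zero,
      sub_self] at key
    simp only [compExp]
    linear_combination -key
  · rw [← continuousWithinAt_Ioi_iff_Ici, ContinuousWithinAt]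
    simpa [compExp] using (h.tendsto_aux hr).1

theorem integrableOn_rpow_mul_cexp {b : ℝ} (hb : -1 < b) {r : ℂ} (hr : 0 < r.re) :
    IntegrableOn (fun v : ℝ => ((v ^ b : ℝ) : ℂ) * Complex.exp (-(r * v))) (Ioi 0) := by
  have h := integrableOn_rpow_mul_exp_neg_mul_rpow hb one_pos hr
  have hm : Measurable fun v : ℝ => ((v ^ b : ℝ) : ℂ) * Complex.exp (-(r * v)) := by fun_prop
  refine Integrable.mono' h hm.aestronglyMeasurable ?_
  filter_upwards [ae_restrict_mem measurableSet_Ioi] with v hv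
  rw [norm_mul, Complex.norm_real, Real.norm_of_nonneg (Real.rpow_nonneg (le_of_lt hv) _),
    Complex.norm_exp]
  simp

theorem differentiableOn_integral_rpow_mul_cexp {b : ℝ} (hb : -1 < b) :
    DifferentiableOn ℂ (fun r : ℂ => ∫ v in Ioi (0 : ℝ), ((v ^ b : ℝ) : ℂ) * Complex.exp (-(r * v)))
      {r | 0 < r.re} := by
  intro r (hr : 0 < r.re)
  have hs : {z : ℂ | r.re / 2 < z.re} ∈ 𝓝 r :=
    (isOpen_lt continuous_const Complex.continuous_re).mem_nhds (by simpa using hr)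
  have hF : ∀ z : ℂ, Measurable fun v : ℝ => ((v ^ b : ℝ) : ℂ) * Complex.exp (-(z * v)) :=
    fun z => by fun_prop
  have hF' : ∀ z : ℂ, Measurable fun v : ℝ =>
      ((v ^ b : ℝ) : ℂ) * (Complex.exp (-(z * v)) * -(v : ℂ)) := fun z => by fun_prop
  have h := integrableOn_rpow_mul_exp_neg_mul_rpow (by linarith : -1 < b + 1) one_pos (half_pos hr)
  refine (hasDerivAt_integral_of_dominated_loc_of_deriv_le
    (F := fun (z : ℂ) (v : ℝ) => ((v ^ b : ℝ) : ℂ) * Complex.exp (-(z * v)))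
    (F' := fun (z : ℂ) (v : ℝ) => ((v ^ b : ℝ) : ℂ) * (Complex.exp (-(z * v)) * -(v : ℂ))) hs
    (Eventually.of_forall fun z => (hF z).aestronglyMeasurable) (integrableOn_rpow_mul_cexp hb hr)
    (hF' r).aestronglyMeasurable (bound := fun v => v ^ (b + 1) * Real.exp (-(r.re / 2) * v ^ (1 : ℝ)))
    ?_ h ?_).2.differentiableAt.differentiableWithinAt
  · filter_upwards [ae_restrict_mem measurableSet_Ioi] with v hv z hz
    have hv' : 0 < v := hv
    rw [norm_mul, norm_mul, norm_neg, Complex.norm_real, Complex.norm_real, Complex.norm_exp,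
      Real.norm_of_nonneg hv'.le, Real.norm_of_nonneg (Real.rpow_nonneg hv'.le _),
      Real.rpow_add_one hv'.ne', Real.rpow_one, mul_comm (Real.exp _) v, ← mul_assoc]
    refine mul_le_mul_of_nonneg_left (Real.exp_le_exp.2 ?_) (by positivity)
    have : r.re / 2 * v ≤ z.re * v := mul_le_mul_of_nonneg_right (le_of_lt hz) hv'.le
    simp only [Complex.neg_re, Complex.mul_re, Complex.ofReal_re, Complex.ofReal_im]
    linarith
  · refine Eventually.of_forall fun v z _ => ?_
    have h1 : HasDerivAt (fun z : ℂ => -(z * (v : ℂ))) (-(v : ℂ)) z := by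
      have h := ((hasDerivAt_id z).mul_const (v : ℂ)).neg
      rw [one_mul] at h
      exact h
    exact (h1.cexp).const_mul _

theorem integral_rpow_mul_cexp {α : ℝ} (hα : α < 1) {r : ℂ} (hr : 0 < r.re) :
    r * ∫ v in Ioi (0 : ℝ), ((v ^ (-α) : ℝ) : ℂ) * Complex.exp (-(r * v)) =
      Real.Gamma (1 - α) * r ^ (α : ℂ) := by
  have hopen : IsOpen {r : ℂ | 0 < r.re} := isOpen_lt continuous_const Complex.continuous_re
  have hreal : ∀ x : ℝ, 0 < x →
      (x : ℂ) * ∫ v in Ioi (0 : ℝ), ((v ^ (-α) : ℝ) : ℂ) * Complex.exp (-((x : ℂ) * v)) =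
      Real.Gamma (1 - α) * (x : ℂ) ^ (α : ℂ) := by
    intro x hx
    have h := Real.integral_rpow_mul_exp_neg_mul_Ioi (a := 1 - α) (by linarith) hx
    rw [show ∫ v in Ioi (0 : ℝ), ((v ^ (-α) : ℝ) : ℂ) * Complex.exp (-((x : ℂ) * v)) =
      ((∫ v in Ioi (0 : ℝ), v ^ (1 - α - 1) * Real.exp (-(x * v)) : ℝ) : ℂ) by
        rw [← integral_complex_ofReal]
        congr 1; ext v
        push_cast
        ring_nf, h, ← Complex.ofReal_cpow hx.le, one_div, Real.inv_rpow hx.le,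
      Real.rpow_sub hx, Real.rpow_one]
    have := hx.ne'
    have := (Real.rpow_pos_of_pos hx α).ne'
    norm_cast
    field_simp
  refine AnalyticOnNhd.eqOn_of_preconnected_of_frequently_eq (𝕜 := ℂ) (z₀ := 1)
    (f := fun r : ℂ => r * ∫ v in Ioi (0 : ℝ), ((v ^ (-α) : ℝ) : ℂ) * Complex.exp (-(r * v)))
    (g := fun r : ℂ => Real.Gamma (1 - α) * r ^ (α : ℂ))
    (DifferentiableOn.analyticOnNhd (differentiableOn_id.mul
      (differentiableOn_integral_rpow_mul_cexp (by linarith))) hopen)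
    (DifferentiableOn.analyticOnNhd (fun z hz => ?_) hopen)
    (convex_halfSpace_re_gt 0).isPreconnected (by simp) ?_ hr
  · exact ((differentiableAt_id.cpow_const (Or.inl hz)).const_mul _).differentiableWithinAt
  · have ht : Tendsto (fun x : ℝ => (x : ℂ)) (𝓝[≠] 1) (𝓝[≠] 1) := by
      refine tendsto_nhdsWithin_iff.2 ⟨?_, ?_⟩
      · have := (Complex.continuous_ofReal.tendsto 1).mono_left
          (nhdsWithin_le_nhds (s := {(1 : ℝ)}ᶜ))
        simpa using this
      · filter_upwards [self_mem_nhdsWithin] with x hx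
        simpa using hx
    refine ht.frequently (Eventually.frequently ?_)
    filter_upwards [nhdsWithin_le_nhds (lt_mem_nhds one_pos)] with x hx using hreal x hx

theorem integral_compExp_of_pos (h : StableIdx α κ) {r : ℂ} (hr : 0 < r.re) :
    ∫ v in Ioi (0 : ℝ), ((v ^ (-1 - α) : ℝ) : ℂ) * compExp κ (r * v) =
      Real.Gamma (1 - α) / α * r ^ (α : ℂ) := by
  have hr0 : r ≠ 0 := fun h => by simp [h] at hr
  have zero_case : ∀ {a : ℝ}, a ∈ Ioo (0 : ℝ) 1 →
      ∫ v in Ioi (0 : ℝ), ((v ^ (-1 - a) : ℝ) : ℂ) * compExp 0 (r * v) =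
      Real.Gamma (1 - a) / a * r ^ (a : ℂ) := by
    intro a ha
    have hidx : StableIdx a 0 := Or.inl ⟨rfl, ha⟩
    have h1 := hidx.integral_parts hr.le (by
      simpa using integrableOn_rpow_mul_cexp (by linarith [ha.2] : -1 < -a) hr)
    simp only [Complex.ofReal_zero, sub_zero] at h1
    rw [integral_rpow_mul_cexp ha.2 hr] at h1
    have ha0 : (a : ℂ) ≠ 0 := by exact_mod_cast ha.1.ne'
    field_simp
    rw [mul_comm]
    exact h1
  rcases h with ⟨rfl, ha⟩ | ⟨rfl, ha⟩
  · exact zero_case ha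
  · have hidx : StableIdx α 1 := Or.inr ⟨rfl, ha⟩
    have hidx' : StableIdx (α - 1) 0 := Or.inl ⟨rfl, by linarith [ha.1], by linarith [ha.2]⟩
    have e : ∀ v : ℝ, ((v ^ (-α) : ℝ) : ℂ) * (Complex.exp (-(r * v)) - (1 : ℝ)) =
        -(((v ^ (-1 - (α - 1)) : ℝ) : ℂ) * compExp 0 (r * v)) := fun v => by
      rw [compExp, show -1 - (α - 1) = -α by ring]; push_cast; ring
    have h1 := hidx.integral_parts hr.le (by
      simp only [e]; exact (hidx'.integrableOn_compExp hr.le).neg)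
    simp only [e] at h1
    rw [integral_neg, zero_case ⟨by linarith [ha.1], by linarith [ha.2]⟩,
      show 1 - (α - 1) = 1 - α + 1 by ring, Real.Gamma_add_one (by linarith [ha.1]),
      show ((α - 1 : ℝ) : ℂ) = (α : ℂ) - 1 by push_cast; rfl, Complex.cpow_sub _ _ hr0,
      Complex.cpow_one] at h1
    have ha0 : (α : ℂ) ≠ 0 := by exact_mod_cast (by linarith [ha.1] : α ≠ 0)
    have ha1 : (α : ℂ) - 1 ≠ 0 := by
      rw [sub_ne_zero]; exact_mod_cast ha.1.ne'
    refine mul_left_cancel₀ ha0 (h1.trans ?_)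
    push_cast
    field_simp
    ring

theorem integral_compExp (h : StableIdx α κ) {r : ℂ} (hr : 0 ≤ r.re) :
    ∫ v in Ioi (0 : ℝ), ((v ^ (-1 - α) : ℝ) : ℂ) * compExp κ (r * v) =
      Real.Gamma (1 - α) / α * r ^ (α : ℂ) := by
  rcases eq_or_ne r 0 with rfl | hr0
  · have : (α : ℂ) ≠ 0 := by exact_mod_cast h.pos.ne'
    simp [compExp, Complex.zero_cpow this]
  have hslit : r ∈ Complex.slitPlane := by
    rcases hr.lt_or_eq with h1 | h1
    · exact Or.inl h1
    · exact Or.inr fun h2 => hr0 (Complex.ext h1.symm h2)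
  set R : ℕ → ℂ := fun n => r + ((1 / ((n : ℝ) + 1) : ℝ) : ℂ) with hR
  have hRpos : ∀ n, 0 < (R n).re := fun n => by
    have : (0 : ℝ) < 1 / ((n : ℝ) + 1) := by positivity
    rw [hR, Complex.add_re, Complex.ofReal_re]; linarith
  have hRlim : Tendsto R atTop (𝓝 r) := by
    have := (Complex.continuous_ofReal.tendsto 0).comp tendsto_one_div_add_atTop_nhds_zero_nat
    simpa [hR] using this.const_add r
  have hRn : ∀ n, ‖R n‖ ≤ ‖r‖ + 1 := fun n => by
    refine (norm_add_le _ _).trans (add_le_add_right ?_ _)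
    rw [Complex.norm_real, Real.norm_of_nonneg (by positivity)]
    exact div_le_one_of_le₀ (by linarith [n.cast_nonneg (α := ℝ)]) (by positivity)
  have h1 : Tendsto (fun n => ∫ v in Ioi (0 : ℝ), ((v ^ (-1 - α) : ℝ) : ℂ) * compExp κ (R n * v))
      atTop (𝓝 (∫ v in Ioi (0 : ℝ), ((v ^ (-1 - α) : ℝ) : ℂ) * compExp κ (r * v))) := by
    refine tendsto_integral_of_dominated_convergence
      (fun v => 3 * (1 + (‖r‖ + 1)) ^ 2 * levyBound (α - κ) v)
      (fun n => measurable_compExp.aestronglyMeasurable)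
      ((integrableOn_levyBound h.sub_mem).const_mul _) (fun n => ?_) ?_
    · filter_upwards [ae_restrict_mem measurableSet_Ioi] with v hv
      refine (h.norm_compExp_le (hRpos n).le hv).trans ?_
      have := levyBound_nonneg (a := α - κ) hv
      have := hRn n
      gcongr
    · refine Eventually.of_forall fun v => ?_
      have hc : Continuous fun z : ℂ => ((v ^ (-1 - α) : ℝ) : ℂ) * compExp κ (z * v) := by
        unfold compExp; fun_prop
      exact (hc.tendsto r).comp hRlim
  simp only [h.integral_compExp_of_pos (hRpos _)] at h1
  have h2 := (((continuousAt_cpow_const (b := (α : ℂ)) hslit).tendsto.comp hRlim).const_mul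
    ((Real.Gamma (1 - α) : ℂ) / α))
  exact tendsto_nhds_unique h1 h2

end StableIdx

/-! ### Riemann sums with weights -/

/-- Step function whose integral over `(0, ∞)` is the weighted Riemann sum of mesh `ε`. -/
def stepFun (c : ℕ → ℝ) (h : ℝ → ℂ) (ε v : ℝ) : ℂ :=
  (c (⌈v / ε⌉₊ - 1) : ℂ) * h (⌈v / ε⌉₊ * ε)

theorem measurable_stepFun {c : ℕ → ℝ} {h : ℝ → ℂ} {ε : ℝ} : Measurable (stepFun c h ε) :=
  (measurable_from_nat (f := fun m : ℕ => (c (m - 1) : ℂ) * h (m * ε))).comp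
    (Nat.measurable_ceil.comp (measurable_id.div_const ε))

theorem stepFun_of_mem {c : ℕ → ℝ} {h : ℝ → ℂ} {ε v : ℝ} (hε : 0 < ε) {k : ℕ}
    (hv : v ∈ Ioc ((k : ℝ) * ε) (((k + 1 : ℕ) : ℝ) * ε)) :
    stepFun c h ε v = c k * h ((k + 1) * ε) := by
  have : ⌈v / ε⌉₊ = k + 1 := by
    rw [Nat.ceil_eq_iff (by simp), lt_div_iff₀ hε, div_le_iff₀ hε]
    simpa using hv
  rw [stepFun, this]
  simp

theorem iUnion_Ioc_mul {ε : ℝ} (hε : 0 < ε) :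
    ⋃ k : ℕ, Ioc ((k : ℝ) * ε) (((k + 1 : ℕ) : ℝ) * ε) = Ioi 0 := by
  ext v
  simp only [mem_iUnion, mem_Ioi]
  constructor
  · rintro ⟨k, hk⟩
    exact lt_of_le_of_lt (by positivity) hk.1
  · intro hv
    have h1 : 0 < ⌈v / ε⌉₊ := Nat.ceil_pos.2 (div_pos hv hε)
    obtain ⟨k, hk⟩ := Nat.exists_eq_succ_of_ne_zero h1.ne'
    refine ⟨k, ?_⟩
    rw [Nat.succ_eq_add_one, Nat.ceil_eq_iff (by simp), lt_div_iff₀ hε, div_le_iff₀ hε] at hk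
    simpa using hk

theorem norm_stepFun_le {c : ℕ → ℝ} {h : ℝ → ℂ} {a C K ε v : ℝ} (ha : 0 < a)
    (hC : ∀ k, |c k| ≤ C) (hK : ∀ v, 0 < v → ‖h v‖ ≤ K * levyBound a v) (hK0 : 0 ≤ K)
    (hε : 0 < ε) (hv : 0 < v) : ‖stepFun c h ε v‖ ≤ C * (K * levyBound a v) := by
  have h1 : v ≤ ⌈v / ε⌉₊ * ε := (div_le_iff₀ hε).1 (Nat.le_ceil _)
  rw [stepFun, norm_mul, Complex.norm_real]
  exact mul_le_mul (hC _) ((hK _ (hv.trans_le h1)).trans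
    (mul_le_mul_of_nonneg_left (levyBound_anti ha hv h1) hK0)) (norm_nonneg _)
    ((abs_nonneg _).trans (hC 0))

theorem hasSum_stepFun {c : ℕ → ℝ} {h : ℝ → ℂ} {a C K ε : ℝ} (ha : a ∈ Ioo (0 : ℝ) 1)
    (hC : ∀ k, |c k| ≤ C) (hK : ∀ v, 0 < v → ‖h v‖ ≤ K * levyBound a v) (hK0 : 0 ≤ K)
    (hε : 0 < ε) :
    HasSum (fun k : ℕ => (ε : ℂ) * (c k * h ((k + 1) * ε))) (∫ v in Ioi 0, stepFun c h ε v) := by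
  have hint : IntegrableOn (stepFun c h ε) (Ioi 0) := by
    refine Integrable.mono' (((integrableOn_levyBound ha).const_mul K).const_mul C)
      measurable_stepFun.aestronglyMeasurable ?_
    filter_upwards [ae_restrict_mem measurableSet_Ioi] with v hv
    exact norm_stepFun_le ha.1 hC hK hK0 hε hv
  have hm : Monotone fun k : ℕ => (k : ℝ) * ε := fun i j hij =>
    mul_le_mul_of_nonneg_right (by exact_mod_cast hij) hε.le
  rw [← iUnion_Ioc_mul hε] at hint ⊢
  have := hasSum_integral_iUnion (fun k => measurableSet_Ioc)
    (by simpa using hm.pairwise_disjoint_on_Ioc_succ) hint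
  refine (congrArg (HasSum · _) (funext fun k => ?_)).mp this
  rw [setIntegral_congr_fun measurableSet_Ioc (fun v hv => stepFun_of_mem hε hv),
    setIntegral_const, measureReal_def, Real.volume_Ioc, ENNReal.toReal_ofReal, Complex.real_smul]
  · push_cast; ring
  · push_cast; nlinarith

theorem tendsto_stepFun {c : ℕ → ℝ} {h : ℝ → ℂ} {A : ℝ} (hc : Tendsto c atTop (𝓝 A))
    {ε : ℕ → ℝ} (hε : ∀ᶠ n in atTop, 0 < ε n) (hlim : Tendsto ε atTop (𝓝 0)) {v : ℝ} (hv : 0 < v)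
    (hh : ContinuousAt h v) :
    Tendsto (fun n => stepFun c h (ε n) v) atTop (𝓝 (A * h v)) := by
  have h0 : Tendsto ε atTop (𝓝[>] 0) := tendsto_nhdsWithin_iff.2 ⟨hlim, hε⟩
  have h1 : Tendsto (fun n => v / ε n) atTop atTop :=
    (tendsto_inv_nhdsGT_zero.comp h0).const_mul_atTop hv
  have h2 : Tendsto (fun n => ⌈v / ε n⌉₊ - 1) atTop atTop :=
    (tendsto_sub_atTop_nat 1).comp (tendsto_nat_ceil_atTop.comp h1)
  have h3 : Tendsto (fun n => (⌈v / ε n⌉₊ : ℝ) * ε n) atTop (𝓝 v) := by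
    refine tendsto_of_tendsto_of_tendsto_of_le_of_le' tendsto_const_nhds
      (by simpa using hlim.const_add v : Tendsto (fun n => v + ε n) atTop (𝓝 v)) ?_ ?_
    · filter_upwards [hε] with n hn using (div_le_iff₀ hn).1 (Nat.le_ceil _)
    · filter_upwards [hε] with n hn
      have := (Nat.ceil_lt_add_one (div_pos hv hn).le).le
      calc (⌈v / ε n⌉₊ : ℝ) * ε n ≤ (v / ε n + 1) * ε n := by gcongr
        _ = v + ε n := by field_simp
  exact ((Complex.continuous_ofReal.tendsto A).comp (hc.comp h2)).mul (hh.tendsto.comp h3)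

theorem tendsto_riemann_sum {c : ℕ → ℝ} {h : ℝ → ℂ} {a A K : ℝ} (ha : a ∈ Ioo (0 : ℝ) 1)
    (hc : Tendsto c atTop (𝓝 A)) (hh : ContinuousOn h (Ioi 0))
    (hK : ∀ v, 0 < v → ‖h v‖ ≤ K * levyBound a v) (hK0 : 0 ≤ K)
    {ε : ℕ → ℝ} (hε : ∀ᶠ n in atTop, 0 < ε n) (hlim : Tendsto ε atTop (𝓝 0)) :
    Tendsto (fun n => ∑' k : ℕ, (ε n : ℂ) * (c k * h ((k + 1) * ε n))) atTop
      (𝓝 (A * ∫ v in Ioi 0, h v)) := by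
  obtain ⟨C, hC⟩ : ∃ C, ∀ k, |c k| ≤ C := by
    obtain ⟨C, hC⟩ := hc.abs.bddAbove_range
    exact ⟨C, fun k => hC ⟨k, rfl⟩⟩
  rw [← integral_const_mul]
  have := tendsto_integral_filter_of_dominated_convergence (μ := volume.restrict (Ioi (0 : ℝ)))
    (F := fun n => stepFun c h (ε n)) (f := fun v => A * h v) (l := atTop)
    (fun v => C * (K * levyBound a v))
    (Eventually.of_forall fun n => measurable_stepFun.aestronglyMeasurable)
    (by
      filter_upwards [hε] with n hn
      filter_upwards [ae_restrict_mem measurableSet_Ioi] with v hv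
      exact norm_stepFun_le ha.1 hC hK hK0 hn hv)
    (((integrableOn_levyBound ha).const_mul K).const_mul C)
    (by
      filter_upwards [ae_restrict_mem measurableSet_Ioi] with v hv
      exact tendsto_stepFun hc hε hlim hv (hh.continuousAt (Ioi_mem_nhds hv)))
  refine this.congr' ?_
  filter_upwards [hε] with n hn
  exact (hasSum_stepFun ha hC hK hK0 hn).tsum_eq.symm

/-! ### The stable exponent -/

/-- The compensated `1 - χ`, where `χ` is the characteristic function of the biased sign. -/
def signDefect (κ β u : ℝ) : ℂ :=
  (1 + β) / 2 * compExp κ (-(Complex.I * u)) + (1 - β) / 2 * compExp κ (Complex.I * u)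

/-- The characteristic function at `u` of a sign which is `1` with probability `(1 + β) / 2`. -/
def signChar (β u : ℝ) : ℂ := Real.cos u + Complex.I * (β * Real.sin u)

theorem signChar_eq (β u : ℝ) :
    signChar β u = (1 + β) / 2 * Complex.exp (Complex.I * u) +
      (1 - β) / 2 * Complex.exp (-(Complex.I * u)) := by
  rw [signChar, mul_comm Complex.I (u : ℂ), Complex.exp_mul_I, ← neg_mul, Complex.exp_mul_I,
    Complex.cos_neg, Complex.sin_neg]
  push_cast
  ring

theorem signDefect_eq (κ β u : ℝ) :
    signDefect κ β u = 1 + κ * (Complex.I * (β * u)) - signChar β u := by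
  rw [signChar_eq, signDefect, compExp, compExp, neg_neg]
  ring

theorem norm_signChar_le {β : ℝ} (hβ : β ∈ Icc (-1 : ℝ) 1) (u : ℝ) : ‖signChar β u‖ ≤ 1 := by
  have h1 : ‖Complex.exp (Complex.I * u)‖ = 1 := by
    rw [mul_comm]; exact Complex.norm_exp_ofReal_mul_I u
  have h2 : ‖Complex.exp (-(Complex.I * u))‖ = 1 := by
    rw [show -(Complex.I * (u : ℂ)) = ((-u : ℝ) : ℂ) * Complex.I by push_cast; ring]
    exact Complex.norm_exp_ofReal_mul_I _
  rw [signChar_eq]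
  refine (norm_add_le _ _).trans ?_
  rw [norm_mul, norm_mul, h1, h2, mul_one, mul_one,
    show (1 + (β : ℂ)) / 2 = (((1 + β) / 2 : ℝ) : ℂ) by push_cast; rfl,
    show (1 - (β : ℂ)) / 2 = (((1 - β) / 2 : ℝ) : ℂ) by push_cast; rfl,
    Complex.norm_real, Complex.norm_real, Real.norm_of_nonneg (by linarith [hβ.1]),
    Real.norm_of_nonneg (by linarith [hβ.2])]
  linarith

theorem norm_signChar_sub_one_le {β θ : ℝ} (hβ : β ∈ Icc (-1 : ℝ) 1) (hθ : θ ∈ Ioo (0 : ℝ) 1)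
    (u : ℝ) : ‖signChar β u - 1‖ ≤ 3 * |u| ^ θ := by
  have hβ' : |β| ≤ 1 := abs_le.2 hβ
  have h : ‖signChar β u - 1‖ ≤ |Real.cos u - 1| + |Real.sin u| := by
    rw [show signChar β u - 1 = ((Real.cos u - 1 : ℝ) : ℂ) +
      Complex.I * ((β * Real.sin u : ℝ) : ℂ) by rw [signChar]; push_cast; ring]
    refine (norm_add_le _ _).trans ?_
    rw [norm_mul, Complex.norm_I, one_mul, Complex.norm_real, Complex.norm_real, Real.norm_eq_abs,
      Real.norm_eq_abs, abs_mul]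
    have := mul_le_mul_of_nonneg_right hβ' (abs_nonneg (Real.sin u))
    linarith
  refine h.trans ?_
  rcases le_total |u| 1 with hu | hu
  · have h1 : |u| ≤ |u| ^ θ := by
      rcases eq_or_ne |u| 0 with h0 | h0
      · rw [h0, Real.zero_rpow hθ.1.ne']
      · exact Real.self_le_rpow_of_le_one (abs_nonneg u) hu hθ.2.le
    have h2 : |Real.cos u - 1| ≤ |u| := by
      rw [abs_sub_comm, abs_of_nonneg (by linarith [Real.cos_le_one u])]
      have := Real.one_sub_sq_div_two_le_cos (x := u)
      nlinarith [sq_abs u, abs_nonneg u]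
    have h3 : |Real.sin u| ≤ |u| := Real.abs_sin_le_abs
    have := abs_nonneg u
    linarith
  · have h1 : 1 ≤ |u| ^ θ := Real.one_le_rpow hu hθ.1.le
    have h2 : |Real.cos u - 1| ≤ 2 := by
      rw [abs_le]; constructor <;> linarith [Real.cos_le_one u, Real.neg_one_le_cos u]
    linarith [Real.abs_sin_le_one u]

theorem cpow_I_mul {α x : ℝ} (hx : 0 < x) :
    (Complex.I * x) ^ (α : ℂ) =
      ((x ^ α : ℝ) : ℂ) * (Real.cos (α * π / 2) + Complex.I * Real.sin (α * π / 2)) := by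
  rw [Complex.cpow_ofReal, mul_comm Complex.I (x : ℂ), Complex.arg_real_mul _ hx, Complex.arg_I,
    norm_mul, Complex.norm_I, Complex.norm_real, Real.norm_of_nonneg hx.le, mul_one,
    show π / 2 * α = α * π / 2 by ring]
  ring

theorem cpow_neg_I_mul {α x : ℝ} (hx : 0 < x) :
    (-(Complex.I * x)) ^ (α : ℂ) =
      ((x ^ α : ℝ) : ℂ) * (Real.cos (α * π / 2) - Complex.I * Real.sin (α * π / 2)) := by
  rw [Complex.cpow_ofReal, show -(Complex.I * (x : ℂ)) = x * -Complex.I by ring,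
    Complex.arg_real_mul _ hx, Complex.arg_neg_I, norm_mul, norm_neg, Complex.norm_I,
    Complex.norm_real, Real.norm_of_nonneg hx.le, mul_one,
    show -(π / 2) * α = -(α * π / 2) by ring, Real.cos_neg, Real.sin_neg]
  push_cast
  ring

theorem sign_mul_cpow {α : ℝ} (hα : 0 < α) (β σ : ℝ) :
    (1 + (β : ℂ)) / 2 * (-(Complex.I * σ)) ^ (α : ℂ) +
      (1 - (β : ℂ)) / 2 * (Complex.I * σ) ^ (α : ℂ) =
      ((|σ| ^ α : ℝ) : ℂ) * (Real.cos (α * π / 2) -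
        Complex.I * β * (Real.sign σ : ℝ) * Real.sin (α * π / 2)) := by
  rcases lt_trichotomy σ 0 with h | rfl | h
  · have h' : 0 < -σ := by linarith
    have e1 := cpow_I_mul (α := α) h'
    have e2 := cpow_neg_I_mul (α := α) h'
    rw [Complex.ofReal_neg, mul_neg] at e1 e2
    rw [neg_neg] at e2
    rw [e1, e2, abs_of_neg h, Real.sign_of_neg h]
    push_cast
    ring
  · have : (α : ℂ) ≠ 0 := by exact_mod_cast hα.ne'
    simp [Complex.zero_cpow this, Real.zero_rpow hα.ne']
  · rw [cpow_I_mul h, cpow_neg_I_mul h, abs_of_pos h, Real.sign_of_pos h]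
    push_cast
    ring

namespace StableIdx

variable {α κ : ℝ}

theorem cos_ne_zero (h : StableIdx α κ) : Real.cos (α * π / 2) ≠ 0 := by
  rcases h with ⟨_, h1, h2⟩ | ⟨_, h1, h2⟩
  · exact (Real.cos_pos_of_mem_Ioo ⟨by nlinarith [Real.pi_pos], by nlinarith [Real.pi_pos]⟩).ne'
  · exact (Real.cos_neg_of_pi_div_two_lt_of_lt (by nlinarith [Real.pi_pos])
      (by nlinarith [Real.pi_pos])).ne

theorem stableGa_pos (h : StableIdx α κ) : 0 < stableGa α := by
  unfold stableGa
  rcases h with ⟨_, h1, h2⟩ | ⟨_, h1, h2⟩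
  · exact mul_pos (Real.Gamma_pos_of_pos (by linarith))
      (Real.cos_pos_of_mem_Ioo ⟨by nlinarith [Real.pi_pos], by nlinarith [Real.pi_pos]⟩)
  · have h3 := Real.Gamma_add_one (by linarith : 1 - α ≠ 0)
    have h4 : 0 < Real.Gamma (1 - α + 1) := Real.Gamma_pos_of_pos (by linarith)
    exact mul_pos_of_neg_of_neg (by nlinarith)
      (Real.cos_neg_of_pi_div_two_lt_of_lt (by nlinarith [Real.pi_pos])
        (by nlinarith [Real.pi_pos]))

theorem norm_signDefect_le (h : StableIdx α κ) (β σ : ℝ) {v : ℝ} (hv : 0 < v) :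
    ‖((v ^ (-1 - α) : ℝ) : ℂ) * signDefect κ β (σ * v)‖ ≤
      (‖(1 + (β : ℂ)) / 2‖ + ‖(1 - (β : ℂ)) / 2‖) * (3 * (1 + |σ|) ^ 2) *
        levyBound (α - κ) v := by
  have h1 := h.norm_compExp_le (r := -(Complex.I * σ)) (by simp) hv
  have h2 := h.norm_compExp_le (r := Complex.I * σ) (by simp) hv
  have e : ‖Complex.I * (σ : ℂ)‖ = |σ| := by simp
  rw [norm_neg] at h1
  rw [e] at h1 h2
  have e2 : ((v ^ (-1 - α) : ℝ) : ℂ) * signDefect κ β (σ * v) =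
      (1 + (β : ℂ)) / 2 * (((v ^ (-1 - α) : ℝ) : ℂ) * compExp κ (-(Complex.I * σ) * v)) +
      (1 - (β : ℂ)) / 2 * (((v ^ (-1 - α) : ℝ) : ℂ) * compExp κ (Complex.I * σ * v)) := by
    rw [signDefect, neg_mul]
    push_cast
    rw [mul_assoc Complex.I]
    ring
  rw [e2]
  refine (norm_add_le _ _).trans ?_
  rw [norm_mul ((1 + (β : ℂ)) / 2), norm_mul ((1 - (β : ℂ)) / 2)]
  have h3 := mul_le_mul_of_nonneg_left h1 (norm_nonneg ((1 + (β : ℂ)) / 2))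
  have h4 := mul_le_mul_of_nonneg_left h2 (norm_nonneg ((1 - (β : ℂ)) / 2))
  linarith

theorem integral_signDefect (h : StableIdx α κ) (β σ : ℝ) :
    ∫ v in Ioi (0 : ℝ), ((v ^ (-1 - α) : ℝ) : ℂ) * signDefect κ β (σ * v) =
      (stableGa α / α : ℝ) * ((|σ| ^ α : ℝ) : ℂ) *
        (1 - Complex.I * β * (Real.sign σ : ℝ) * (Real.tan (α * π / 2) : ℝ)) := by
  have e2 : ∀ v : ℝ, ((v ^ (-1 - α) : ℝ) : ℂ) * signDefect κ β (σ * v) =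
      (1 + (β : ℂ)) / 2 * (((v ^ (-1 - α) : ℝ) : ℂ) * compExp κ (-(Complex.I * σ) * v)) +
      (1 - (β : ℂ)) / 2 * (((v ^ (-1 - α) : ℝ) : ℂ) * compExp κ (Complex.I * σ * v)) := by
    intro v
    rw [signDefect, neg_mul]
    push_cast
    rw [mul_assoc Complex.I]
    ring
  have hs := sign_mul_cpow h.pos β σ
  have hc : (Real.cos (α * π / 2) : ℂ) ≠ 0 := by exact_mod_cast h.cos_ne_zero
  simp only [e2]
  rw [integral_add ((h.integrableOn_compExp (by simp)).const_mul _)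
      ((h.integrableOn_compExp (by simp)).const_mul _), integral_const_mul, integral_const_mul,
    h.integral_compExp (by simp), h.integral_compExp (by simp), stableGa, Real.tan_eq_sin_div_cos]
  calc _ = (Real.Gamma (1 - α) : ℂ) / α * ((1 + (β : ℂ)) / 2 * (-(Complex.I * σ)) ^ (α : ℂ) +
      (1 - (β : ℂ)) / 2 * (Complex.I * σ) ^ (α : ℂ)) := by ring
    _ = _ := by
      rw [hs]
      push_cast at hc ⊢
      field_simp

end StableIdx

theorem tendsto_exp_second_order {u : ℕ → ℝ} {c : ℂ} (hu0 : Tendsto u atTop (𝓝 0))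
    (hu : Tendsto (fun n : ℕ => (n : ℝ) * u n ^ 2) atTop (𝓝 0)) :
    Tendsto (fun n : ℕ => (n : ℂ) * (Complex.exp (-(c / n) + Complex.I * u n) - 1 -
      (-(c / n) + Complex.I * u n))) atTop (𝓝 0) := by
  have hinv : Tendsto (fun n : ℕ => ((n : ℝ))⁻¹) atTop (𝓝 0) := tendsto_inv_atTop_nhds_zero_nat
  have hnorm : ∀ n : ℕ, ‖-(c / n) + Complex.I * u n‖ ≤ ‖c‖ * (n : ℝ)⁻¹ + |u n| := fun n => by
    refine (norm_add_le _ _).trans (le_of_eq ?_)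
    rw [norm_neg, norm_div, norm_mul, Complex.norm_I, one_mul, Complex.norm_real,
      Complex.norm_natCast, Real.norm_eq_abs, div_eq_mul_inv]
  have hsmall : ∀ᶠ n : ℕ in atTop, ‖-(c / n) + Complex.I * u n‖ ≤ 1 := by
    have : Tendsto (fun n : ℕ => ‖c‖ * (n : ℝ)⁻¹ + |u n|) atTop (𝓝 0) := by
      simpa using (hinv.const_mul ‖c‖).add hu0.abs
    filter_upwards [this.eventually_le_const one_pos] with n hn using (hnorm n).trans hn
  have hbound : Tendsto (fun n : ℕ => 2 * ‖c‖ ^ 2 * (n : ℝ)⁻¹ + 2 * ((n : ℝ) * u n ^ 2)) atTop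
      (𝓝 0) := by
    simpa using (hinv.const_mul (2 * ‖c‖ ^ 2)).add (hu.const_mul 2)
  refine squeeze_zero_norm' ?_ hbound
  filter_upwards [hsmall, eventually_gt_atTop 0] with n hn hn0
  have hn0' : (0 : ℝ) < n := by exact_mod_cast hn0
  rw [norm_mul, Complex.norm_natCast]
  have h1 := (Complex.norm_exp_sub_one_sub_id_le hn).trans
    (pow_le_pow_left₀ (norm_nonneg _) (hnorm n) 2)
  calc (n : ℝ) * _ ≤ n * (‖c‖ * (n : ℝ)⁻¹ + |u n|) ^ 2 := by gcongr
    _ ≤ n * (2 * (‖c‖ * (n : ℝ)⁻¹) ^ 2 + 2 * u n ^ 2) := by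
      gcongr
      nlinarith [sq_nonneg (‖c‖ * (n : ℝ)⁻¹ - |u n|), sq_abs (u n)]
    _ = _ := by field_simp

theorem tendsto_exp_of_linearization {E X : ℕ → ℂ} {u D : ℕ → ℝ} {c : ℂ} {t : ℝ} (ht : 0 ≤ t)
    (hc : 0 ≤ c.re) (hD0 : ∀ n, 0 ≤ D n)
    (hE : Tendsto (fun n : ℕ => (n : ℂ) * (1 + Complex.I * u n - E n)) atTop (𝓝 c))
    (hu0 : Tendsto u atTop (𝓝 0)) (hu : Tendsto (fun n : ℕ => (n : ℝ) * u n ^ 2) atTop (𝓝 0))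
    (hD : Tendsto (fun n : ℕ => (n : ℝ) * D n) atTop (𝓝 0))
    (hX : ∀ᶠ n in atTop, ∀ b : ℂ, ‖b‖ ≤ 1 →
      ‖X n - b ^ ⌊(n : ℝ) * t⌋₊‖ ≤ ⌊(n : ℝ) * t⌋₊ * (D n + ‖E n - b‖)) :
    Tendsto (fun n : ℕ => Complex.exp (-(Complex.I * (u n * (n * t)))) * X n) atTop
      (𝓝 (Complex.exp (-(t * c)))) := by
  set w : ℕ → ℂ := fun n => -(c / n) + Complex.I * u n with hw
  have hfloor : ∀ n : ℕ, (⌊(n : ℝ) * t⌋₊ : ℝ) ≤ n * t := fun n => Nat.floor_le (by positivity)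
  have hEb : Tendsto (fun n : ℕ => (n : ℝ) * ‖E n - Complex.exp (w n)‖) atTop (𝓝 0) := by
    have h1 := (((tendsto_exp_second_order (c := c) hu0 hu).add hE).sub_const c).norm
    rw [zero_add, sub_self, norm_zero] at h1
    refine h1.congr' ?_
    filter_upwards [eventually_gt_atTop 0] with n hn
    have hn' : (n : ℂ) ≠ 0 := by exact_mod_cast hn.ne'
    rw [norm_sub_rev, ← Complex.norm_natCast, ← norm_mul]
    congr 1
    simp only [hw]
    field_simp
    ring
  have hb : ∀ n, ‖Complex.exp (w n)‖ ≤ 1 := fun n => by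
    rw [Complex.norm_exp, Real.exp_le_one_iff]
    have h1 : (c / (n : ℂ)).re = c.re / n := Complex.div_natCast_re c n
    simp only [hw, Complex.add_re, Complex.neg_re, h1, Complex.mul_re, Complex.I_re, Complex.I_im,
      Complex.ofReal_re, Complex.ofReal_im]
    have : 0 ≤ c.re / n := by positivity
    linarith
  have hdiff : Tendsto (fun n : ℕ => Complex.exp (-(Complex.I * (u n * (n * t)))) *
      (X n - Complex.exp (w n) ^ ⌊(n : ℝ) * t⌋₊)) atTop (𝓝 0) := by
    have h1 := (hD.add hEb).const_mul t
    rw [zero_add, mul_zero] at h1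
    refine squeeze_zero_norm' ?_ h1
    filter_upwards [hX] with n hn
    rw [norm_mul, show -(Complex.I * ((u n : ℂ) * ((n : ℂ) * t))) =
      ((-(u n * (n * t)) : ℝ) : ℂ) * Complex.I by push_cast; ring,
      Complex.norm_exp_ofReal_mul_I, one_mul]
    refine (hn _ (hb n)).trans ?_
    calc (⌊(n : ℝ) * t⌋₊ : ℝ) * (D n + ‖E n - Complex.exp (w n)‖)
        ≤ (n * t) * (D n + ‖E n - Complex.exp (w n)‖) :=
          mul_le_mul_of_nonneg_right (hfloor n) (add_nonneg (hD0 n) (norm_nonneg _))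
      _ = _ := by ring
  have hrem : Tendsto (fun n : ℕ => u n * ((⌊(n : ℝ) * t⌋₊ : ℝ) - n * t)) atTop (𝓝 0) := by
    refine squeeze_zero_norm (fun n => ?_) (by simpa using hu0.abs)
    rw [norm_mul, Real.norm_eq_abs, Real.norm_eq_abs]
    refine mul_le_of_le_one_right (abs_nonneg _) (abs_le.2 ⟨?_, ?_⟩)
    · linarith [Nat.lt_floor_add_one ((n : ℝ) * t)]
    · linarith [hfloor n]
  have hratio : Tendsto (fun n : ℕ => (⌊(n : ℝ) * t⌋₊ : ℝ) / n) atTop (𝓝 t) := by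
    have := (tendsto_nat_floor_mul_div_atTop ht).comp (tendsto_natCast_atTop_atTop (R := ℝ))
    refine this.congr fun n => ?_
    simp [mul_comm]
  have hmain : Tendsto (fun n : ℕ => Complex.exp (-(Complex.I * (u n * (n * t)))) *
      Complex.exp (w n) ^ ⌊(n : ℝ) * t⌋₊) atTop (𝓝 (Complex.exp (-(t * c)))) := by
    have h1 := ((((Complex.continuous_ofReal.tendsto t).comp hratio).mul_const c).neg).add
      (((Complex.continuous_ofReal.tendsto 0).comp hrem).const_mul Complex.I)
    rw [Complex.ofReal_zero, mul_zero, add_zero] at h1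
    refine ((Complex.continuous_exp.tendsto _).comp h1).congr fun n => ?_
    rw [← Complex.exp_nat_mul, ← Complex.exp_add]
    simp only [Function.comp_apply, hw]
    push_cast
    congr 1
    ring
  refine (by simpa using hdiff.add hmain : Tendsto _ atTop (𝓝 (Complex.exp (-(t * c))))).congr
    fun n => ?_
  ring

namespace ThalerParam

variable {α κ xs : ℝ}

/-- The sequence of sign characteristic functions at frequency `s`, indexed by return time
minus one. -/
def signSeq (β s : ℝ) (k : ℕ) : ℂ := signChar β (s * (k + 1))

theorem norm_signSeq_le {β : ℝ} (hβ : β ∈ Icc (-1 : ℝ) 1) (s : ℝ) (k : ℕ) :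
    ‖signSeq β s k‖ ≤ 1 := norm_signChar_le hβ _

theorem hasSum_mean (P : ThalerParam α⁻¹ xs) (h : StableIdx α κ) :
    HasSum (fun k : ℕ => κ * (thalerMass α⁻¹ k / total α⁻¹ * ((k : ℝ) + 1))) (stableLa α) := by
  rcases h with ⟨rfl, h⟩ | ⟨rfl, h⟩
  · simp [stableLa, h.2, hasSum_zero]
  · have h1 : α⁻¹ < 1 := inv_lt_one_of_one_lt₀ h.1
    have hs := (P.hasSum_mul_mass h1).div_const (total α⁻¹)
    have hval : (2 : ℝ) ^ (1 - α⁻¹) / (1 - α⁻¹) / total α⁻¹ = stableLa α := by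
      have hT := P.total_pos
      have h2 : 0 < 1 - α⁻¹ := by linarith
      have h3 : (1 : ℝ) < 2 ^ (1 - α⁻¹) := Real.one_lt_rpow one_lt_two h2
      rw [stableLa, if_neg (by linarith [h.1]), total, show α⁻¹ - 1 = -(1 - α⁻¹) by ring,
        Real.rpow_neg zero_le_two]
      have h4 : (2 : ℝ) ^ (1 - α⁻¹) - 1 ≠ 0 := by linarith
      have h5 := h2.ne'
      generalize 1 - α⁻¹ = b at *
      field_simp
    rw [hval] at hs
    exact hs.congr_fun fun k => by ring

theorem hasSum_signDefect (P : ThalerParam α⁻¹ xs) (h : StableIdx α κ) {β : ℝ}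
    (hβ : β ∈ Icc (-1 : ℝ) 1) (s : ℝ) :
    HasSum (fun k : ℕ => ((thalerMass α⁻¹ k / total α⁻¹ : ℝ) : ℂ) *
        signDefect κ β (s * (k + 1)))
      (1 + Complex.I * ((s * (β * stableLa α) : ℝ) : ℂ) -
        ∫ y, signSeq β s (thalerTau α⁻¹ xs y - 1) ∂thalerMuY α⁻¹ xs) := by
  have h1 : HasSum (fun k => ((thalerMass α⁻¹ k / total α⁻¹ : ℝ) : ℂ)) 1 := by
    have := Complex.hasSum_ofReal.2 (P.hasSum_mass.div_const (total α⁻¹))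
    rwa [div_self P.total_pos.ne', Complex.ofReal_one] at this
  have h2 := (Complex.hasSum_ofReal.2 ((P.hasSum_mean h).mul_left (s * β))).mul_left Complex.I
  have h3 := P.hasSum_multiplier (norm_signSeq_le hβ s)
  rw [← mul_assoc s]
  refine ((h1.add h2).sub h3).congr_fun fun k => ?_
  rw [signDefect_eq, signSeq]
  push_cast
  ring

theorem stableDa_eq (α : ℝ) : stableDa α = α ^ α / total α⁻¹ * stableGa α := by
  rw [stableDa, total, ← inv_div, div_eq_mul_inv (α ^ α)]

theorem stableDa_pos (P : ThalerParam α⁻¹ xs) (h : StableIdx α κ) : 0 < stableDa α := by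
  rw [stableDa_eq]
  exact mul_pos (div_pos (Real.rpow_pos_of_pos h.pos _) P.total_pos) h.stableGa_pos

theorem tendsto_natCast_rpow_neg {b : ℝ} (hb : 0 < b) :
    Tendsto (fun n : ℕ => (n : ℝ) ^ (-b)) atTop (𝓝 0) :=
  (tendsto_rpow_neg_atTop hb).comp tendsto_natCast_atTop_atTop

theorem tendsto_signDefect (P : ThalerParam α⁻¹ xs) (h : StableIdx α κ) {β : ℝ}
    (hβ : β ∈ Icc (-1 : ℝ) 1) (σ : ℝ) :
    Tendsto (fun n : ℕ => (n : ℂ) * (1 + Complex.I *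
        ((σ * (n : ℝ) ^ (-α⁻¹) * (β * stableLa α) : ℝ) : ℂ) -
        ∫ y, signSeq β (σ * (n : ℝ) ^ (-α⁻¹)) (thalerTau α⁻¹ xs y - 1) ∂thalerMuY α⁻¹ xs)) atTop
      (𝓝 ((stableDa α * |σ| ^ α : ℝ) *
        (1 - Complex.I * β * (Real.sign σ : ℝ) * (Real.tan (α * π / 2) : ℝ)))) := by
  have hα := h.pos
  have hc : Tendsto (fun k : ℕ => ((k : ℝ) + 1) ^ (1 + α) * thalerMass α⁻¹ k / total α⁻¹) atTop
      (𝓝 (α ^ (1 + α) / total α⁻¹)) := by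
    simpa using P.tendsto_mul_mass.div_const (total α⁻¹)
  have hcont : ContinuousOn (fun v : ℝ => ((v ^ (-1 - α) : ℝ) : ℂ) * signDefect κ β (σ * v))
      (Ioi 0) := by
    have h1 : ContinuousOn (fun v : ℝ => v ^ (-1 - α)) (Ioi 0) := fun v hv =>
      (Real.continuousAt_rpow_const v _ (Or.inl (ne_of_gt hv))).continuousWithinAt
    have h2 : Continuous fun v : ℝ => signDefect κ β (σ * v) := by
      unfold signDefect compExp; fun_prop
    exact (Complex.continuous_ofReal.comp_continuousOn h1).mul h2.continuousOn
  have hε : ∀ᶠ n : ℕ in atTop, (0 : ℝ) < (n : ℝ) ^ (-α⁻¹) := by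
    filter_upwards [eventually_gt_atTop 0] with n hn
    have : (0 : ℝ) < n := by exact_mod_cast hn
    positivity
  have key := tendsto_riemann_sum h.sub_mem hc hcont (fun v hv => h.norm_signDefect_le β σ hv)
    (by positivity) hε (tendsto_natCast_rpow_neg (inv_pos.2 hα))
  rw [h.integral_signDefect] at key
  have hlim : ((α ^ (1 + α) / total α⁻¹ : ℝ) : ℂ) * ((stableGa α / α : ℝ) * ((|σ| ^ α : ℝ) : ℂ) *
        (1 - Complex.I * β * (Real.sign σ : ℝ) * (Real.tan (α * π / 2) : ℝ))) =
      (stableDa α * |σ| ^ α : ℝ) *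
        (1 - Complex.I * β * (Real.sign σ : ℝ) * (Real.tan (α * π / 2) : ℝ)) := by
    rw [← mul_assoc, ← mul_assoc, ← Complex.ofReal_mul, ← Complex.ofReal_mul, stableDa_eq,
      Real.rpow_add hα, Real.rpow_one]
    congr 3
    field_simp
  rw [hlim] at key
  refine key.congr' ?_
  filter_upwards [eventually_gt_atTop 0] with n hn
  have hn' : (0 : ℝ) < n := by exact_mod_cast hn
  rw [← (P.hasSum_signDefect h hβ (σ * (n : ℝ) ^ (-α⁻¹))).tsum_eq, ← tsum_mul_left]
  refine tsum_congr fun k => ?_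
  have hk : (0 : ℝ) < (k : ℝ) + 1 := by positivity
  have hpos : (0 : ℝ) < (n : ℝ) ^ (-α⁻¹) := by positivity
  have e1 : (n : ℝ) ^ (-α⁻¹) * (((n : ℝ) ^ (-α⁻¹)) ^ (-1 - α)) = n := by
    rw [← Real.rpow_one_add' hpos.le (by linarith), ← Real.rpow_mul hn'.le]
    rw [show -α⁻¹ * (1 + (-1 - α)) = 1 by field_simp; ring, Real.rpow_one]
  have e2 : ((k : ℝ) + 1) ^ (1 + α) * ((k : ℝ) + 1) ^ (-1 - α) = 1 := by
    rw [← Real.rpow_add hk, show 1 + α + (-1 - α) = 0 by ring, Real.rpow_zero]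
  have e3 : (n : ℝ) ^ (-α⁻¹) * ((((k : ℝ) + 1) ^ (1 + α) * thalerMass α⁻¹ k / total α⁻¹) *
      (((k : ℝ) + 1) * (n : ℝ) ^ (-α⁻¹)) ^ (-1 - α)) =
      n * (thalerMass α⁻¹ k / total α⁻¹) := by
    rw [Real.mul_rpow hk.le hpos.le]
    linear_combination (((k : ℝ) + 1) ^ (1 + α) * ((k : ℝ) + 1) ^ (-1 - α)) *
      (thalerMass α⁻¹ k / total α⁻¹) * e1 + n * (thalerMass α⁻¹ k / total α⁻¹) * e2
  rw [show σ * (((k : ℝ) + 1) * (n : ℝ) ^ (-α⁻¹)) = σ * (n : ℝ) ^ (-α⁻¹) * (k + 1) by ring,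
    ← mul_assoc, ← mul_assoc, ← mul_assoc, ← Complex.ofReal_natCast, ← Complex.ofReal_mul,
    ← Complex.ofReal_mul, ← Complex.ofReal_mul, mul_assoc ((n : ℝ) ^ (-α⁻¹)), e3]

theorem exists_twist_signSeq_le (P : ThalerParam α⁻¹ xs) {θ : ℝ} (hθ : θ ∈ Ioo (0 : ℝ) 1)
    (hθα : θ < α) {β : ℝ} (hβ : β ∈ Icc (-1 : ℝ) 1) :
    ∃ M, ∀ s, twist α⁻¹ xs (signSeq β s) ≤ M * |s| ^ θ := by
  obtain ⟨K, hK, hw⟩ := P.exists_weightBound_le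
  rw [inv_inv] at hw
  have hsum : Summable fun k : ℕ => ((k : ℝ) + 1) ^ (θ - (1 + α)) := by
    have := (summable_nat_add_iff 1).2 (Real.summable_nat_rpow.2 (by linarith : θ - (1 + α) < -1))
    simpa using this
  refine ⟨3 * K * ∑' k : ℕ, ((k : ℝ) + 1) ^ (θ - (1 + α)), fun s => ?_⟩
  have hle : ∀ k : ℕ, ‖signSeq β s k - 1‖ * weightBound α⁻¹ xs k ≤
      3 * K * |s| ^ θ * ((k : ℝ) + 1) ^ (θ - (1 + α)) := fun k => by
    have hk : (0 : ℝ) < (k : ℝ) + 1 := by positivity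
    have h1 := norm_signChar_sub_one_le hβ hθ (s * (k + 1))
    rw [abs_mul, abs_of_pos hk, Real.mul_rpow (abs_nonneg _) hk.le] at h1
    calc _ ≤ 3 * (|s| ^ θ * ((k : ℝ) + 1) ^ θ) * (K * ((k : ℝ) + 1) ^ (-(1 + α))) :=
          mul_le_mul h1 (hw k) (P.weightBound_nonneg k) (by positivity)
      _ = _ := by rw [sub_eq_add_neg θ, Real.rpow_add hk]; ring
  calc twist α⁻¹ xs (signSeq β s) ≤ ∑' k : ℕ, 3 * K * |s| ^ θ * ((k : ℝ) + 1) ^ (θ - (1 + α)) :=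
        (P.summable_twist (norm_signSeq_le hβ s)).tsum_le_tsum hle (hsum.mul_left _)
    _ = _ := by rw [tsum_mul_left]; ring

theorem tendsto_integral_signSeq (P : ThalerParam α⁻¹ xs) (h : StableIdx α κ) {β : ℝ}
    (hβ : β ∈ Icc (-1 : ℝ) 1) (s : ℝ) {t : ℝ} (ht : 0 ≤ t) :
    Tendsto (fun n : ℕ => Complex.exp (-(Complex.I * (((s * stableDa α ^ (-α⁻¹) *
        (n : ℝ) ^ (-α⁻¹) * (β * stableLa α) : ℝ) : ℂ) * (n * t)))) *
        ∫ y, ∏ j ∈ Finset.range ⌊(n : ℝ) * t⌋₊,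
          signSeq β (s * stableDa α ^ (-α⁻¹) * (n : ℝ) ^ (-α⁻¹))
            (thalerTau α⁻¹ xs ((thalerF α⁻¹ xs)^[j] y) - 1) ∂thalerMuY α⁻¹ xs) atTop
      (𝓝 (Complex.exp (-(t * ((|s| ^ α : ℝ) *
        (1 - Complex.I * β * (Real.sign s : ℝ) * (Real.tan (α * π / 2) : ℝ))))))) := by
  have hα := h.pos
  have hα2 := h.lt_two
  have hd := P.stableDa_pos h
  have hdp : 0 < stableDa α ^ (-α⁻¹) := Real.rpow_pos_of_pos hd _
  set σ := s * stableDa α ^ (-α⁻¹) with hσ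
  have hσabs : stableDa α * |σ| ^ α = |s| ^ α := by
    rw [hσ, abs_mul, abs_of_pos hdp, Real.mul_rpow (abs_nonneg _) hdp.le, ← Real.rpow_mul hd.le,
      neg_mul, inv_mul_cancel₀ hα.ne', Real.rpow_neg_one]
    field_simp
  have hσsign : Real.sign σ = Real.sign s := by
    rcases lt_trichotomy s 0 with hs | hs | hs
    · rw [Real.sign_of_neg hs, Real.sign_of_neg (mul_neg_of_neg_of_pos hs hdp)]
    · rw [hσ, hs, zero_mul]
    · rw [Real.sign_of_pos hs, Real.sign_of_pos (mul_pos hs hdp)]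
  have hE := P.tendsto_signDefect h hβ σ
  rw [hσabs, hσsign] at hE
  have hu0 : Tendsto (fun n : ℕ => σ * (n : ℝ) ^ (-α⁻¹) * (β * stableLa α)) atTop (𝓝 0) := by
    simpa using ((tendsto_natCast_rpow_neg (inv_pos.2 hα)).const_mul σ).mul_const (β * stableLa α)
  have hpow : ∀ {b : ℝ}, α / 2 < b → Tendsto (fun n : ℕ => (n : ℝ) * ((n : ℝ) ^ (-α⁻¹ * b)) ^ 2)
      atTop (𝓝 0) := by
    intro b hb
    have hb' : 0 < 2 * (α⁻¹ * b) - 1 := by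
      have : α⁻¹ * (α / 2) < α⁻¹ * b := mul_lt_mul_of_pos_left hb (inv_pos.2 hα)
      have e : α⁻¹ * (α / 2) = 1 / 2 := by field_simp
      linarith
    refine (tendsto_natCast_rpow_neg hb').congr' ?_
    filter_upwards [eventually_gt_atTop 0] with n hn
    have hn' : (0 : ℝ) < n := by exact_mod_cast hn
    rw [← Real.rpow_natCast, ← Real.rpow_mul hn'.le]
    nth_rewrite 2 [← Real.rpow_one (n : ℝ)]
    rw [← Real.rpow_add hn']
    congr 1
    push_cast
    ring
  have hu : Tendsto (fun n : ℕ => (n : ℝ) * (σ * (n : ℝ) ^ (-α⁻¹) * (β * stableLa α)) ^ 2) atTop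
      (𝓝 0) := by
    have := (hpow (by linarith : α / 2 < 1)).const_mul ((σ * (β * stableLa α)) ^ 2)
    rw [mul_zero] at this
    refine this.congr fun n => ?_
    rw [mul_one]; ring
  obtain ⟨θ, hθ1, hθ2⟩ : ∃ θ, α / 2 < θ ∧ θ < min α 1 :=
    exists_between (lt_min (by linarith) (by linarith))
  have hθ0 : 0 < θ := by linarith
  have hθ3 : θ < α := hθ2.trans_le (min_le_left _ _)
  obtain ⟨M, hM⟩ := P.exists_twist_signSeq_le ⟨hθ0, hθ2.trans_le (min_le_right _ _)⟩ hθ3 hβ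
  set δ : ℕ → ℝ := fun n => twist α⁻¹ xs (signSeq β (σ * (n : ℝ) ^ (-α⁻¹))) with hδ
  have hδ0 : ∀ n, 0 ≤ δ n := fun n => P.twist_nonneg _
  have hδle : ∀ n, δ n ≤ M * |σ| ^ θ * (n : ℝ) ^ (-α⁻¹ * θ) := fun n => by
    refine (hM _).trans (le_of_eq ?_)
    have : (0 : ℝ) ≤ (n : ℝ) ^ (-α⁻¹) := by positivity
    rw [abs_mul, abs_of_nonneg this, Real.mul_rpow (abs_nonneg _) this,
      ← Real.rpow_mul n.cast_nonneg, mul_assoc]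
  have hδlim : Tendsto δ atTop (𝓝 0) := by
    have h1 := (tendsto_natCast_rpow_neg (mul_pos (inv_pos.2 hα) hθ0)).const_mul (M * |σ| ^ θ)
    rw [mul_zero, ← neg_mul] at h1
    exact squeeze_zero hδ0 hδle h1
  refine tendsto_exp_of_linearization (D := fun n => 4 * δ n ^ 2) ht ?_ (fun n => by positivity)
    hE hu0 hu ?_ ?_
  · have : (0 : ℝ) ≤ |s| ^ α := by positivity
    rw [Complex.re_ofReal_mul]
    refine mul_nonneg this ?_
    rw [show Complex.I * (β : ℂ) * (Real.sign s : ℝ) * (Real.tan (α * π / 2) : ℝ) =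
      ((β * Real.sign s * Real.tan (α * π / 2) : ℝ) : ℂ) * Complex.I by push_cast; ring]
    rw [Complex.sub_re, Complex.re_ofReal_mul]
    simp
  · have h1 := (hpow hθ1).const_mul (4 * (M * |σ| ^ θ) ^ 2)
    rw [mul_zero] at h1
    refine squeeze_zero (fun n => by positivity) (fun n => ?_) h1
    have h2 := pow_le_pow_left₀ (hδ0 n) (hδle n) 2
    calc (n : ℝ) * (4 * δ n ^ 2) ≤ n * (4 * (M * |σ| ^ θ * (n : ℝ) ^ (-α⁻¹ * θ)) ^ 2) := by gcongr
      _ = _ := by ring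
  · filter_upwards [hδlim.eventually_le_const (by norm_num : (0 : ℝ) < 1 / 4)] with n hn b hb
    exact P.norm_integral_prod_sub_pow_le (norm_signSeq_le hβ _) hn hb _

end ThalerParam

/-! ### The biased signs -/

/-- The cylinder probabilities of i.i.d. signs of bias `β`. -/
def IsSignMeasure (β : ℝ) (ν : Measure (ℕ → ℝ)) : Prop :=
  ∀ (s : Finset ℕ) (ε : ℕ → ℝ), (∀ i, ε i = 1 ∨ ε i = -1) →
    ν {ω | ∀ i ∈ s, ω i = ε i} = ∏ i ∈ s, ENNReal.ofReal ((1 + β * ε i) / 2)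

namespace IsSignMeasure

variable {β : ℝ} {ν : Measure (ℕ → ℝ)} [IsProbabilityMeasure ν]

theorem ae_sign (hν : IsSignMeasure β ν) (hβ : β ∈ Icc (-1 : ℝ) 1) (j : ℕ) :
    ∀ᵐ ω ∂ν, ω j = 1 ∨ ω j = -1 := by
  have hm : ∀ x : ℝ, MeasurableSet {ω : ℕ → ℝ | ω j = x} := fun x =>
    (measurable_pi_apply (X := fun _ : ℕ => ℝ) j) (measurableSet_singleton x)
  have h1 := hν {j} (fun _ => 1) (fun _ => Or.inl rfl)
  have h2 := hν {j} (fun _ => -1) (fun _ => Or.inr rfl)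
  simp only [Finset.mem_singleton, forall_eq, Finset.prod_singleton] at h1 h2
  have hu : ν ({ω | ω j = 1} ∪ {ω | ω j = -1}) = 1 := by
    rw [measure_union _ (hm _), h1, h2, ← ENNReal.ofReal_add (by linarith [hβ.1])
      (by linarith [hβ.2]), show (1 + β * 1) / 2 + (1 + β * -1) / 2 = 1 by ring,
      ENNReal.ofReal_one]
    refine Set.disjoint_left.2 fun ω (h3 : ω j = 1) (h4 : ω j = -1) => ?_
    linarith
  exact mem_ae_iff_prob_eq_one ((hm 1).union (hm (-1))) |>.2 hu

theorem integral_prod (hν : IsSignMeasure β ν) (hβ : β ∈ Icc (-1 : ℝ) 1) (s : Finset ℕ)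
    (f : ℕ → ℝ → ℂ) :
    ∫ ω, ∏ j ∈ s, f j (ω j) ∂ν =
      ∏ j ∈ s, ((1 + β) / 2 * f j 1 + (1 - β) / 2 * f j (-1)) := by
  classical
  let ε : Finset ℕ → ℕ → ℝ := fun S j => if j ∈ S then 1 else -1
  let C : Finset ℕ → Set (ℕ → ℝ) := fun S => {ω | ∀ i ∈ s, ω i = ε S i}
  have hC : ∀ S, MeasurableSet (C S) := fun S => by
    have : C S = ⋂ i ∈ s, {ω | ω i = ε S i} := by ext ω; simp [C]
    rw [this]
    exact Finset.measurableSet_biInter _ fun i _ =>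
      measurable_pi_apply i (measurableSet_singleton _)
  have hexpand : ∀ᵐ ω ∂ν, ∏ j ∈ s, f j (ω j) =
      ∑ S ∈ s.powerset, (C S).indicator (fun _ => ∏ j ∈ s, f j (ε S j)) ω := by
    filter_upwards [ae_all_iff.2 (hν.ae_sign hβ)] with ω hω
    rw [Finset.sum_eq_single (s.filter fun j => ω j = 1)]
    · rw [indicator_of_mem]
      · refine Finset.prod_congr rfl fun j hj => ?_
        rcases hω j with h | h
        · simp [ε, hj, h]
        · simp [ε, h]
          norm_num
      · intro i hi
        rcases hω i with h | h <;> simp [ε, hi, h]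
    · intro S hS hne
      refine indicator_of_notMem (fun hmem => hne ?_) _
      ext j
      rw [Finset.mem_filter]
      constructor
      · intro hj
        have hjs := Finset.mem_powerset.1 hS hj
        exact ⟨hjs, by simpa [ε, hj] using hmem j hjs⟩
      · rintro ⟨hjs, hj⟩
        by_contra hcon
        have := hmem j hjs
        simp only [ε, hcon, if_false] at this
        linarith
    · intro h
      exact absurd (Finset.mem_powerset.2 (Finset.filter_subset _ _)) h
  rw [integral_congr_ae hexpand, integral_finsetSum _ fun S _ =>
    (integrable_const _).indicator (hC S), Finset.prod_add]
  refine Finset.sum_congr rfl fun S hS => ?_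
  have hSs := Finset.mem_powerset.1 hS
  rw [integral_indicator_const _ (hC S), measureReal_def,
    hν s (ε S) (fun i => by by_cases h : i ∈ S <;> simp [ε, h]), ENNReal.toReal_prod,
    Complex.real_smul, Complex.ofReal_prod, ← Finset.prod_mul_distrib,
    ← Finset.prod_sdiff hSs, mul_comm]
  congr 1
  · refine Finset.prod_congr rfl fun j hj => ?_
    rw [ENNReal.toReal_ofReal] <;> simp only [ε, hj, if_true]
    · push_cast; ring
    · linarith [hβ.1]
  · refine Finset.prod_congr rfl fun j hj => ?_
    have hj' := (Finset.mem_sdiff.1 hj).2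
    rw [ENNReal.toReal_ofReal] <;> simp only [ε, hj', if_false]
    · push_cast; ring
    · linarith [hβ.2]

end IsSignMeasure

namespace ThalerParam

variable {γ xs β : ℝ} {ν : Measure (ℕ → ℝ)} [IsProbabilityMeasure ν]

theorem one_le_tau (P : ThalerParam γ xs) {y : ℝ} (hy : y ∈ Ioc xs 1) : 1 ≤ thalerTau γ xs y := by
  rw [← P.iUnion_branch] at hy
  obtain ⟨k, hk⟩ := mem_iUnion.1 hy
  rw [P.tau_branch hk]
  omega

theorem iterate_F_mem (P : ThalerParam γ xs) {y : ℝ} (hy : y ∈ Ioc xs 1) (j : ℕ) :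
    (thalerF γ xs)^[j] y ∈ Ioc xs 1 :=
  MapsTo.iterate (fun _ h => P.F_mem h) j hy

theorem integral_prod_sign (P : ThalerParam γ xs) (hν : IsSignMeasure β ν)
    (hβ : β ∈ Icc (-1 : ℝ) 1) (a b : ℝ) (N : ℕ) :
    ∫ p : ℝ × (ℕ → ℝ), Complex.exp (Complex.I *
        ((a * ∑ j ∈ Finset.range N, p.2 j * (thalerTau γ xs ((thalerF γ xs)^[j] p.1) : ℝ) -
          b : ℝ) : ℂ)) ∂((thalerMuY γ xs).prod ν) =
      Complex.exp (-(Complex.I * b)) * ∫ y, ∏ j ∈ Finset.range N,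
        signSeq β a (thalerTau γ xs ((thalerF γ xs)^[j] y) - 1) ∂thalerMuY γ xs := by
  have := P.isProbabilityMeasure
  have hτ : ∀ j, Measurable fun p : ℝ × (ℕ → ℝ) =>
      (thalerTau γ xs ((thalerF γ xs)^[j] p.1) : ℝ) := fun j =>
    (measurable_from_nat (f := fun n : ℕ => (n : ℝ))).comp
      (measurable_thalerTau.comp ((measurable_thalerF.iterate j).comp measurable_fst))
  have hm : Measurable fun p : ℝ × (ℕ → ℝ) => Complex.exp (Complex.I *
      ((a * ∑ j ∈ Finset.range N, p.2 j * (thalerTau γ xs ((thalerF γ xs)^[j] p.1) : ℝ) -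
        b : ℝ) : ℂ)) := by
    refine Complex.measurable_exp.comp (Measurable.const_mul (Complex.measurable_ofReal.comp
      (((Finset.measurable_sum _ fun j _ => ?_).const_mul a).sub_const b)) _)
    exact ((measurable_pi_apply j).comp measurable_snd).mul (hτ j)
  have hint : Integrable (fun p : ℝ × (ℕ → ℝ) => Complex.exp (Complex.I *
      ((a * ∑ j ∈ Finset.range N, p.2 j * (thalerTau γ xs ((thalerF γ xs)^[j] p.1) : ℝ) -
        b : ℝ) : ℂ))) ((thalerMuY γ xs).prod ν) :=
    Integrable.of_bound hm.aestronglyMeasurable 1 (Eventually.of_forall fun p => by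
      rw [mul_comm, Complex.norm_exp_ofReal_mul_I])
  rw [MeasureTheory.integral_prod _ hint, ← integral_const_mul]
  refine integral_congr_ae ?_
  filter_upwards [P.ae_mem] with y hy
  have hsplit : ∀ ω : ℕ → ℝ, Complex.exp (Complex.I *
      ((a * ∑ j ∈ Finset.range N, ω j * (thalerTau γ xs ((thalerF γ xs)^[j] y) : ℝ) -
        b : ℝ) : ℂ)) = Complex.exp (-(Complex.I * b)) * ∏ j ∈ Finset.range N,
        Complex.exp (Complex.I * ((a * thalerTau γ xs ((thalerF γ xs)^[j] y) : ℝ) : ℂ) *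
          (ω j : ℂ)) := fun ω => by
    rw [← Complex.exp_sum, ← Complex.exp_add, Finset.mul_sum]
    push_cast
    rw [mul_sub, Finset.mul_sum, sub_eq_neg_add]
    congr 2
    exact Finset.sum_congr rfl fun j _ => by ring
  simp only [hsplit]
  rw [integral_const_mul, hν.integral_prod hβ (Finset.range N) fun j x =>
    Complex.exp (Complex.I * ((a * thalerTau γ xs ((thalerF γ xs)^[j] y) : ℝ) : ℂ) * (x : ℂ))]
  congr 1
  refine Finset.prod_congr rfl fun j _ => ?_
  have h1 : ((thalerTau γ xs ((thalerF γ xs)^[j] y) - 1 : ℕ) : ℝ) + 1 =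
      thalerTau γ xs ((thalerF γ xs)^[j] y) := by
    exact_mod_cast Nat.sub_add_cancel (P.one_le_tau (P.iterate_F_mem hy j))
  rw [signSeq, h1, signChar_eq]
  simp

end ThalerParam

/-- one-dimensional marginals of Theorem 3.1, via characteristic
functions: Fix `α ∈ (0,1) ∪ (1,2)`, `β ∈ [−1,1]`, `γ = 1/α`, and define
`W_n(t)(y,ω) = n^(−γ)·d_α^(−γ)·(Σ_{j<⌊nt⌋} ω_j τ(F^j y) − n t β ℓ_α)` on the product
probability space `(Y × {−1,1}^ℕ, μ_Y ⊗ ν_β^{⊗ℕ})`.  Then for every `t ≥ 0` and every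
`s ∈ ℝ`, `∫ exp(i s W_n(t)) → exp(−t |s|^α (1 − i β sgn(s) tan(απ/2)))` as `n → ∞`;
that is, `W_n(t)` converges in distribution to the time-`t` marginal
`W_{α,1,β}(t) = t^(1/α)·X_{α,1,β}` of the α-stable Lévy process. -/
theorem thaler_levy_marginals (α : ℝ)
    (hα : α ∈ Set.Ioo (0 : ℝ) 1 ∪ Set.Ioo (1 : ℝ) 2)
    (β : ℝ) (hβ : β ∈ Set.Icc (-1 : ℝ) 1)
    (xs : ℝ) (hxs : xs ∈ Set.Ioo (0 : ℝ) 1)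
    (hxseq : xs ^ (1 - α⁻¹) + (1 + xs) ^ (1 - α⁻¹) = 2)
    (ν : Measure (ℕ → ℝ)) [IsProbabilityMeasure ν]
    (hν : ∀ (s : Finset ℕ) (ε : ℕ → ℝ), (∀ i, ε i = 1 ∨ ε i = -1) →
      ν {ω | ∀ i ∈ s, ω i = ε i} = ∏ i ∈ s, ENNReal.ofReal ((1 + β * ε i) / 2)) :
    ∀ t : ℝ, 0 ≤ t → ∀ s : ℝ,
      Tendsto
        (fun n : ℕ =>
          ∫ p : ℝ × (ℕ → ℝ), Complex.exp (Complex.I * (s : ℂ) *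
            (((n : ℝ) ^ (-α⁻¹) * stableDa α ^ (-α⁻¹) *
              ((∑ j ∈ Finset.range ⌊(n : ℝ) * t⌋₊,
                  p.2 j * (thalerTau α⁻¹ xs ((thalerF α⁻¹ xs)^[j] p.1) : ℝ))
                - n * t * β * stableLa α) : ℝ) : ℂ))
            ∂((thalerMuY α⁻¹ xs).prod ν))
        atTop
        (nhds (Complex.exp (-((t : ℝ) : ℂ) * ((|s| ^ α : ℝ) : ℂ) *
          (1 - Complex.I * (β : ℂ) * ((Real.sign s : ℝ) : ℂ) *
            ((Real.tan (α * π / 2) : ℝ) : ℂ))))) := by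
  intro t ht s
  have hα0 : 0 < α := by
    rcases hα with h | h
    · exact h.1
    · linarith [h.1]
  obtain ⟨κ, h⟩ : ∃ κ, StableIdx α κ := by
    rcases hα with h | h
    · exact ⟨0, Or.inl ⟨rfl, h⟩⟩
    · exact ⟨1, Or.inr ⟨rfl, h⟩⟩
  have P : ThalerParam α⁻¹ xs :=
    ⟨inv_pos.2 hα0, fun h1 => h.ne_one (inv_eq_one.1 h1), hxs, hxseq⟩
  have key := P.tendsto_integral_signSeq h hβ s ht
  rw [← mul_assoc, ← neg_mul, ← neg_mul] at key
  refine key.congr fun n => ?_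
  rw [show ((s * stableDa α ^ (-α⁻¹) * (n : ℝ) ^ (-α⁻¹) * (β * stableLa α) : ℝ) : ℂ) *
      ((n : ℂ) * t) = ((s * stableDa α ^ (-α⁻¹) * (n : ℝ) ^ (-α⁻¹) * (β * stableLa α) *
        (n * t) : ℝ) : ℂ) by push_cast; ring,
    ← P.integral_prod_sign (ν := ν) hν hβ]
  congr 1
  ext p
  rw [mul_assoc Complex.I, ← Complex.ofReal_mul]
  congr 3
  ring
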